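/- Let G be a maximal abelian subgroup of the Cremona group Bir(ℙ²), identified with the group of ℂ-algebra automorphisms of the field ℂ(x,y), and suppose G is uncountable. Then at least one of the following holds: (i) G contains a nontrivial element of finite order; (ii) G is conjugate in Bir(ℙ²) to a subgroup of the de Jonquières group dJ, where dJ is the subgroup of automorphisms φ of ℂ(x,y) with φ(ℂ(y)) = ℂ(y). -/

import Mathlib

noncomputable section Frz

open MvPolynomial


/-- The field `ℂ(x,y)` of rational functions in two variables. -/
abbrev K2 : Type := FractionRing (MvPolynomial (Fin 2) ℂ)

/-- The Cremona group, identified with the group of `ℂ`-algebra automorphisms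
of `ℂ(x,y)`. -/
abbrev Cremona : Type := K2 ≃ₐ[ℂ] K2

/-- The element `y` of `ℂ(x,y)`. -/
def yy : K2 := algebraMap (MvPolynomial (Fin 2) ℂ) K2 (X 1)

/-- The subfield `ℂ(y)` of `ℂ(x,y)`. -/
def CY : Subfield K2 := Subfield.closure (Set.range (algebraMap ℂ K2) ∪ {yy})

/-- The de Jonquières group: the automorphisms `φ` of `ℂ(x,y)` with
`φ(ℂ(y)) = ℂ(y)`. -/
def deJonquieres : Set Cremona :=
  {f | CY.map (f : K2 ≃ₐ[ℂ] K2).toRingEquiv.toRingHom = CY}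


end Frz


set_option linter.all false

theorem der_ext {A L : Type*} [CommRing A] [Field L] [Algebra A L]
    [Algebra.FormallySmooth A L] (d : Derivation ℤ A L) :
    ∃ D : Derivation ℤ L L, ∀ a : A, D (algebraMap A L a) = d a := by
  let φ : A →+* TrivSqZeroExt L L :=
    { toFun := fun a => TrivSqZeroExt.inl (algebraMap A L a) + TrivSqZeroExt.inr (d a)
      map_one' := by ext <;> simp
      map_zero' := by ext <;> simp
      map_add' := by intro a b; ext <;> simp
      map_mul' := by
        intro a b
        ext
        · simp
        · simp [Algebra.smul_def, -TrivSqZeroExt.inl_mul, -DualNumber.inr_eq_smul_eps, mul_comm] }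
  letI : Algebra A (TrivSqZeroExt L L) := φ.toAlgebra
  have hφ : ∀ a, algebraMap A (TrivSqZeroExt L L) a = 
    TrivSqZeroExt.inl (algebraMap A L a) + TrivSqZeroExt.inr (d a) := fun a => rfl
  let g : TrivSqZeroExt L L →ₐ[A] L :=
    { (TrivSqZeroExt.fstHom ℤ L L).toRingHom with
      commutes' := by intro a; simp [hφ] }
  have hgs : Function.Surjective g := fun x => ⟨TrivSqZeroExt.inl x, by simp [g]⟩
  have hnil : IsNilpotent (RingHom.ker (g : TrivSqZeroExt L L →+* L)) := by
    refine ⟨2, ?_⟩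
    refine (pow_two (M := Ideal (TrivSqZeroExt L L)) _).trans ?_
    rw [Ideal.zero_eq_bot, eq_bot_iff, Ideal.mul_le]
    intro r hr s hs
    have hr' : r.fst = 0 := hr
    have hs' : s.fst = 0 := hs
    simp only [Ideal.mem_bot]
    ext <;> simp [hr', hs']
  let ψ : L →ₐ[A] TrivSqZeroExt L L := Algebra.FormallySmooth.liftOfSurjective
    (AlgHom.id A L) g hgs hnil
  have hψ : ∀ x, (ψ x).fst = x := by
    intro x
    exact Algebra.FormallySmooth.liftOfSurjective_apply (AlgHom.id A L) g hgs hnil x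
  refine ⟨Derivation.mk' (AddMonoidHom.toIntLinearMap
    { toFun := fun x => (ψ x).snd, map_zero' := by simp, map_add' := by intros; simp }) ?_, ?_⟩
  · intro a b
    simp [hψ, mul_comm]
  · intro a
    change (ψ (algebraMap A L a)).snd = d a
    rw [ψ.commutes, hφ]; simp

/-- extension to a field algebraic over a domain of characteristic zero -/
theorem der_ext_alg {A L : Type*} [CommRing A] [IsDomain A] [CharZero A] [Field L] [Algebra A L]
    [FaithfulSMul A L] [Algebra.IsAlgebraic A L] (d : Derivation ℤ A L) :
    ∃ D : Derivation ℤ L L, ∀ a : A, D (algebraMap A L a) = d a := by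
  let K := FractionRing A
  haveI : CharZero K := inferInstance
  letI : Algebra K L := FractionRing.liftAlgebra A L
  haveI : IsScalarTower A K L := FractionRing.isScalarTower_liftAlgebra A L
  haveI : Algebra.IsAlgebraic K L := (IsFractionRing.comap_isAlgebraic_iff (A := A) (K := K) (C := L)).1 inferInstance
  haveI : Algebra.FormallyEtale K L := Algebra.FormallyEtale.of_isSeparable K L
  haveI : Algebra.FormallyEtale A K := Algebra.FormallyEtale.of_isLocalization (nonZeroDivisors A)
  haveI : Algebra.FormallyEtale A L := Algebra.FormallyEtale.comp A K L
  exact der_ext d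

theorem der_alg_zero {K L : Type*} [Field K] [Field L] [Algebra K L] [CharZero K]
    {D : Derivation ℤ L L} (h : ∀ a : K, D (algebraMap K L a) = 0) {x : L}
    (hx : IsAlgebraic K x) : D x = 0 := by
  have hp := minpoly.aeval K x
  have hsep := (minpoly.irreducible hx.isIntegral).separable
  let D' : Derivation K L L := Derivation.mk'
    { toFun := D, map_add' := by simp, 
      map_smul' := by intro m x; simp [Algebra.smul_def, h] } (by intro a b; simp)
  have h1 := D'.map_aeval (minpoly K x) x
  rw [hp, map_zero, eq_comm, smul_eq_mul, mul_eq_zero] at h1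
  exact h1.resolve_left (hsep.aeval_derivative_ne_zero hp)

theorem mvpoly_alg {k L ι : Type*} [Field k] [Field L] [Algebra k L] {v : ι → L}
    (hB : IsTranscendenceBasis k v) (x : L) :
    ∃ p : Polynomial (MvPolynomial ι k), p ≠ 0 ∧ 
      p.eval₂ (MvPolynomial.aeval v).toRingHom x = 0 := by
  have := hB.isAlgebraic
  have hx := this.isAlgebraic x
  obtain ⟨p, hp0, hp⟩ := hx
  let e := hB.1.aevalEquiv.symm
  refine ⟨p.map (e : _ →+* MvPolynomial ι k), ?_, ?_⟩
  · rwa [Ne, Polynomial.map_eq_zero_iff (RingEquiv.injective _)]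
  · rw [Polynomial.eval₂_map]
    rw [Polynomial.aeval_def] at hp
    convert hp using 1
    congr 1
    refine RingHom.ext fun a => ?_
    obtain ⟨q, rfl⟩ := hB.1.aevalEquiv.surjective a
    simp [e]

/-- a derivation which is nonzero at a transcendental element -/
theorem exists_der {L : Type*} [Field L] [CharZero L] (k : Subfield L) {c : L}
    (hc : Transcendental k c) : ∃ D : Derivation ℤ L L, (∀ a ∈ k, D a = 0) ∧ D c = 1 := by
  have hind : AlgebraicIndepOn k id ({c} : Set L) :=
    (algebraicIndependent_unique_type_iff (R := k) (x := fun i : ({c} : Set L) => (i : L))).2 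
      (by simpa using hc)
  obtain ⟨B, hcB, hB⟩ := exists_isTranscendenceBasis_superset hind
  have hcB' : c ∈ B := hcB rfl
  let v : B → L := Subtype.val
  letI : Algebra (MvPolynomial B k) L := (MvPolynomial.aeval v).toRingHom.toAlgebra
  have hal : ∀ p, algebraMap (MvPolynomial B k) L p = MvPolynomial.aeval v p := fun p => rfl
  have hinj : Function.Injective (algebraMap (MvPolynomial B k) L) := hB.1
  haveI : FaithfulSMul (MvPolynomial B k) L := (faithfulSMul_iff_algebraMap_injective _ _).2 hinj
  haveI : Algebra.IsAlgebraic (MvPolynomial B k) L := ⟨fun x => mvpoly_alg hB x⟩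
  haveI : IsScalarTower k (MvPolynomial B k) L := IsScalarTower.of_algebraMap_eq (by
    intro a; simp [hal, MvPolynomial.algebraMap_eq])
  classical
  let d : Derivation k (MvPolynomial B k) L := 
    MvPolynomial.mkDerivation k (fun i : B => if (i : L) = c then 1 else 0)
  obtain ⟨D, hD⟩ := der_ext_alg (d.restrictScalars ℤ)
  refine ⟨D, fun a ha => ?_, ?_⟩
  · have := hD (MvPolynomial.C ⟨a, ha⟩)
    have h2 : d.restrictScalars ℤ (MvPolynomial.C ⟨a, ha⟩) = 0 := MvPolynomial.derivation_C d _
    have h3 := this.trans h2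
    rw [hal, MvPolynomial.aeval_C] at h3
    exact h3
  · have := hD (MvPolynomial.X ⟨c, hcB'⟩)
    have h2 : d.restrictScalars ℤ (MvPolynomial.X ⟨c, hcB'⟩) = 1 := by
      change d (MvPolynomial.X ⟨c, hcB'⟩) = 1
      simp [d]
    have h3 := this.trans h2
    rw [hal, MvPolynomial.aeval_X] at h3
    exact h3

theorem aut_lift {L : Type*} [Field L] [IsAlgClosed L] {A : Type*} [Field A] [Algebra A L]
    (τ : A ≃+* A) : ∃ σ : L ≃+* L, ∀ a, σ (algebraMap A L a) = algebraMap A L (τ a) := by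
  obtain ⟨B, hB⟩ := exists_isTranscendenceBasis A L
  let v : B → L := Subtype.val
  letI : Algebra (MvPolynomial B A) L := (MvPolynomial.aeval v).toRingHom.toAlgebra
  have hal : ∀ p, algebraMap (MvPolynomial B A) L p = MvPolynomial.aeval v p := fun p => rfl
  have hinj : Function.Injective (algebraMap (MvPolynomial B A) L) := hB.1
  haveI : FaithfulSMul (MvPolynomial B A) L := (faithfulSMul_iff_algebraMap_injective _ _).2 hinj
  haveI : Module.IsTorsionFree (MvPolynomial B A) L := inferInstance
  haveI : IsAlgClosure (MvPolynomial B A) L := ⟨inferInstance, ⟨fun x => mvpoly_alg hB x⟩⟩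
  let e : MvPolynomial B A ≃+* MvPolynomial B A := MvPolynomial.mapEquiv B τ
  refine ⟨IsAlgClosure.equivOfEquiv L L e, fun a => ?_⟩
  have := IsAlgClosure.equivOfEquiv_algebraMap L L e (MvPolynomial.C a)
  rw [hal, MvPolynomial.aeval_C, hal] at this
  rw [this]
  simp [e]

theorem exists_aut {L : Type*} [Field L] [CharZero L] [IsAlgClosed L] (k : Subfield L) {c : L}
    (hc : IsAlgebraic k c) (hck : c ∉ k) : ∃ σ : L ≃+* L, (∀ a ∈ k, σ a = a) ∧ σ c ≠ c := by
  let A := algebraicClosure k L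
  have hcA : c ∈ A := mem_algebraicClosure_iff.2 hc
  haveI : IsAlgClosure k A := inferInstance
  haveI : IsGalois k A := inferInstance
  have : ∃ τ : A ≃ₐ[k] A, τ ⟨c, hcA⟩ ≠ ⟨c, hcA⟩ := by
    by_contra! h
    have := (InfiniteGalois.mem_bot_iff_fixed (k := k) (K := A) ⟨c, hcA⟩).2 h
    rw [IntermediateField.mem_bot] at this
    obtain ⟨y, hy⟩ := this
    apply hck
    have : (y : L) = c := congrArg (Subtype.val) hy
    rw [← this]; exact y.2
  obtain ⟨τ, hτ⟩ := this
  obtain ⟨σ, hσ⟩ := aut_lift (L := L) τ.toRingEquiv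
  refine ⟨σ, fun a ha => ?_, fun h => hτ ?_⟩
  · have := hσ (algebraMap k A ⟨a, ha⟩)
    have h2 : τ.toRingEquiv (algebraMap k A ⟨a, ha⟩) = algebraMap k A ⟨a, ha⟩ := τ.commutes _
    rw [h2] at this
    exact this
  · have := hσ ⟨c, hcA⟩
    apply Subtype.ext
    exact this.symm.trans h

set_option linter.all false

section B1
open Polynomial

variable {M : Type*} [Field M]

noncomputable def pD (D : Derivation ℤ M M) (p : M[X]) : M[X] :=
  ∑ i ∈ Finset.range (p.natDegree + 1), monomial i (D (p.coeff i))

theorem coeff_pD (D : Derivation ℤ M M) (p : M[X]) (n : ℕ) : (pD D p).coeff n = D (p.coeff n) := by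
  simp only [pD, finset_sum_coeff, coeff_monomial]
  rw [Finset.sum_ite_eq' (Finset.range (p.natDegree + 1)) n]
  split_ifs with h
  · rfl
  · rw [coeff_eq_zero_of_natDegree_lt (by simpa using h), map_zero]

noncomputable def psD (D : Derivation ℤ M M) (f : PowerSeries M) : PowerSeries M :=
  PowerSeries.mk fun n => D (PowerSeries.coeff n f)

theorem psD_coe (D : Derivation ℤ M M) (p : M[X]) : psD D (p : PowerSeries M) = (pD D p : M[X]) := by
  ext n; simp [psD, coeff_pD]

theorem psD_mul (D : Derivation ℤ M M) (f g : PowerSeries M) :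
    psD D (f * g) = psD D f * g + f * psD D g := by
  ext n
  simp only [psD, PowerSeries.coeff_mk, map_add, PowerSeries.coeff_mul, map_sum, Derivation.leibniz,
    smul_eq_mul, ← Finset.sum_add_distrib]
  refine Finset.sum_congr rfl fun i _ => by ring

noncomputable def cs (D : Derivation ℤ M M) (ε : M) (f : M) : ℕ → M
  | 0 => f
  | n + 1 => (D (cs D ε f n) - ε * n * cs D ε f n) / (n + 1)

noncomputable def csP (D : Derivation ℤ M M) (ε : M) (f : M) : PowerSeries M := 
  PowerSeries.mk (cs D ε f)

theorem csP_ode [CharZero M] (D : Derivation ℤ M M) (ε : M) (f : M) :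
    (1 + PowerSeries.C ε * PowerSeries.X) * PowerSeries.derivative M (csP D ε f) = psD D (csP D ε f) := by
  ext n
  rw [add_mul, one_mul, map_add, mul_assoc, PowerSeries.coeff_C_mul]
  have key : ∀ n, cs D ε f (n+1) * ((n:M) + 1) = D (cs D ε f n) - ε * n * cs D ε f n := by
    intro n
    have : (n:M) + 1 ≠ 0 := by exact_mod_cast Nat.succ_ne_zero n
    rw [cs]; field_simp
  cases n with
  | zero => 
    have := key 0
    simp at this
    simp [PowerSeries.coeff_derivative, csP, psD, this]
  | succ n =>
    rw [PowerSeries.coeff_succ_X_mul]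
    simp only [PowerSeries.coeff_derivative, csP, psD, PowerSeries.coeff_mk]
    have := key (n+1)
    push_cast at this ⊢
    rw [this]; ring

def RatPS (c : PowerSeries M) : Prop := ∃ N P : M[X], N ≠ 0 ∧ c * (N : PowerSeries M) = (P : PowerSeries M)

theorem rat_min [CharZero M] (D : Derivation ℤ M M) (ε : M) (f : M) (hr : RatPS (csP D ε f)) :
    ∃ Q P : M[X], Q.coeff 0 ≠ 0 ∧ P.coeff 0 = f * Q.coeff 0 ∧ 
      (∃ r : ℕ, (1 + C ε * X) * derivative Q - pD D Q = C (ε * r) * Q ∧ 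
      (1 + C ε * X) * derivative P - pD D P = C (ε * r) * P) := by
  classical
  set c := csP D ε f with hc
  have hex : ∃ n, ∃ N P : M[X], N ≠ 0 ∧ N.natDegree = n ∧ c * (N : PowerSeries M) = (P : PowerSeries M) := by
    obtain ⟨N, P, h, h'⟩ := hr
    exact ⟨_, N, P, h, rfl, h'⟩
  obtain ⟨Q₀, P₀, hQ₀, hdeg₀, hcQ₀⟩ := Nat.find_spec hex
  set d := Nat.find hex with hd
  have hmin : ∀ N P : M[X], N.natDegree < d → c * (N : PowerSeries M) = (P : PowerSeries M) → N = 0 := by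
    intro N P hlt h
    by_contra hN
    exact Nat.find_min hex hlt ⟨N, P, hN, rfl, h⟩
  -- normalise
  set Q := C (Q₀.leadingCoeff⁻¹) * Q₀ with hQ
  set P := C (Q₀.leadingCoeff⁻¹) * P₀ with hP
  have hlc : Q₀.leadingCoeff ≠ 0 := leadingCoeff_ne_zero.2 hQ₀
  have hQm : Q.Monic := by
    rw [hQ, mul_comm]; exact monic_mul_leadingCoeff_inv hQ₀
  have hQd : Q.natDegree = d := by rw [hQ, natDegree_C_mul (inv_ne_zero hlc), hdeg₀]
  have hcQ : c * (Q : PowerSeries M) = (P : PowerSeries M) := by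
    simp only [hQ, hP, Polynomial.coe_mul, ← hcQ₀]; ring
  have hf : PowerSeries.coeff 0 c = f := by simp [hc, csP, cs]
  have hP0 : P.coeff 0 = f * Q.coeff 0 := by
    have := congrArg (PowerSeries.coeff 0) hcQ
    rw [PowerSeries.coeff_zero_eq_constantCoeff] at this hf
    rw [map_mul, hf] at this
    simpa using this.symm
  refine ⟨Q, P, ?_, hP0, d, ?_⟩
  · intro h0
    obtain ⟨Q', hQ'⟩ := X_dvd_iff.2 h0
    obtain ⟨P', hP'⟩ := X_dvd_iff.2 (by rw [hP0, h0, mul_zero] : P.coeff 0 = 0)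
    have hQ'0 : Q' ≠ 0 := by rintro rfl; simp at hQ'; exact hQm.ne_zero hQ'
    apply hQ'0
    refine hmin Q' P' ?_ ?_
    · rw [← hQd, hQ', natDegree_X_mul hQ'0]; omega
    · have : PowerSeries.X * (c * (Q' : PowerSeries M)) = PowerSeries.X * (P' : PowerSeries M) := by
        rw [hQ', hP'] at hcQ
        simp only [Polynomial.coe_mul, Polynomial.coe_X] at hcQ
        rw [← hcQ]; ring
      exact mul_left_cancel₀ PowerSeries.X_ne_zero this
  · set A := (1 + C ε * X) * derivative Q - pD D Q with hA
    set B := (1 + C ε * X) * derivative P - pD D P with hB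
    have hcA : c * (A : PowerSeries M) = (B : PowerSeries M) := by
      have ode := csP_ode D ε f
      rw [← hc] at ode
      have e1 : PowerSeries.derivative M (c * (Q : PowerSeries M)) = (derivative P : M[X]) := by
        rw [hcQ, PowerSeries.derivative_coe]
      have e2 : psD D (c * (Q : PowerSeries M)) = (pD D P : M[X]) := by rw [hcQ, psD_coe]
      rw [psD_mul, psD_coe, ← ode] at e2
      rw [Derivation.leibniz, PowerSeries.derivative_coe] at e1
      simp only [smul_eq_mul] at e1
      simp only [hA, hB, Polynomial.coe_sub, Polynomial.coe_mul, Polynomial.coe_add, 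
        Polynomial.coe_one, Polynomial.coe_C, Polynomial.coe_X, ← e1, ← e2]
      ring
    set E := A - C (ε * d) * Q with hE
    have hcE : c * (E : PowerSeries M) = ((B - C (ε * d) * P : M[X]) : PowerSeries M) := by
      simp only [hE, Polynomial.coe_sub, Polynomial.coe_mul, mul_sub, hcA, ← hcQ]
      ring
    have hEc : ∀ n, E.coeff n = (n + 1) * Q.coeff (n+1) + ε * n * Q.coeff n - D (Q.coeff n) - ε * d * Q.coeff n := by
      intro n
      have : (1 + C ε * X) * derivative Q = derivative Q + C ε * (X * derivative Q) := by ring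
      simp only [hE, hA, this, coeff_sub, coeff_add, coeff_C_mul, coeff_pD, coeff_derivative]
      cases n with
      | zero => simp
      | succ n => rw [coeff_X_mul, coeff_derivative]; push_cast; ring
    have hQtop : Q.coeff d = 1 := by rw [← hQd]; exact hQm
    have hE0 : E = 0 := by
      by_cases hd0 : d = 0
      · have hQ1 : Q = 1 := by rw [← hQm.natDegree_eq_zero]; omega
        ext n
        rw [hEc]
        simp only [hQ1, hd0]
        rcases n with _ | n <;> simp [coeff_one]
      · apply hmin _ _ _ hcE
        by_contra hge
        have hge : d ≤ E.natDegree := not_lt.1 hge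
        have h0 : E.coeff E.natDegree = 0 := by
          rw [hEc, coeff_eq_zero_of_natDegree_lt (n := E.natDegree + 1) (by omega)]
          rcases hge.eq_or_lt with h | h
          · rw [← h, hQtop]; simp
          · rw [coeff_eq_zero_of_natDegree_lt (n := E.natDegree) (by omega)]; simp
        have : E = 0 := leadingCoeff_eq_zero.1 h0
        rw [this] at hge; simp at hge; omega
    constructor
    · rw [hE, sub_eq_zero] at hE0; exact hE0
    · rw [hE0] at hcE
      simp only [Polynomial.coe_zero, mul_zero] at hcE
      have := (Polynomial.coe_eq_zero_iff).1 hcE.symm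
      rwa [sub_eq_zero] at this

theorem rat_add [CharZero M] (D : Derivation ℤ M M) (f : M) (hr : RatPS (csP D 0 f)) :
    f ∈ Subfield.closure {b : M | ∃ n : ℕ, D^[n] b = 0} := by
  obtain ⟨Q, P, hQ0, hP0, r, hQ, hP⟩ := rat_min D 0 f hr
  have aux : ∀ R : M[X], (1 + C (0:M) * X) * derivative R - pD D R = C (0 * (r:M)) * R → 
      ∃ n : ℕ, D^[n] (R.coeff 0) = 0 := by
    intro R hR
    have h1 : ∀ n, D (R.coeff n) = (n+1) * R.coeff (n+1) := by
      intro n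
      have := congrArg (fun p => coeff p n) hR
      simp [coeff_pD, coeff_derivative, sub_eq_zero] at this
      rw [← this]; ring
    have h2 : ∀ n, D^[n] (R.coeff 0) = (n.factorial : M) * R.coeff n := by
      intro n
      induction n with
      | zero => simp
      | succ n ih => 
        rw [Function.iterate_succ_apply', ih, Derivation.leibniz, Derivation.map_natCast, h1,
          Nat.factorial_succ]
        simp only [smul_eq_mul]; push_cast; ring
    exact ⟨R.natDegree + 1, by rw [h2, coeff_eq_zero_of_natDegree_lt (by omega), mul_zero]⟩
  have : f = P.coeff 0 / Q.coeff 0 := by rw [hP0]; field_simp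
  rw [this]
  exact div_mem (Subfield.subset_closure (aux P hP)) (Subfield.subset_closure (aux Q hQ))

theorem rat_mul [CharZero M] (D : Derivation ℤ M M) (f : M) (hr : RatPS (csP D 1 f)) :
    f ∈ Subfield.closure {b : M | ∃ n : ℤ, D b = n * b} := by
  obtain ⟨Q, P, hQ0, hP0, r, hQ, hP⟩ := rat_min D 1 f hr
  have aux : ∀ R : M[X], (1 + C (1:M) * X) * derivative R - pD D R = C (1 * (r:M)) * R → 
      R.coeff 0 ∈ Subfield.closure {b : M | ∃ n : ℤ, D b = n * b} := by
    intro R hR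
    set S := R.comp (X - 1) with hS
    have hRS : R = S.comp (X + 1) := by simp [hS, comp_assoc]
    have hpc : ∀ T : M[X], pD D (T.comp (X - 1)) = (pD D T).comp (X - 1) := by
      intro T
      induction T using Polynomial.induction_on' with
      | add p q hp hq => 
        have hadd : ∀ p q : M[X], pD D (p + q) = pD D p + pD D q := by
          intro p q; ext n; simp [coeff_pD]
        rw [add_comp, hadd, hp, hq, hadd, add_comp]
      | monomial n a =>
        have hm : pD D (monomial n a) = monomial n (D a) := by
          ext m; simp [coeff_pD, coeff_monomial]; split_ifs <;> simp
        rw [hm, monomial_comp, monomial_comp]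
        have hz : ∀ m, D (((X - 1 : M[X]) ^ n).coeff m) = 0 := by
          intro m
          have : (X - 1 : M[X]) ^ n = ((X - 1 : ℤ[X]) ^ n).map (Int.castRingHom M) := by simp
          rw [this, coeff_map]; simp
        ext m
        simp [coeff_pD, hz, mul_comm]
    have h1 : ∀ n, D (S.coeff n) = ((n:ℤ) - r : ℤ) * S.coeff n := by
      intro n
      have h3 := congrArg (fun p => p.comp (X - 1)) hR
      simp only [sub_comp, mul_comp, ← hpc, add_comp, one_comp, X_comp, C_comp, map_one, one_mul] at h3
      have h4 : derivative S = (derivative R).comp (X - 1) := by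
        rw [hS, derivative_comp]; simp
      rw [← h4, ← hS] at h3
      have h5 := congrArg (fun p => coeff p n) h3
      simp only [coeff_sub, coeff_pD, coeff_C_mul] at h5
      have h6 : ((1 + (X - 1)) * derivative S).coeff n = n * S.coeff n := by
        rw [add_sub_cancel]
        cases n with
        | zero => simp
        | succ n => rw [coeff_X_mul, coeff_derivative]; push_cast; ring
      rw [h6] at h5
      push_cast
      linear_combination -h5
    have h2 : R.coeff 0 = ∑ i ∈ Finset.range (S.natDegree + 1), S.coeff i := by
      rw [coeff_zero_eq_eval_zero, hRS, eval_comp]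
      have h0 : eval 0 (X + 1 : M[X]) = 1 := by simp
      rw [h0, eval_eq_sum_range]; simp
    rw [h2]
    exact sum_mem fun i _ => Subfield.subset_closure ⟨_, h1 i⟩
  have : f = P.coeff 0 / Q.coeff 0 := by rw [hP0]; field_simp
  rw [this]
  exact div_mem (aux P hP) (aux Q hQ)

theorem L1 [CharZero M] (D : Derivation ℤ M M) (gens : Set M) (hgen : Subfield.closure gens = ⊤)
    (hrat : ∀ f ∈ gens, RatPS (csP D 0 f)) (hD : D ≠ 0) :
    ∃ s, D s = 1 ∧ Subfield.closure ({a | D a = 0} ∪ {s}) = ⊤ := by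
  have hnil : Subfield.closure {b : M | ∃ n : ℕ, D^[n] b = 0} = ⊤ := by
    rw [eq_top_iff, ← hgen, Subfield.closure_le]
    exact fun f hf => rat_add D f (hrat f hf)
  let L : Subfield M :=
    { carrier := {a | D a = 0}
      mul_mem' := by intro a b ha hb; simp_all
      one_mem' := by simp
      add_mem' := by intro a b ha hb; simp_all
      zero_mem' := by simp
      neg_mem' := by intro a ha; simp_all
      inv_mem' := by intro a ha; simp_all [Derivation.leibniz_inv] }
  have hb : ∃ b n, D^[n] b = 0 ∧ D b ≠ 0 := by
    by_contra! h
    apply hD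
    have : Subfield.closure {b : M | ∃ n : ℕ, D^[n] b = 0} ≤ L := by
      rw [Subfield.closure_le]
      rintro b ⟨n, hn⟩
      exact h b n hn
    rw [hnil] at this
    ext a
    exact this (Subfield.mem_top a)
  obtain ⟨b, n, hn, hDb⟩ := hb
  classical
  have hex : ∃ n, D^[n] b = 0 := ⟨n, hn⟩
  obtain ⟨m, hm⟩ : ∃ m, Nat.find hex = m + 2 := by
    have h0 : Nat.find hex ≠ 0 := by
      intro h; have := Nat.find_spec hex; rw [h] at this; simp at this; simp [this] at hDb
    have h1 : Nat.find hex ≠ 1 := by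
      intro h; have := Nat.find_spec hex; rw [h] at this; simp at this; exact hDb this
    exact ⟨Nat.find hex - 2, by omega⟩
  have hz : D (D^[m+1] b) = 0 := by
    have := Nat.find_spec hex; rw [hm] at this; rwa [← Function.iterate_succ_apply' (⇑D)]
  have hnz : D^[m+1] b ≠ 0 := Nat.find_min hex (by omega)
  set s := D^[m] b / D^[m+1] b with hs
  have hDs : D s = 1 := by
    rw [hs, Derivation.leibniz_div, hz, ← Function.iterate_succ_apply' D]
    simp only [smul_eq_mul]; field_simp; ring
  refine ⟨s, hDs, ?_⟩
  rw [eq_top_iff, ← hnil, Subfield.closure_le]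
  rintro a ⟨n, hn⟩
  induction n generalizing a with
  | zero => simp at hn; rw [hn]; exact zero_mem _
  | succ n ih =>
    set l := D^[n] a with hl
    have hDl : D l = 0 := by rw [hl, ← Function.iterate_succ_apply' (⇑D)]; exact hn
    have hpow : ∀ j i : ℕ, D^[i] (l * s ^ j / j.factorial) = if i ≤ j then l * s ^ (j - i) / (j-i).factorial else 0 := by
      intro j i
      induction i with
      | zero => simp
      | succ i ih2 =>
        rw [Function.iterate_succ_apply', ih2]
        split_ifs with h1 h2 h2
        · have : j - i = (j - (i+1)) + 1 := by omega
          set t := j - (i+1)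
          rw [this, Derivation.leibniz_div, Derivation.leibniz, hDl, Derivation.map_natCast,
            Derivation.leibniz_pow, hDs, Nat.factorial_succ]
          have : ((t:M)+1) ≠ 0 := by exact_mod_cast Nat.succ_ne_zero t
          have : ((t.factorial:M)) ≠ 0 := by exact_mod_cast Nat.factorial_ne_zero t
          simp only [smul_eq_mul, Nat.add_sub_cancel, nsmul_eq_mul]
          push_cast
          field_simp; simp; ring
        · have : j - i = 0 := by omega
          rw [this]; simp [hDl]
        · omega
        · simp
    have hsub : D^[n] (a - l * s ^ n / n.factorial) = 0 := by
      rw [iterate_map_sub, hpow]; simp [← hl]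
    have h1 := ih hsub
    have h2 : l * s ^ n / n.factorial ∈ Subfield.closure ({a | D a = 0} ∪ {s}) := by
      have e1 : l ∈ Subfield.closure ({a | D a = 0} ∪ {s}) := Subfield.subset_closure (Or.inl hDl)
      have e2 : s ∈ Subfield.closure ({a | D a = 0} ∪ {s}) := Subfield.subset_closure (Or.inr rfl)
      exact div_mem (mul_mem e1 (pow_mem e2 _)) (natCast_mem _ _)
    have h3 := add_mem h1 h2
    simpa using h3

end B1

set_option linter.all false

section C1
open Finset

variable {M : Type*} [Field M] {ι : Type*} [Fintype ι]

noncomputable def AA (c : ι → PowerSeries M) (D : ι → Derivation ℤ M M) (W : PowerSeries M) : PowerSeries M :=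
  ∑ l, c l * psD (D l) W

noncomputable def solC (c : ι → PowerSeries M) (D : ι → Derivation ℤ M M) (f : M) : ℕ → M
  | 0 => f
  | n + 1 => (∑ l, ∑ j : Fin (n+1), PowerSeries.coeff (n - j) (c l) * D l (solC c D f j)) / (n + 1)

noncomputable def sol (c : ι → PowerSeries M) (D : ι → Derivation ℤ M M) (f : M) : PowerSeries M :=
  PowerSeries.mk (solC c D f)

theorem psD_add (D : Derivation ℤ M M) (f g : PowerSeries M) :
    psD D (f + g) = psD D f + psD D g := by
  ext n; simp [psD]

theorem AA_add (c : ι → PowerSeries M) (D : ι → Derivation ℤ M M) (f g : PowerSeries M) :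
    AA c D (f + g) = AA c D f + AA c D g := by
  simp only [AA, psD_add, mul_add, sum_add_distrib]

theorem AA_mul (c : ι → PowerSeries M) (D : ι → Derivation ℤ M M) (f g : PowerSeries M) :
    AA c D (f * g) = AA c D f * g + f * AA c D g := by
  simp only [AA, psD_mul, sum_mul, mul_sum, ← sum_add_distrib]
  exact sum_congr rfl fun _ _ => by ring

theorem coeff_AA (c : ι → PowerSeries M) (D : ι → Derivation ℤ M M) (W : PowerSeries M) (n : ℕ) :
    PowerSeries.coeff n (AA c D W) =
      ∑ l, ∑ j : Fin (n+1), PowerSeries.coeff (n - j) (c l) * D l (PowerSeries.coeff j W) := by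
  simp only [AA, map_sum]
  refine sum_congr rfl fun l _ => ?_
  rw [mul_comm, PowerSeries.coeff_mul, Finset.Nat.sum_antidiagonal_eq_sum_range_succ_mk, Finset.sum_range]
  refine sum_congr rfl fun j _ => ?_
  simp [psD, mul_comm]

variable [CharZero M]

theorem sol_ode (c : ι → PowerSeries M) (D : ι → Derivation ℤ M M) (f : M) :
    PowerSeries.derivative M (sol c D f) = AA c D (sol c D f) := by
  ext n
  rw [coeff_AA, PowerSeries.coeff_derivative]
  have : (n:M) + 1 ≠ 0 := by exact_mod_cast Nat.succ_ne_zero n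
  simp only [sol, PowerSeries.coeff_mk]
  rw [solC]
  field_simp

theorem sol_zero (c : ι → PowerSeries M) (D : ι → Derivation ℤ M M) (f : M) :
    PowerSeries.coeff 0 (sol c D f) = f := by
  simp [sol, solC]

theorem sol_unique (c : ι → PowerSeries M) (D : ι → Derivation ℤ M M) {f : M} {W : PowerSeries M}
    (h0 : PowerSeries.coeff 0 W = f) (h : PowerSeries.derivative M W = AA c D W) : sol c D f = W := by
  ext n
  induction n using Nat.strong_induction_on with
  | _ n ih =>
  cases n with
  | zero => rw [sol_zero, h0]
  | succ n =>
    have h1 := congrArg (PowerSeries.coeff n) h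
    have h2 := congrArg (PowerSeries.coeff n) (sol_ode c D f)
    rw [coeff_AA, PowerSeries.coeff_derivative] at h1 h2
    have : (n:M) + 1 ≠ 0 := by exact_mod_cast Nat.succ_ne_zero n
    apply mul_right_cancel₀ this
    rw [h1, h2]
    refine sum_congr rfl fun l _ => sum_congr rfl fun j _ => ?_
    rw [ih j (by omega)]

theorem psD_C (D : Derivation ℤ M M) (a : M) (h : D a = 0) : psD D (PowerSeries.C a) = 0 := by
  ext n; simp only [psD, PowerSeries.coeff_mk, PowerSeries.coeff_C]
  split_ifs <;> simp [h]

theorem sol_const (c : ι → PowerSeries M) (D : ι → Derivation ℤ M M) {a : M} (h : ∀ l, D l a = 0) :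
    sol c D a = PowerSeries.C a := by
  apply sol_unique
  · simp
  · have : PowerSeries.derivative M (PowerSeries.C a) = 0 := by
      ext n; simp [PowerSeries.coeff_derivative, PowerSeries.coeff_C]
    rw [this]; simp [AA, psD_C _ _ (h _)]

noncomputable def solHom (c : ι → PowerSeries M) (D : ι → Derivation ℤ M M) : M →+* PowerSeries M where
  toFun := sol c D
  map_one' := by rw [sol_const]; simp; intro l; simp
  map_zero' := by rw [sol_const]; simp; intro l; simp
  map_mul' := by
    intro f g
    apply sol_unique
    · rw [PowerSeries.coeff_mul]; simp [sol_zero]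
    · rw [Derivation.leibniz, AA_mul, sol_ode, sol_ode]; simp only [smul_eq_mul]; ring
  map_add' := by
    intro f g
    apply sol_unique
    · rw [map_add, sol_zero, sol_zero]
    · rw [map_add, AA_add, sol_ode, sol_ode]

noncomputable def EE (d : Derivation ℤ M M) : M →+* PowerSeries M :=
  solHom (fun _ : Unit => 1) (fun _ => d)

theorem EE_ode (d : Derivation ℤ M M) (f : M) :
    PowerSeries.derivative M (EE d f) = psD d (EE d f) := by
  have := sol_ode (fun _ : Unit => 1) (fun _ => d) f
  simpa [AA, EE, solHom] using this

theorem EE_zero (d : Derivation ℤ M M) (f : M) : PowerSeries.coeff 0 (EE d f) = f := sol_zero _ _ f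

theorem EE_unique (d : Derivation ℤ M M) {f : M} {W : PowerSeries M}
    (h0 : PowerSeries.coeff 0 W = f) (h : PowerSeries.derivative M W = psD d W) : EE d f = W := 
  sol_unique _ _ h0 (by simpa [AA] using h)

theorem psD_EE (d D : Derivation ℤ M M) (hc : ∀ a, d (D a) = D (d a)) (f : M) :
    psD D (EE d f) = EE d (D f) := by
  symm
  apply EE_unique
  · simp only [psD, PowerSeries.coeff_mk, EE_zero]
  · have : PowerSeries.derivative M (psD D (EE d f)) = psD D (PowerSeries.derivative M (EE d f)) := by
      ext n; simp only [PowerSeries.coeff_derivative, psD, PowerSeries.coeff_mk, Derivation.leibniz]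
      have : D ((n:M)+1) = 0 := by simp
      rw [this]; simp [mul_comm]
    rw [this, EE_ode]
    ext n; simp [psD, hc]

theorem EE_const (d : Derivation ℤ M M) {f : M} (h : d f = 0) : EE d f = PowerSeries.C f :=
  sol_const _ _ (fun _ => h)

theorem EE_X (d : Derivation ℤ M M) {x : M} (h : d x = 1) : EE d x = PowerSeries.C x + PowerSeries.X := by
  apply EE_unique
  · simp
  · ext n
    rw [PowerSeries.coeff_derivative]
    simp only [psD, PowerSeries.coeff_mk, map_add, PowerSeries.coeff_C, PowerSeries.coeff_X]
    rcases n with _ | n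
    · simp [h]
    · simp; split_ifs <;> simp

/-- elements whose image series is rational form a subfield -/
def ratField (R : M →+* PowerSeries M) : Subfield M where
  carrier := {f | RatPS (R f)}
  mul_mem' := by
    rintro a b ⟨N, P, hN, h⟩ ⟨N', P', hN', h'⟩
    refine ⟨N * N', P * P', mul_ne_zero hN hN', ?_⟩
    rw [map_mul, Polynomial.coe_mul, Polynomial.coe_mul, ← h, ← h']; ring
  one_mem' := ⟨1, 1, one_ne_zero, by simp⟩
  add_mem' := by
    rintro a b ⟨N, P, hN, h⟩ ⟨N', P', hN', h'⟩
    refine ⟨N * N', P * N' + P' * N, mul_ne_zero hN hN', ?_⟩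
    rw [map_add, Polynomial.coe_mul, Polynomial.coe_add, Polynomial.coe_mul, Polynomial.coe_mul, ← h, ← h']; ring
  zero_mem' := ⟨1, 0, one_ne_zero, by simp⟩
  neg_mem' := by
    rintro a ⟨N, P, hN, h⟩
    refine ⟨N, -P, hN, ?_⟩
    rw [Polynomial.coe_neg, ← h, map_neg]; ring
  inv_mem' := by
    rintro a ⟨N, P, hN, h⟩
    by_cases ha : a = 0
    · subst ha; exact ⟨1, 0, one_ne_zero, by simp⟩
    have hR : R a⁻¹ * R a = 1 := by rw [← map_mul, inv_mul_cancel₀ ha, map_one]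
    refine ⟨P, N, ?_, ?_⟩
    · rintro rfl
      have : R a ≠ 0 := by intro h0; rw [h0] at hR; simp at hR
      have h2 : (N : PowerSeries M) = 0 := (mul_eq_zero.mp (by simpa using h)).resolve_left this
      exact hN (by simpa using h2)
    · rw [← h, ← mul_assoc, hR, one_mul]

theorem ratC (a : M) : RatPS (PowerSeries.C a) := ⟨1, Polynomial.C a, one_ne_zero, by simp⟩

/-- The flow `G` is rational. -/
theorem flow_rat (d : Derivation ℤ M M) (D : ι → Derivation ℤ M M) (f : ι → M) (x : M)
    (hcomm : ∀ l a, d (D l a) = D l (d a))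
    (hdx : d x = 1) (hDx : ∀ l, D l x = 0) (hgen : Subfield.closure ({a | d a = 0} ∪ {x}) = ⊤)
    (H : M →+* M) (hHx : H x = x) (hHs : Function.Surjective H)
    (hH : ∀ a, d a = 0 → d (H a) = ∑ l, f l * D l (H a)) (g : M) :
    RatPS (sol (fun l => EE d (f l)) D g) := by
  set G := solHom (fun l => EE d (f l)) D with hG
  have hE : ∀ g, RatPS (EE d g) := by
    have : (⊤ : Subfield M) ≤ ratField (EE d) := by
      rw [← hgen, Subfield.closure_le]
      rintro a (ha | rfl)
      · show RatPS _
        rw [EE_const d ha]; exact ratC _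
      · show RatPS _
        rw [EE_X d hdx]
        exact ⟨1, Polynomial.C a + Polynomial.X, one_ne_zero, by simp⟩
    exact fun g => this (Subfield.mem_top g)
  have key : (⊤ : Subfield M) ≤ (ratField G).comap H := by
    rw [← hgen, Subfield.closure_le]
    rintro a (ha | rfl)
    · show RatPS (sol _ _ (H a))
      rw [sol_unique (W := EE d (H a)) _ _ (EE_zero _ _)]
      · exact hE _
      · rw [EE_ode, psD_EE _ _ (fun _ => rfl), hH a ha, AA, map_sum]
        exact sum_congr rfl fun l _ => by rw [map_mul, psD_EE _ _ (hcomm l)]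
    · show RatPS (sol _ _ (H a))
      rw [hHx, sol_const _ _ hDx]; exact ratC _
  obtain ⟨b, rfl⟩ := hHs g
  exact key (Subfield.mem_top b)

end C1

set_option linter.all false

section C2
open Finset

variable {M : Type*} [Field M] {Ω : Type*} [Field Ω] 

def lge (x : LaurentSeries Ω) (a : ℤ) : Prop := ∀ i < a, x.coeff i = 0

theorem lge_mul {x y : LaurentSeries Ω} {a b : ℤ} (hx : lge x a) (hy : lge y b) :
    lge (x * y) (a + b) ∧ (x * y).coeff (a + b) = x.coeff a * y.coeff b := by
  constructor
  · intro i hi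
    rw [HahnSeries.coeff_mul]
    apply sum_eq_zero
    rintro ⟨u, v⟩ huv
    simp only [Finset.mem_antidiagonal, HahnSeries.mem_support] at huv
    obtain ⟨h1, h2, h3⟩ := huv
    have : a ≤ u := by by_contra! h; exact h1 (hx u h)
    have : b ≤ v := by by_contra! h; exact h2 (hy v h)
    omega
  · rw [HahnSeries.coeff_mul]
    rw [sum_eq_single (a,b)]
    · rintro ⟨u, v⟩ huv hne
      simp only [Finset.mem_antidiagonal, HahnSeries.mem_support] at huv
      obtain ⟨h1, h2, h3⟩ := huv
      have : a ≤ u := by by_contra! h; exact h1 (hx u h)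
      have : b ≤ v := by by_contra! h; exact h2 (hy v h)
      exact absurd (Prod.ext (show u = a by omega) (show v = b by omega)) hne
    intro h
    simp only [Finset.mem_antidiagonal, HahnSeries.mem_support, not_and_or, not_not] at h
    rcases h with h | h | h
    · simp [h]
    · simp [h]
    · simp at h

theorem lge_mono {x : LaurentSeries Ω} {a b : ℤ} (hx : lge x a) (h : b ≤ a) : lge x b :=
  fun i hi => hx i (by omega)

theorem lge_sum {κ : Type*} (t : Finset κ) (x : κ → LaurentSeries Ω) (a : ℤ) (h : ∀ k ∈ t, lge (x k) a) :
    lge (∑ k ∈ t, x k) a := by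
  intro i hi
  rw [HahnSeries.coeff_sum]
  exact sum_eq_zero fun k hk => h k hk i hi

/-- generic rationality of the limit -/
theorem limit_rat (s : M →+* LaurentSeries Ω) (W : PowerSeries M) (hW : RatPS W) (p : ℤ) (c : PowerSeries Ω)
    (h1 : ∀ n : ℕ, lge (s (PowerSeries.coeff n W)) (-(p * n)))
    (h2 : ∀ n : ℕ, (s (PowerSeries.coeff n W)).coeff (-(p * n)) = PowerSeries.coeff n c) : RatPS c := by
  obtain ⟨N, P, hN, hNP⟩ := hW
  have hne : N.support.Nonempty := by simpa [Polynomial.support_nonempty] using hN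
  obtain ⟨i0, hi0, hmin⟩ := exists_min_image N.support (fun i => (s (N.coeff i)).order + p * i) hne
  set m := (s (N.coeff i0)).order + p * i0 with hm
  have hNl : ∀ i : ℕ, lge (s (N.coeff i)) (m - p * i) := by
    intro i j hj
    by_cases hi : i ∈ N.support
    · have := hmin i hi
      apply HahnSeries.coeff_eq_zero_of_lt_order
      linarith
    · have : N.coeff i = 0 := by simpa using hi
      simp [this]
  have key : ∀ n : ℕ, (s (P.coeff n)).coeff (m - p * n) =
      ∑ ij ∈ antidiagonal n, PowerSeries.coeff ij.1 c * (s (N.coeff ij.2)).coeff (m - p * ij.2) := by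
    intro n
    have : P.coeff n = ∑ ij ∈ antidiagonal n, PowerSeries.coeff ij.1 W * N.coeff ij.2 := by
      have := congrArg (PowerSeries.coeff n) hNP
      rw [PowerSeries.coeff_mul] at this
      simpa using this.symm
    rw [this, map_sum, HahnSeries.coeff_sum]
    refine sum_congr rfl fun ij hij => ?_
    rw [map_mul, ← h2]
    have e : (m - p * n) = -(p * ij.1) + (m - p * ij.2) := by
      have := mem_antidiagonal.mp hij
      rw [← this]; push_cast; ring
    rw [e, (lge_mul (h1 _) (hNl _)).2]
  refine ⟨∑ i ∈ range (N.natDegree + 1), Polynomial.monomial i ((s (N.coeff i)).coeff (m - p * i)),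
    ∑ i ∈ range (P.natDegree + 1), Polynomial.monomial i ((s (P.coeff i)).coeff (m - p * i)), ?_, ?_⟩
  all_goals
    have cN : ∀ (Q : Polynomial M) n, (∑ i ∈ range (Q.natDegree + 1), Polynomial.monomial i ((s (Q.coeff i)).coeff (m - p * i))).coeff n
        = (s (Q.coeff n)).coeff (m - p * n) := by
      intro Q n
      simp only [Polynomial.finset_sum_coeff, Polynomial.coeff_monomial]
      rw [Finset.sum_ite_eq' (Finset.range (Q.natDegree + 1)) n]
      split_ifs with h
      · rfl
      · rw [Polynomial.coeff_eq_zero_of_natDegree_lt (by simpa using h), map_zero]; rfl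
  · intro h0
    have := cN N i0
    rw [h0] at this
    have e : m - p * i0 = (s (N.coeff i0)).order := by rw [hm]; ring
    rw [e] at this
    have h3 : s (N.coeff i0) ≠ 0 := by
      rw [Ne, map_eq_zero]; simpa using hi0
    rw [Polynomial.coeff_zero] at this
    exact h3 (HahnSeries.coeff_order_eq_zero.mp this.symm)
  · ext n
    rw [PowerSeries.coeff_mul, Polynomial.coeff_coe, cN, key]
    refine sum_congr rfl fun ij _ => ?_
    rw [Polynomial.coeff_coe, cN]

theorem der_sum_apply {A κ : Type*} [CommRing A] (t : Finset κ) (D : κ → Derivation ℤ A A) (x : A) :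
    (∑ k ∈ t, D k) x = ∑ k ∈ t, D k x := by
  classical
  induction t using Finset.induction_on with
  | empty => simp
  | insert a t ha ih => rw [sum_insert ha, sum_insert ha, Derivation.add_apply, ih]

variable [CharZero M] [CharZero Ω] {ι : Type*} [Fintype ι]

theorem flow_limit (s : M →+* LaurentSeries Ω) (d : Derivation ℤ M M) (D : ι → Derivation ℤ M M) (f : ι → M)
    (dl : ι → Derivation ℤ Ω Ω)
    (hsd : ∀ g (i : ℤ), (s (d g)).coeff i = ((i+1 : ℤ) : Ω) * (s g).coeff (i+1))
    (hsD : ∀ l g (i : ℤ), (s (D l g)).coeff i = dl l ((s g).coeff i))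
    (p : ℤ) (hp : 1 ≤ p) (hf : ∀ l, lge (s (f l)) (-p)) (g : M) (hg : lge (s g) 0) 
    (hrat : RatPS (sol (fun l => EE d (f l)) D g)) :
    RatPS (csP (∑ l, (s (f l)).coeff (-p) • dl l) (if p = 1 then 1 else 0) ((s g).coeff 0)) := by
  set DD : Derivation ℤ Ω Ω := ∑ l, (s (f l)).coeff (-p) • dl l with hDD
  set W := sol (fun l => EE d (f l)) D g with hW
  have hDDa : ∀ x, DD x = ∑ l, (s (f l)).coeff (-p) * dl l x := by
    intro x; rw [hDD]; rw [der_sum_apply]; rfl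
  -- coefficients of EE
  have hE : ∀ l (n : ℕ), lge (s (PowerSeries.coeff n (EE d (f l)))) (-p - n) ∧
      (p = 1 → (s (PowerSeries.coeff n (EE d (f l)))).coeff (-p - n) = (-1)^n * (s (f l)).coeff (-p)) := by
    intro l n
    induction n with
    | zero => rw [EE_zero]; simpa using hf l
    | succ n ih =>
      have hr : ∀ i : ℤ, (n + 1 : Ω) * (s (PowerSeries.coeff (n+1) (EE d (f l)))).coeff i =
          ((i+1 : ℤ) : Ω) * (s (PowerSeries.coeff n (EE d (f l)))).coeff (i+1) := by
        intro i
        rw [← hsd]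
        have := congrArg (PowerSeries.coeff n) (EE_ode d (f l))
        rw [PowerSeries.coeff_derivative] at this
        simp only [psD, PowerSeries.coeff_mk] at this
        rw [← this, map_mul, mul_comm (s _)]
        have e : s ((n:M)+1) = HahnSeries.C ((n:Ω)+1) := by
          rw [map_add, map_natCast, map_one, map_add, map_natCast, map_one]
        rw [e, HahnSeries.C_mul_eq_smul]; rfl
      have hn : (n:Ω) + 1 ≠ 0 := by exact_mod_cast Nat.succ_ne_zero n
      constructor
      · intro i hi
        have := hr i
        rw [ih.1 (i+1) (by push_cast at hi; linarith)] at this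
        simpa [hn] using this
      · intro hp1
        have := hr (-p - (n+1 : ℕ))
        have e : -p - ((n+1 : ℕ):ℤ) + 1 = -p - n := by push_cast; ring
        rw [e, ih.2 hp1] at this
        apply mul_left_cancel₀ hn
        rw [this, hp1]; push_cast; ring
  have hWrec : ∀ n : ℕ, ((n:Ω)+1) • s (PowerSeries.coeff (n+1) W) =
      ∑ l, ∑ j : Fin (n+1), s (PowerSeries.coeff (n - j) (EE d (f l))) * s (D l (PowerSeries.coeff j W)) := by
    intro n
    have := congrArg (PowerSeries.coeff n) (sol_ode (fun l => EE d (f l)) D g)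
    rw [coeff_AA, PowerSeries.coeff_derivative] at this
    have h2 := congrArg s this
    simp only [map_sum, map_mul] at h2
    rw [← h2, mul_comm]
    have e : s ((n:M)+1) = HahnSeries.C ((n:Ω)+1) := by
          rw [map_add, map_natCast, map_one, map_add, map_natCast, map_one]
    rw [e, HahnSeries.C_mul_eq_smul]
  have main : ∀ n : ℕ, lge (s (PowerSeries.coeff n W)) (-(p * n)) ∧
      (s (PowerSeries.coeff n W)).coeff (-(p * n)) = cs DD (if p = 1 then 1 else 0) ((s g).coeff 0) n := by
    set ε : Ω := if p = 1 then 1 else 0 with hε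
    set κ := cs DD ε ((s g).coeff 0) with hκ
    have hκs : ∀ n : ℕ, ((n:Ω)+1) * κ (n+1) = DD (κ n) - ε * n * κ n := by
      intro n
      have hn : (n:Ω) + 1 ≠ 0 := by exact_mod_cast Nat.succ_ne_zero n
      rw [hκ, cs]; field_simp
    have hS : ∀ n : ℕ, ∑ j : Fin (n+1), (if p = 1 then (-1:Ω)^(n - (j:ℕ)) else if (j:ℕ) = n then 1 else 0) * DD (κ j)
        = DD (κ n) - ε * n * κ n := by
      intro n
      by_cases hp1 : p = 1
      · simp only [hp1, if_true]
        have hε1 : ε = 1 := by simp [hε, hp1]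
        induction n with
        | zero => simp
        | succ n ih =>
          rw [Fin.sum_univ_castSucc]
          have : ∀ j : Fin (n+1), (-1:Ω)^(n+1 - ((Fin.castSucc j : Fin (n+2)):ℕ)) * DD (κ (Fin.castSucc j : Fin (n+2))) =
              - ((-1:Ω)^(n - (j:ℕ)) * DD (κ j)) := by
            intro j
            have : n + 1 - (j:ℕ) = (n - j) + 1 := by omega
            simp only [Fin.val_castSucc]
            rw [this, pow_succ]; ring
          rw [sum_congr rfl fun j _ => this j, sum_neg_distrib, ih, ← hκs]
          simp [hε1]; ring
      · have hε1 : ε = 0 := by simp [hε, hp1]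
        simp only [hp1, if_false, hε1]
        rw [Fin.sum_univ_castSucc]
        rw [sum_eq_zero]
        · simp
        · intro j _
          have : (j:ℕ) ≠ n := by omega
          simp [this]
    intro n
    induction n using Nat.strong_induction_on with
    | _ n ih =>
    cases n with
    | zero => 
      have : PowerSeries.coeff 0 W = g := sol_zero _ _ _
      rw [this]; simpa [hκ, cs] using hg
    | succ n =>
      have hn : (n:Ω) + 1 ≠ 0 := by exact_mod_cast Nat.succ_ne_zero n
      have hterm : ∀ l (j : Fin (n+1)), 
          lge (s (PowerSeries.coeff (n - j) (EE d (f l))) * s (D l (PowerSeries.coeff j W))) (-(p * (n+1:ℕ))) ∧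
          (s (PowerSeries.coeff (n - j) (EE d (f l))) * s (D l (PowerSeries.coeff j W))).coeff (-(p * (n+1:ℕ))) =
            (if p = 1 then (-1:Ω)^(n - (j:ℕ)) else if (j:ℕ) = n then 1 else 0) * ((s (f l)).coeff (-p) * dl l (κ j)) := by
        intro l j
        have hj := j.2
        obtain ⟨i1, i2⟩ := ih j (by omega)
        have hD1 : lge (s (D l (PowerSeries.coeff j W))) (-(p * (j:ℕ))) := by
          intro i hi; rw [hsD, i1 i hi, map_zero]
        have hD2 : (s (D l (PowerSeries.coeff j W))).coeff (-(p * (j:ℕ))) = dl l (κ j) := by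
          rw [hsD, i2]
        obtain ⟨e1, e2⟩ := hE l (n - j)
        obtain ⟨m1, m2⟩ := lge_mul e1 hD1
        obtain ⟨t, ht⟩ : ∃ t : ℕ, n = j + t := ⟨n - j, by omega⟩
        have htz : (n:ℤ) = ((j:ℕ):ℤ) + t := by omega
        have ht' : n - (j:ℕ) = t := by omega
        rw [ht'] at m1 m2 e2 ⊢
        have hle : -(p * (n+1:ℕ)) ≤ -p - t + -(p * (j:ℕ)) := by
          push_cast; rw [htz]
          nlinarith [mul_nonneg (sub_nonneg.mpr hp) (Int.natCast_nonneg t)]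
        refine ⟨lge_mono m1 hle, ?_⟩
        by_cases hp1 : p = 1
        · have : -(p * (n+1:ℕ)) = -p - t + -(p * (j:ℕ)) := by push_cast; rw [htz, hp1]; ring
          rw [this, m2, e2 hp1, hD2, if_pos hp1]; ring
        · rw [if_neg hp1]
          by_cases ht0 : t = 0
          · have hjn : (j:ℕ) = n := by omega
            rw [if_pos hjn]
            have : -(p * (n+1:ℕ)) = -p - t + -(p * (j:ℕ)) := by push_cast; rw [htz, ht0]; ring
            rw [this, m2, hD2, ht0, EE_zero]; simp
          · have hjn : (j:ℕ) ≠ n := by omega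
            rw [if_neg hjn, zero_mul]
            apply m1
            have hp2 : 2 ≤ p := by omega
            have : 1 ≤ (t:ℤ) := by omega
            push_cast; rw [htz]
            nlinarith [mul_nonneg (sub_nonneg.mpr hp2) (sub_nonneg.mpr this)]
      have hlge := lge_sum (univ : Finset ι) _ _ (fun l _ => lge_sum (univ : Finset (Fin (n+1))) _ _ (fun j _ => (hterm l j).1))
      rw [← hWrec n] at hlge
      constructor
      · intro i hi
        have := hlge i hi
        simpa [hn] using this
      · have h3 := congrArg (fun z => HahnSeries.coeff z (-(p * (n+1:ℕ)))) (hWrec n)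
        simp only [HahnSeries.coeff_smul, HahnSeries.coeff_sum] at h3
        apply mul_left_cancel₀ hn
        rw [hκs, ← hS, ← smul_eq_mul, h3, sum_comm]
        refine sum_congr rfl fun j _ => ?_
        rw [hDDa, mul_sum]
        exact sum_congr rfl fun l _ => (hterm l j).2
  refine limit_rat s W hrat p _ (fun n => (main n).1) (fun n => ?_)
  rw [(main n).2]; simp [csP]

end C2

set_option linter.all false

section C3
open Finset

theorem ext_hom {R L L' : Type*} [CommRing R] [IsDomain R] [Field L] [Field L'] (i : R →+* L)
    (hi : Function.Injective i) (hs : ∀ z, ∃ x y, z = i x / i y) (g : R →+* L') (hg : Function.Injective g) :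
    ∃ s : L →+* L', ∀ r, s (i r) = g r := by
  letI : Algebra R L := i.toAlgebra
  haveI : FaithfulSMul R L := (faithfulSMul_iff_algebraMap_injective R L).mpr hi
  haveI : IsFractionRing R L := IsFractionRing.of_field R L hs
  exact ⟨IsFractionRing.lift hg, fun r => IsFractionRing.lift_algebraMap hg r⟩

/-- A field generated by a subfield `k` and `x` consists of fractions. -/
theorem closure_frac {M : Type*} [Field M] (k : Subfield M) (x : M) (z : M)
    (hz : z ∈ Subfield.closure ((k : Set M) ∪ {x})) :
    ∃ P Q : Polynomial k, z = P.eval₂ k.subtype x / Q.eval₂ k.subtype x := by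
  induction hz using Subfield.closure_induction with
  | mem a ha =>
    rcases ha with ha | rfl
    · exact ⟨Polynomial.C ⟨a, ha⟩, 1, by simp⟩
    · exact ⟨Polynomial.X, 1, by simp⟩
  | one => exact ⟨1, 1, by simp⟩
  | add a b _ _ iha ihb =>
    obtain ⟨P, Q, rfl⟩ := iha
    obtain ⟨P', Q', rfl⟩ := ihb
    by_cases h1 : Q.eval₂ k.subtype x = 0
    · exact ⟨P', Q', by rw [h1]; simp⟩
    by_cases h2 : Q'.eval₂ k.subtype x = 0
    · exact ⟨P, Q, by rw [h2]; simp⟩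
    exact ⟨P * Q' + P' * Q, Q * Q', by simp only [Polynomial.eval₂_add, Polynomial.eval₂_mul]; field_simp⟩
  | neg a _ iha =>
    obtain ⟨P, Q, rfl⟩ := iha
    exact ⟨-P, Q, by simp [neg_div]⟩
  | inv a _ iha =>
    obtain ⟨P, Q, rfl⟩ := iha
    exact ⟨Q, P, by simp⟩
  | mul a b _ _ iha ihb =>
    obtain ⟨P, Q, rfl⟩ := iha
    obtain ⟨P', Q', rfl⟩ := ihb
    exact ⟨P * P', Q * Q', by simp only [Polynomial.eval₂_mul, mul_div_mul_comm]⟩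

/-- if `d` kills `k` and `d x = 1` then `x` is transcendental over `k`. -/
theorem transc_of_der {M : Type*} [Field M] [CharZero M] (k : Subfield M) (d : Derivation ℤ M M)
    (hk : ∀ a ∈ k, d a = 0) (x : M) (hx : d x = 1) :
    Function.Injective (Polynomial.eval₂RingHom k.subtype x) := by
  have h : Transcendental k x := by
    intro h
    have := der_alg_zero (K := k) (D := d) (fun a => hk a a.2) h
    rw [hx] at this; exact one_ne_zero this
  rw [transcendental_iff_injective] at h
  exact h

variable {Ω : Type*} [Field Ω] 

/-- graded coefficientwise operator -/
noncomputable def lA (A : ℤ → Ω →+ Ω) (x : LaurentSeries Ω) : LaurentSeries Ω where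
  coeff i := A i (x.coeff i)
  isPWO_support' := x.isPWO_support.mono (by
    intro i hi; simp only [Function.mem_support, HahnSeries.mem_support] at hi ⊢
    intro h; rw [h] at hi; simp at hi)

theorem lA_supp (A : ℤ → Ω →+ Ω) (x : LaurentSeries Ω) : (lA A x).support ⊆ x.support := by
  intro i hi; simp only [lA, HahnSeries.mem_support] at hi ⊢
  intro h; rw [h] at hi; simp at hi

theorem lA_mul (A : ℤ → Ω →+ Ω) (hA : ∀ i j a b, A (i + j) (a * b) = A i a * b + a * A j b)
    (x y : LaurentSeries Ω) : lA A (x * y) = lA A x * y + x * lA A y := by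
  ext i
  show A i ((x * y).coeff i) = _
  rw [HahnSeries.coeff_add, HahnSeries.coeff_mul_left' x.isPWO_support (lA_supp A x),
    HahnSeries.coeff_mul_right' y.isPWO_support (lA_supp A y), HahnSeries.coeff_mul, map_sum, ← sum_add_distrib]
  refine sum_congr rfl fun ij h => ?_
  have := (Finset.mem_antidiagonal.mp h).2.2
  rw [← this, hA]; rfl

theorem lA_add (A : ℤ → Ω →+ Ω) (x y : LaurentSeries Ω) : lA A (x + y) = lA A x + lA A y := by
  ext i
  simp [lA]

variable {M : Type*} [Field M]

/-- compat subfield -/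
def compatF (s : M →+* LaurentSeries Ω) (D : Derivation ℤ M M) (y : LaurentSeries Ω) (A : ℤ → Ω →+ Ω) 
    (hA : ∀ i j a b, A (i + j) (a * b) = A i a * b + a * A j b) : Subfield M where
  carrier := {g | y * s (D g) = lA A (s g)}
  mul_mem' := by
    intro a b ha hb
    simp only [Set.mem_setOf_eq] at *
    rw [map_mul s, lA_mul A hA, ← ha, ← hb, Derivation.leibniz]; simp; ring
  one_mem' := by
    simp only [Set.mem_setOf_eq, map_one]
    have := lA_mul A hA 1 1
    simp at this; simp [this]
  add_mem' := by
    intro a b ha hb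
    simp only [Set.mem_setOf_eq] at *
    rw [map_add s, lA_add, ← ha, ← hb, map_add, map_add, mul_add]
  zero_mem' := by
    simp only [Set.mem_setOf_eq, map_zero]
    ext i; simp [lA]
  neg_mem' := by
    intro a ha
    simp only [Set.mem_setOf_eq, map_neg] at *
    ext i
    have := congrArg (fun z => HahnSeries.coeff z i) ha
    simp [lA] at this ⊢
    exact this
  inv_mem' := by
    intro a ha
    simp only [Set.mem_setOf_eq] at *
    by_cases h0 : a = 0
    · subst h0; simpa using ha
    have hs0 : s a ≠ 0 := by simpa using h0
    have h1 : lA A 1 = 0 := by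
      have := lA_mul A hA 1 1
      simpa using this
    have h2 := lA_mul A hA (s a) (s a⁻¹)
    rw [← map_mul, mul_inv_cancel₀ h0, map_one, h1, ← ha] at h2
    rw [Derivation.leibniz_inv]
    apply mul_left_cancel₀ hs0
    have : s a * lA A (s a⁻¹) = - (y * s (D a) * s a⁻¹) := by linear_combination -h2
    rw [this, smul_eq_mul]
    simp
    field_simp

theorem pole_hom [CharZero M] [CharZero Ω] (d : Derivation ℤ M M) (x : M) (hdx : d x = 1)
    (hgen : Subfield.closure ({a | d a = 0} ∪ {x}) = ⊤) (ψ : M →+* Ω) (α : Ω) :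
    ∃ s : M →+* LaurentSeries Ω, (∀ c, d c = 0 → s c = HahnSeries.C (ψ c)) ∧
      s x = HahnSeries.C α + HahnSeries.single 1 1 ∧
      (∀ g (i : ℤ), (s (d g)).coeff i = ((i+1 : ℤ) : Ω) * (s g).coeff (i+1)) ∧
      (∀ (D : Derivation ℤ M M) (dl : Derivation ℤ Ω Ω), D x = 0 → (∀ c, d (D c) = D (d c)) → 
        (∀ c, dl (ψ c) = ψ (D c)) → dl α = 0 → ∀ g (i : ℤ), (s (D g)).coeff i = dl ((s g).coeff i)) := by
  let k : Subfield M :=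
    { carrier := {a | d a = 0}
      mul_mem' := by intro a b ha hb; simp_all
      one_mem' := by simp
      add_mem' := by intro a b ha hb; simp_all
      zero_mem' := by simp
      neg_mem' := by intro a ha; simp_all
      inv_mem' := by intro a ha; simp_all [Derivation.leibniz_inv] }
  have hi := transc_of_der k d (fun a ha => ha) x hdx
  let g : Polynomial k →+* LaurentSeries Ω :=
    (HahnSeries.ofPowerSeries ℤ Ω).comp (Polynomial.coeToPowerSeries.ringHom.comp
      ((Polynomial.taylorAlgHom α).toRingHom.comp (Polynomial.mapRingHom (ψ.comp k.subtype))))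
  have hg : Function.Injective g := by
    refine HahnSeries.ofPowerSeries_injective.comp ?_
    refine (Polynomial.coe_injective Ω).comp ?_
    refine (Polynomial.taylor_injective α).comp ?_
    exact Polynomial.map_injective _ (ψ.comp k.subtype).injective
  obtain ⟨s, hs⟩ := ext_hom _ hi (fun z => by
    obtain ⟨P, Q, h⟩ := closure_frac k x z (by
      have : Subfield.closure ((k : Set M) ∪ {x}) = ⊤ := hgen
      rw [this]; exact Subfield.mem_top z)
    exact ⟨P, Q, h⟩) g hg
  have hsc : ∀ c, d c = 0 → s c = HahnSeries.C (ψ c) := by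
    intro c hc
    have := hs (Polynomial.C ⟨c, hc⟩)
    simp [g] at this
    simpa using this
  have hsx : s x = HahnSeries.C α + HahnSeries.single 1 1 := by
    have := hs Polynomial.X
    simp [g] at this
    rw [this, add_comm]; simp
  refine ⟨s, hsc, hsx, ?_, ?_⟩
  · set A : ℤ → Ω →+ Ω := fun i => AddMonoidHom.mulLeft (i : Ω) with hAd
    have hA : ∀ i j a b, A (i + j) (a * b) = A i a * b + a * A j b := by
      intro i j a b; simp [A]; ring
    have : (⊤ : Subfield M) ≤ compatF s d (HahnSeries.single 1 1) A hA := by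
      rw [← hgen, Subfield.closure_le]
      rintro a (ha | rfl)
      · show _ * s (d a) = lA A (s a)
        rw [show d a = 0 from ha, hsc a ha]
        ext i; by_cases hi : i = 0 <;> simp [lA, A, HahnSeries.coeff_single, hi]
      · show _ * s (d a) = lA A (s a)
        rw [hdx, hsx]
        ext i; by_cases hi : i = 0
        · simp [lA, A, HahnSeries.coeff_single, hi]
        · by_cases hi : i = 1 <;> simp_all [lA, A, HahnSeries.coeff_single, hi]
    intro g i
    have h1 : HahnSeries.single 1 1 * s (d g) = lA A (s g) := this (Subfield.mem_top g)
    have h2 := congrArg (fun z => HahnSeries.coeff z (i+1)) h1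
    simp only [lA, A] at h2
    rw [HahnSeries.coeff_single_mul_add] at h2
    simpa using h2
  · intro D dl hDx hcomm hdl hα
    set A : ℤ → Ω →+ Ω := fun i => (dl : Ω →ₗ[ℤ] Ω).toAddMonoidHom with hAd
    have hA : ∀ i j a b, A (i + j) (a * b) = A i a * b + a * A j b := by
      intro i j a b; simp [A]; ring
    have : (⊤ : Subfield M) ≤ compatF s D 1 A hA := by
      rw [← hgen, Subfield.closure_le]
      rintro a (ha | rfl)
      · show _ * s (D a) = lA A (s a)
        have ha' : d a = 0 := ha
        rw [hsc a ha, one_mul, hsc _ (by rw [hcomm, ha', map_zero])]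
        ext i; by_cases hi : i = 0 <;> simp [lA, A, HahnSeries.coeff_single, hi, hdl]
      · show _ * s (D a) = lA A (s a)
        rw [hDx, hsx]
        ext i; by_cases hi : i = 0
        · simp [lA, A, HahnSeries.coeff_single, hi, hα]
        · by_cases hi : i = 1 <;> simp_all [lA, A, HahnSeries.coeff_single, hi]
    intro g i
    have h1 : 1 * s (D g) = lA A (s g) := this (Subfield.mem_top g)
    rw [one_mul] at h1
    rw [h1]; rfl

end C3

set_option linter.all false

section C4
open Finset

variable {Ω : Type*} [Field Ω] [CharZero Ω] {M : Type*} [Field M] [CharZero M] {ι : Type*} [Fintype ι]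

/-- Laurent series with coefficients in a subfield -/
def lcoef (κ : Subfield Ω) : Subring (LaurentSeries Ω) where
  carrier := {z | ∀ i, z.coeff i ∈ κ}
  mul_mem' := by
    intro a b ha hb i
    rw [HahnSeries.coeff_mul]
    exact sum_mem fun ij _ => mul_mem (ha _) (hb _)
  one_mem' := by
    intro i; rw [HahnSeries.coeff_one]; split_ifs
    · exact one_mem _
    · exact zero_mem _
  add_mem' := by intro a b ha hb i; rw [HahnSeries.coeff_add]; exact add_mem (ha _) (hb _)
  zero_mem' := by intro i; rw [HahnSeries.coeff_zero]; exact zero_mem _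
  neg_mem' := by intro a ha i; rw [HahnSeries.coeff_neg]; exact neg_mem (ha _)

structure PoleData (d : Derivation ℤ M M) (x : M) (D : ι → Derivation ℤ M M) (f : ι → M) (H : M →+* M)
    (ψ : M →+* Ω) (dl : ι → Derivation ℤ Ω Ω) (k₀ : Subfield M) (κ : Subfield Ω) : Prop where
  hdx : d x = 1
  hgen : Subfield.closure ({a | d a = 0} ∪ {x}) = ⊤
  hcomm : ∀ l a, d (D l a) = D l (d a)
  hDx : ∀ l, D l x = 0
  hHx : H x = x
  hHs : Function.Surjective H
  hH : ∀ a, d a = 0 → d (H a) = ∑ l, f l * D l (H a)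
  hdl : ∀ l c, dl l (ψ c) = ψ (D l c)
  hk₀ : ∀ c ∈ k₀, d c = 0
  hψ : ∀ c ∈ k₀, ψ c ∈ κ
  hκ : ∀ (α : Ω) (R : Polynomial k₀), R ≠ 0 → R.eval₂ (ψ.comp k₀.subtype) α = 0 → α ∈ κ
  hdlκ : ∀ l, ∀ a ∈ κ, dl l a = 0
  hf : ∀ l, f l ∈ Subfield.closure ((k₀ : Set M) ∪ {x})

theorem flow_pole {d : Derivation ℤ M M} {x : M} {D : ι → Derivation ℤ M M} {f : ι → M} {H : M →+* M}
    {ψ : M →+* Ω} {dl : ι → Derivation ℤ Ω Ω} {k₀ : Subfield M} {κ : Subfield Ω}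
    (h : PoleData d x D f H ψ dl k₀ κ) (α : Ω) (hα : α ∈ κ) (s : M →+* LaurentSeries Ω)
    (hsc : ∀ c, d c = 0 → s c = HahnSeries.C (ψ c))
    (hsx : s x = HahnSeries.C α + HahnSeries.single 1 1)
    (hsd : ∀ g (i : ℤ), (s (d g)).coeff i = ((i+1 : ℤ) : Ω) * (s g).coeff (i+1))
    (hsD : ∀ (D : Derivation ℤ M M) (dl : Derivation ℤ Ω Ω), D x = 0 → (∀ c, d (D c) = D (d c)) → 
        (∀ c, dl (ψ c) = ψ (D c)) → dl α = 0 → ∀ g (i : ℤ), (s (D g)).coeff i = dl ((s g).coeff i))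
    (hpole : ∃ l, ¬ lge (s (f l)) 0) :
    ∃ a : ι → Ω, (∀ l, a l ∈ κ) ∧ a ≠ 0 ∧ ∃ ε : Ω, (ε = 0 ∨ ε = 1) ∧
      ∀ g, d g = 0 → RatPS (csP (∑ l, a l • dl l) ε (ψ g)) := by
  classical
  obtain ⟨l0, hl0⟩ := hpole
  have hne0 : s (f l0) ≠ 0 := by intro h0; apply hl0; intro i _; rw [h0]; rfl
  obtain ⟨l1, hl1, hmin⟩ := exists_min_image (univ.filter fun l => s (f l) ≠ 0) (fun l => (s (f l)).order)
    ⟨l0, by simpa using hne0⟩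
  set m := (s (f l1)).order with hm
  have hm0 : m < 0 := by
    have h1 := hmin l0 (by simpa using hne0)
    by_contra! h2
    apply hl0
    intro i hi
    exact HahnSeries.coeff_eq_zero_of_lt_order (by omega)
  have hfl : ∀ l, lge (s (f l)) m := by
    intro l i hi
    by_cases hl : s (f l) = 0
    · rw [hl]; rfl
    · have := hmin l (by simpa using hl)
      exact HahnSeries.coeff_eq_zero_of_lt_order (by omega)
  refine ⟨fun l => (s (f l)).coeff m, ?_, ?_, if -m = 1 then 1 else 0, by split_ifs <;> simp, ?_⟩
  · intro l
    obtain ⟨P, Q, hPQ⟩ := closure_frac k₀ x (f l) (h.hf l)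
    have hco : ∀ R : Polynomial k₀, s (R.eval₂ k₀.subtype x) ∈ lcoef κ := by
      intro R
      rw [Polynomial.eval₂_eq_sum_range, map_sum]
      refine sum_mem fun i _ => ?_
      rw [map_mul, map_pow]
      refine mul_mem ?_ (pow_mem ?_ _)
      · have hq : s (k₀.subtype (R.coeff i)) = _ := hsc _ (h.hk₀ _ (R.coeff i).2)
        rw [hq]
        intro j
        by_cases hj : j = 0 <;> simp [HahnSeries.coeff_single, hj]
        exact h.hψ _ (R.coeff i).2
      · rw [hsx]
        refine add_mem ?_ ?_
        · intro j
          by_cases hj : j = 0 <;> simp [HahnSeries.coeff_single, hj, hα]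
        · intro j
          by_cases hj : j = 1 <;> simp [HahnSeries.coeff_single, hj, hα]
    by_cases hQ : Q.eval₂ k₀.subtype x = 0
    · show (s (f l)).coeff m ∈ κ
      rw [hPQ, hQ]; simp
    have hsQ : s (Q.eval₂ k₀.subtype x) ≠ 0 := by simpa using hQ
    have e : s (f l) * s (Q.eval₂ k₀.subtype x) = s (P.eval₂ k₀.subtype x) := by
      rw [← map_mul, hPQ]; field_simp
    have hlQ : lge (s (Q.eval₂ k₀.subtype x)) (s (Q.eval₂ k₀.subtype x)).order :=
      fun i hi => HahnSeries.coeff_eq_zero_of_lt_order hi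
    have := (lge_mul (hfl l) hlQ).2
    rw [e] at this
    have hz : (s (Q.eval₂ k₀.subtype x)).coeff (s (Q.eval₂ k₀.subtype x)).order ≠ 0 := by
      rw [Ne, HahnSeries.coeff_order_eq_zero]; exact hsQ
    rw [eq_comm, ← eq_div_iff hz] at this
    show (s (f l)).coeff m ∈ κ
    rw [this]
    exact div_mem (hco P _) (hco Q _)
  · intro h0
    have := congrFun h0 l1
    simp only [hm, Pi.zero_apply, HahnSeries.coeff_order_eq_zero] at this
    exact (mem_filter.mp hl1).2 this
  · intro g hg
    have hrat := flow_rat d D f x h.hcomm h.hdx h.hDx h.hgen H h.hHx h.hHs h.hH g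
    have hsg : s g = HahnSeries.C (ψ g) := hsc g hg
    have := flow_limit s d D f dl hsd 
      (fun l => hsD (D l) (dl l) (h.hDx l) (h.hcomm l) (h.hdl l) (h.hdlκ l α hα)) (-m) (by omega)
      (by simpa using hfl) g (by intro i hi; rw [hsg]; simp [HahnSeries.coeff_single]; omega) hrat
    rw [hsg] at this
    simpa using this

theorem flow_main [IsAlgClosed Ω] {d : Derivation ℤ M M} {x : M} {D : ι → Derivation ℤ M M} {f : ι → M} {H : M →+* M}
    {ψ : M →+* Ω} {dl : ι → Derivation ℤ Ω Ω} {k₀ : Subfield M} {κ : Subfield Ω}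
    (h : PoleData d x D f H ψ dl k₀ κ) (hf0 : f ≠ 0) :
    ∃ a : ι → Ω, (∀ l, a l ∈ κ) ∧ a ≠ 0 ∧ ∃ ε : Ω, (ε = 0 ∨ ε = 1) ∧
      ∀ g, d g = 0 → RatPS (csP (∑ l, a l • dl l) ε (ψ g)) := by
  by_cases hpoly : ∀ l, ∃ R : Polynomial k₀, f l = R.eval₂ k₀.subtype x
  · have hx0 : x ≠ 0 := by rintro rfl; have := h.hdx; simp at this
    have hd' : ∀ a, (-(x^2) • d) a = -(x^2) * d a := fun a => rfl
    have hker : {a | (-(x^2) • d) a = 0} = {a | d a = 0} := by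
      ext a; simp [hx0]
    have hd'0 : ∀ a, (-(x^2) • d) a = 0 ↔ d a = 0 := by
      intro a; simp [hx0]
    have h' : PoleData (-(x^2) • d) x⁻¹ D (fun l => -(x^2) * f l) H ψ dl k₀ κ := by
      refine { hdx := ?_, hgen := ?_, hcomm := ?_, hDx := ?_, hHx := ?_, hHs := h.hHs, hH := ?_, hdl := h.hdl,
               hk₀ := ?_, hψ := h.hψ, hκ := h.hκ, hdlκ := h.hdlκ, hf := ?_ }
      · rw [hd', Derivation.leibniz_inv, h.hdx]; simp; field_simp
      · rw [hker, eq_top_iff, ← h.hgen, Subfield.closure_le]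
        rintro a (ha | rfl)
        · exact Subfield.subset_closure (Or.inl ha)
        · have : a⁻¹ ∈ Subfield.closure ({a | d a = 0} ∪ {a⁻¹}) := Subfield.subset_closure (Or.inr rfl)
          simpa using inv_mem this
      · intro l a
        rw [hd', hd', h.hcomm, Derivation.leibniz, map_neg, Derivation.leibniz_pow, h.hDx]; simp
      · intro l; rw [Derivation.leibniz_inv, h.hDx]; simp
      · rw [map_inv₀, h.hHx]
      · intro a ha
        rw [hd'0] at ha
        rw [hd', h.hH a ha, mul_sum]
        exact sum_congr rfl fun l _ => by ring
      · intro c hc; rw [hd'0]; exact h.hk₀ c hc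
      · intro l
        have hle : Subfield.closure ((k₀ : Set M) ∪ {x}) ≤ Subfield.closure ((k₀ : Set M) ∪ {x⁻¹}) := by
          rw [Subfield.closure_le]
          rintro a (ha | rfl)
          · exact Subfield.subset_closure (Or.inl ha)
          · have : a⁻¹ ∈ Subfield.closure ((k₀ : Set M) ∪ {a⁻¹}) := Subfield.subset_closure (Or.inr rfl)
            simpa using inv_mem this
        have hxm : x ∈ Subfield.closure ((k₀ : Set M) ∪ {x}) := Subfield.subset_closure (Or.inr rfl)
        exact hle (mul_mem (neg_mem (pow_mem hxm 2)) (h.hf l))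
    obtain ⟨s, hsc, hsx, hsd, hsD⟩ := pole_hom _ _ h'.hdx h'.hgen ψ 0
    have hsx' : s x = HahnSeries.single (-1) 1 := by
      rw [map_inv₀] at hsx
      rw [← inv_inv (s x), hsx]
      simp
    suffices hpp : ∃ l, ¬ lge (s (-(x^2) * f l)) 0 by
      obtain ⟨a, ha, ha0, ε, hε, hr⟩ := flow_pole h' 0 (zero_mem _) s hsc hsx hsd hsD hpp
      exact ⟨a, ha, ha0, ε, hε, fun g hg => hr g ((hd'0 g).mpr hg)⟩
    · obtain ⟨l, hl⟩ : ∃ l, f l ≠ 0 := by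
        by_contra! hh; exact hf0 (funext hh)
      obtain ⟨R, hR⟩ := hpoly l
      have hR0 : R ≠ 0 := by rintro rfl; simp at hR; exact hl hR
      refine ⟨l, fun hlg => ?_⟩
      have e : s (-(x^2) * f l) = - (HahnSeries.single (-2) 1 * s (f l)) := by
        rw [map_mul, map_neg, map_pow, hsx']; simp [pow_two]
      have e2 : (s (f l)).coeff (-(R.natDegree : ℤ)) = ψ (R.leadingCoeff) := by
        rw [hR, Polynomial.eval₂_eq_sum_range, map_sum, HahnSeries.coeff_sum, sum_eq_single R.natDegree]
        · rw [map_mul, map_pow, hsx', hsc (k₀.subtype _) (by rw [hd'0]; exact h.hk₀ _ (R.coeff _).2)]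
          simp [HahnSeries.single_pow]
        · intro i hi hne
          rw [map_mul, map_pow, hsx', hsc (k₀.subtype _) (by rw [hd'0]; exact h.hk₀ _ (R.coeff _).2)]
          simp [HahnSeries.single_pow, HahnSeries.coeff_single]
          intro h1; omega
        · intro hh; simp at hh
      have := hlg (-(R.natDegree : ℤ) + (-2)) (by omega)
      rw [e, HahnSeries.coeff_neg, HahnSeries.coeff_single_mul_add, e2] at this
      simp [hR0] at this
  · push Not at hpoly
    obtain ⟨l, hl⟩ := hpoly
    obtain ⟨P, Q, hPQ⟩ := closure_frac k₀ x (f l) (h.hf l)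
    have hinj := transc_of_der k₀ d h.hk₀ x h.hdx
    have hQ0 : Q ≠ 0 := by rintro rfl; exact hl 0 (by simpa using hPQ)
    obtain ⟨P', Q', hQ'0, hcop, hPQ'⟩ : ∃ P' Q' : Polynomial k₀, Q' ≠ 0 ∧ IsCoprime P' Q' ∧ 
        f l = P'.eval₂ k₀.subtype x / Q'.eval₂ k₀.subtype x := by
      classical
      have hg0 : EuclideanDomain.gcd P Q ≠ 0 := by
        intro h0; exact hQ0 (EuclideanDomain.gcd_eq_zero_iff.mp h0).2
      obtain ⟨P', hP'⟩ := EuclideanDomain.gcd_dvd_left P Q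
      obtain ⟨Q', hQ'⟩ := EuclideanDomain.gcd_dvd_right P Q
      have hge : (EuclideanDomain.gcd P Q).eval₂ k₀.subtype x ≠ 0 := by
        intro h0
        exact hg0 (hinj (by simpa using h0))
      refine ⟨P', Q', by rintro rfl; simp at hQ'; exact hQ0 hQ', ?_, ?_⟩
      · refine ⟨EuclideanDomain.gcdA P Q, EuclideanDomain.gcdB P Q, ?_⟩
        apply mul_left_cancel₀ hg0
        have := EuclideanDomain.gcd_eq_gcd_ab P Q
        linear_combination (-EuclideanDomain.gcdA P Q) * hP' - EuclideanDomain.gcdB P Q * hQ' - this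
      · rw [hPQ]
        have e1 := congrArg (Polynomial.eval₂ k₀.subtype x) hP'
        have e2 := congrArg (Polynomial.eval₂ k₀.subtype x) hQ'
        rw [Polynomial.eval₂_mul] at e1 e2
        rw [e1, e2, mul_div_mul_left _ _ hge]
    have hdeg : Q'.degree ≠ 0 := by
      intro h0
      rw [Polynomial.eq_C_of_degree_eq_zero h0] at hPQ'
      apply hl (Polynomial.C (Q'.coeff 0)⁻¹ * P')
      rw [hPQ']; simp [div_eq_mul_inv, mul_comm]
    obtain ⟨α, hα⟩ := IsAlgClosed.exists_eval₂_eq_zero (ψ.comp k₀.subtype) Q' hdeg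
    have hακ : α ∈ κ := h.hκ α Q' hQ'0 hα
    obtain ⟨s, hsc, hsx, hsd, hsD⟩ := pole_hom _ _ h.hdx h.hgen ψ α
    refine flow_pole h α hακ s hsc hsx hsd hsD ⟨l, fun hlg => ?_⟩
    have hev : ∀ R : Polynomial k₀, lge (s (R.eval₂ k₀.subtype x)) 0 ∧ 
        (s (R.eval₂ k₀.subtype x)).coeff 0 = R.eval₂ (ψ.comp k₀.subtype) α := by
      intro R
      induction R using Polynomial.induction_on with
      | C c =>
        rw [Polynomial.eval₂_C, Polynomial.eval₂_C, hsc (k₀.subtype c) (h.hk₀ _ c.2)]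
        constructor
        · intro i hi; simp [HahnSeries.coeff_single]; intro h; omega
        · simp
      | add p q hp hq =>
        rw [Polynomial.eval₂_add, Polynomial.eval₂_add, map_add]
        refine ⟨fun i hi => by rw [HahnSeries.coeff_add, hp.1 i hi, hq.1 i hi, add_zero], ?_⟩
        rw [HahnSeries.coeff_add, hp.2, hq.2]
      | monomial n c hp =>
        have : Polynomial.C c * Polynomial.X ^ (n+1) = (Polynomial.C c * Polynomial.X ^ n) * Polynomial.X := by ring
        rw [this, Polynomial.eval₂_mul, Polynomial.eval₂_mul (x := α), map_mul, Polynomial.eval₂_X, Polynomial.eval₂_X]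
        have hsx0 : lge (s x) 0 := by
          rw [hsx]; intro i hi
          have h1 : i ≠ 0 := by omega
          have h2 : i ≠ 1 := by omega
          simp [HahnSeries.coeff_single, h1, h2]
        have hm := lge_mul hp.1 hsx0
        rw [add_zero] at hm
        refine ⟨hm.1, ?_⟩
        rw [hm.2, hp.2, hsx]
        simp [HahnSeries.coeff_single]
    have hQx : Q'.eval₂ k₀.subtype x ≠ 0 := by
      intro h0; exact hQ'0 (hinj (by simpa using h0))
    have e : s (f l) * s (Q'.eval₂ k₀.subtype x) = s (P'.eval₂ k₀.subtype x) := by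
      rw [← map_mul, hPQ']; field_simp
    have := (lge_mul hlg (hev Q').1).2
    rw [add_zero, e, (hev P').2, (hev Q').2, hα, mul_zero] at this
    obtain ⟨u, v, huv⟩ := hcop
    have h2 := congrArg (Polynomial.eval₂ (ψ.comp k₀.subtype) α) huv
    rw [Polynomial.eval₂_add, Polynomial.eval₂_mul, Polynomial.eval₂_mul, this, hα] at h2
    simp at h2

end C4

set_option linter.all false

section B2
open Finset

theorem rat_descend {K L : Type*} [Field K] [Field L] [Algebra K L] (c : PowerSeries K)
    (h : RatPS (c.map (algebraMap K L))) : RatPS c := by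
  obtain ⟨N, P, hN, hNP⟩ := h
  obtain ⟨j, hj⟩ : ∃ j, N.coeff j ≠ 0 := by
    by_contra! hh; exact hN (Polynomial.ext (by simpa using hh))
  obtain ⟨φ, hφ⟩ : ∃ φ : L →ₗ[K] K, φ (N.coeff j) ≠ 0 := by
    by_contra! hh
    exact hj ((Module.forall_dual_apply_eq_zero_iff K (N.coeff j)).1 hh)
  let ap : Polynomial L → Polynomial K := fun R => ∑ i ∈ range (R.natDegree + 1), Polynomial.monomial i (φ (R.coeff i))
  have hap : ∀ R i, (ap R).coeff i = φ (R.coeff i) := by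
    intro R i
    simp only [ap, Polynomial.finset_sum_coeff, Polynomial.coeff_monomial]
    rw [sum_ite_eq' (range (R.natDegree + 1)) i]
    split_ifs with h
    · rfl
    · rw [Polynomial.coeff_eq_zero_of_natDegree_lt (by simpa using h), map_zero]
  refine ⟨ap N, ap P, ?_, ?_⟩
  · intro h0
    apply hφ
    rw [← hap, h0]; simp
  · ext n
    have := congrArg (fun z => φ (PowerSeries.coeff n z)) hNP
    simp only [PowerSeries.coeff_mul, map_sum, PowerSeries.coeff_map, Polynomial.coeff_coe,
      ← Algebra.smul_def, map_smul] at this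
    simp only [PowerSeries.coeff_mul, Polynomial.coeff_coe, hap]
    rw [← this]; rfl

theorem csP_map {K L : Type*} [Field K] [Field L] (ψ : K →+* L) (d : Derivation ℤ K K) (D : Derivation ℤ L L)
    (h : ∀ a, D (ψ a) = ψ (d a)) (ε f : K) : csP D (ψ ε) (ψ f) = (csP d ε f).map ψ := by
  have : ∀ n, cs D (ψ ε) (ψ f) n = ψ (cs d ε f n) := by
    intro n
    induction n with
    | zero => rfl
    | succ n ih => simp [cs, ih, h]
  ext n
  simp [csP, this]

theorem csP_rescale {L : Type*} [Field L] (D : Derivation ℤ L L) (a : L) (ha : D a = 0) (f : L) :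
    csP (a • D) 0 f = PowerSeries.rescale a (csP D 0 f) := by
  have hp : ∀ n, D (a ^ n) = 0 := by intro n; rw [Derivation.leibniz_pow, ha]; simp
  have : ∀ n, cs (a • D) 0 f n = a ^ n * cs D 0 f n := by
    intro n
    induction n with
    | zero => simp [cs]
    | succ n ih => 
      simp only [cs, ih, Derivation.smul_apply, Derivation.leibniz, hp]
      simp; ring
  ext n
  simp [csP, this, PowerSeries.coeff_rescale]

theorem rat_rescale {L : Type*} [Field L] (a : L) (ha : a ≠ 0) (c : PowerSeries L) (h : RatPS (PowerSeries.rescale a c)) :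
    RatPS c := by
  obtain ⟨N, P, hN, hNP⟩ := h
  have hco : ∀ R : Polynomial L, PowerSeries.rescale a⁻¹ (R : PowerSeries L) = ((R.comp (Polynomial.C a⁻¹ * Polynomial.X) : Polynomial L) : PowerSeries L) := by
    intro R; ext n; rw [PowerSeries.coeff_rescale, Polynomial.coeff_coe, Polynomial.coeff_coe, Polynomial.comp_C_mul_X_coeff, mul_comm]
  refine ⟨N.comp (Polynomial.C a⁻¹ * Polynomial.X), P.comp (Polynomial.C a⁻¹ * Polynomial.X), ?_, ?_⟩
  · intro h0
    apply hN
    ext n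
    have := congrArg (fun z => Polynomial.coeff z n) h0
    simpa [Polynomial.comp_C_mul_X_coeff, ha] using this
  · rw [← hco, ← hco, ← hNP, map_mul]
    congr 1
    ext n; simp only [PowerSeries.coeff_rescale]; rw [← mul_assoc, ← mul_pow, inv_mul_cancel₀ ha]; simp

theorem der_restrict {L : Type*} [Field L] (D : Derivation ℤ L L) (P : Subfield L) (h : ∀ a ∈ P, D a ∈ P) :
    ∃ d : Derivation ℤ P P, ∀ a : P, (d a : L) = D a := by
  refine ⟨Derivation.mk' { toFun := fun a => ⟨D a, h a a.2⟩, map_add' := ?_, map_smul' := ?_ } ?_, fun a => rfl⟩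
  · intro a b; ext; simp
  · intro a b; ext; simp
  · intro a b; ext; simp [mul_comm]

theorem closure_frac_coprime {M : Type*} [Field M] (k : Subfield M) (x z : M)
    (hinj : Function.Injective (Polynomial.eval₂RingHom k.subtype x))
    (hz : z ∈ Subfield.closure ((k : Set M) ∪ {x})) (hz0 : z ≠ 0) : ∃ P Q : Polynomial k, P ≠ 0 ∧ Q ≠ 0 ∧ IsCoprime P Q ∧ 
        z = P.eval₂ k.subtype x / Q.eval₂ k.subtype x := by
  classical
  obtain ⟨P, Q, hPQ⟩ := closure_frac k x z hz
  have hQ0 : Q ≠ 0 := by rintro rfl; exact hz0 (by simpa using hPQ)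
  have hg0 : EuclideanDomain.gcd P Q ≠ 0 := by
    intro h0; exact hQ0 (EuclideanDomain.gcd_eq_zero_iff.mp h0).2
  obtain ⟨P', hP'⟩ := EuclideanDomain.gcd_dvd_left P Q
  obtain ⟨Q', hQ'⟩ := EuclideanDomain.gcd_dvd_right P Q
  have hge : (EuclideanDomain.gcd P Q).eval₂ k.subtype x ≠ 0 := by
    intro h0
    exact hg0 (hinj (by simpa using h0))
  refine ⟨P', Q', ?_, by rintro rfl; simp at hQ'; exact hQ0 hQ', ?_, ?_⟩
  · rintro rfl; simp at hP'; exact hz0 (by simpa [hP'] using hPQ)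
  · refine ⟨EuclideanDomain.gcdA P Q, EuclideanDomain.gcdB P Q, ?_⟩
    apply mul_left_cancel₀ hg0
    have := EuclideanDomain.gcd_eq_gcd_ab P Q
    linear_combination (-EuclideanDomain.gcdA P Q) * hP' - EuclideanDomain.gcdB P Q * hQ' - this
  · rw [hPQ]
    have e1 := congrArg (Polynomial.eval₂ k.subtype x) hP'
    have e2 := congrArg (Polynomial.eval₂ k.subtype x) hQ'
    rw [Polynomial.eval₂_mul] at e1 e2
    rw [e1, e2, mul_div_mul_left _ _ hge]

/-- kernel of a derivation as a subfield -/
def kerS {L : Type*} [Field L] (D : Derivation ℤ L L) : Subfield L where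
  carrier := {a | D a = 0}
  mul_mem' := by intro a b ha hb; simp_all
  one_mem' := by simp
  add_mem' := by intro a b ha hb; simp_all
  zero_mem' := by simp
  neg_mem' := by intro a ha; simp_all
  inv_mem' := by intro a ha; simp_all [Derivation.leibniz_inv]

@[simp] theorem mem_kerS {L : Type*} [Field L] (D : Derivation ℤ L L) (a : L) : a ∈ kerS D ↔ D a = 0 := Iff.rfl

theorem mono_of_dvd {F : Type*} [Field F] [CharZero F] (q : Polynomial F) (hq : q ≠ 0)
    (h : q ∣ Polynomial.X * Polynomial.derivative q) : ∃ c n, c ≠ 0 ∧ q = Polynomial.monomial n c := by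
  obtain ⟨r, hr⟩ := h
  have hdeg : r.natDegree = 0 := by
    by_cases hr0 : r = 0
    · simp [hr0]
    have h1 := congrArg Polynomial.natDegree hr
    rw [Polynomial.natDegree_mul hq hr0] at h1
    have h2 : (Polynomial.X * Polynomial.derivative q).natDegree ≤ q.natDegree := by
      rcases Nat.eq_zero_or_pos q.natDegree with h0 | h0
      · rw [Polynomial.eq_C_of_natDegree_eq_zero h0]; simp
      · have := Polynomial.natDegree_derivative_lt (p := q) (by omega)
        have := Polynomial.natDegree_mul_le (p := Polynomial.X) (q := Polynomial.derivative q)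
        simp at this; omega
    omega
  rw [Polynomial.eq_C_of_natDegree_eq_zero hdeg] at hr
  have key : ∀ i, q.coeff i * (i - r.coeff 0) = 0 := by
    intro i
    have := congrArg (fun z => Polynomial.coeff z i) hr
    simp only [Polynomial.coeff_mul_C] at this
    cases i with
    | zero => simp at this ⊢; exact this
    | succ i => 
      rw [Polynomial.coeff_X_mul, Polynomial.coeff_derivative] at this
      push_cast; rw [mul_sub, this, sub_self]
  refine ⟨q.leadingCoeff, q.natDegree, by simpa using hq, ?_⟩
  ext i
  rw [Polynomial.coeff_monomial]
  split_ifs with h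
  · subst h; rfl
  · by_contra hne
    have h1 := (mul_eq_zero.mp (key i)).resolve_left hne
    have h2 := (mul_eq_zero.mp (key q.natDegree)).resolve_left (by simpa using hq)
    apply h
    have : (i:F) = q.natDegree := by linear_combination h1 - h2
    exact_mod_cast this.symm

theorem der_eval {L : Type*} [Field L] (D : Derivation ℤ L L) (k : Subfield L) (hk : ∀ a ∈ k, D a = 0) (e : L)
    (p : Polynomial k) : D (p.eval₂ k.subtype e) = (Polynomial.derivative p).eval₂ k.subtype e * D e := by
  induction p using Polynomial.induction_on' with
  | add p q hp hq => simp [Polynomial.eval₂_add, hp, hq, add_mul]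
  | monomial n c =>
    simp only [Polynomial.eval₂_monomial, Polynomial.derivative_monomial, Derivation.leibniz, Derivation.leibniz_pow]
    have : D (k.subtype c) = 0 := hk _ c.2
    rw [this]; simp; ring

theorem eig {P : Type*} [Field P] [CharZero P] (D : Derivation ℤ P P) (e : P) (d : ℤ) (hd : d ≠ 0) (he0 : e ≠ 0)
    (he : D e = d * e) (hgen : Subfield.closure ({a | D a = 0} ∪ {e}) = ⊤) :
    (∀ w μ, w ≠ 0 → D μ = 0 → D w = μ * w → ∃ l, D l = 0 ∧ ∃ n : ℤ, w = l * e ^ n) ∧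
    ∃ τ : P →+* P, (∀ a, D a = 0 → τ a = a) ∧ τ e = - e := by
  have hd' : (d : P) ≠ 0 := by exact_mod_cast hd
  set k := kerS D with hkdef
  have hinj := transc_of_der k ((d * e)⁻¹ • D) (by intro a ha; simp [(mem_kerS D a).1 ha]) e 
    (by simp [he]; field_simp)
  have hfr : ∀ z : P, z ∈ Subfield.closure ((k : Set P) ∪ {e}) := by
    intro z
    have : ((k : Set P) ∪ {e}) = {a | D a = 0} ∪ {e} := rfl
    rw [this, hgen]; trivial
  constructor
  · intro w μ hw hμ hDw
    obtain ⟨p, q, hp0, hq0, hcop, hpq⟩ := closure_frac_coprime k e w hinj (hfr w) hw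
    have hqe : q.eval₂ k.subtype e ≠ 0 := by
      intro h0; exact hq0 (hinj (by simpa using h0))
    have hpe : p.eval₂ k.subtype e ≠ 0 := by
      intro h0; exact hp0 (hinj (by simpa using h0))
    have hDp := der_eval D k (fun a ha => ha) e p
    have hDq := der_eval D k (fun a ha => ha) e q
    have hw' : w * q.eval₂ k.subtype e = p.eval₂ k.subtype e := by rw [hpq]; field_simp
    have hDw' := congrArg D hw'
    rw [Derivation.leibniz, hDw, hDp, hDq, he] at hDw'
    simp only [smul_eq_mul] at hDw'
    have hpoly : Polynomial.C (d : k) * Polynomial.X * (Polynomial.derivative p * q - p * Polynomial.derivative q) 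
        = Polynomial.C (⟨μ, hμ⟩ : k) * p * q := by
      apply hinj
      simp only [Polynomial.coe_eval₂RingHom, Polynomial.eval₂_mul, Polynomial.eval₂_sub, Polynomial.eval₂_C, Polynomial.eval₂_X]
      have h1 : k.subtype (d : k) = d := by simp
      have h2 : k.subtype ⟨μ, hμ⟩ = μ := rfl
      rw [h1, h2, ← hw']
      linear_combination (-q.eval₂ k.subtype e) * hDw'
    have hdk : (d : k) ≠ 0 := by exact_mod_cast hd
    have hCd : IsUnit (Polynomial.C (d : k)) := Polynomial.isUnit_C.2 (isUnit_iff_ne_zero.2 hdk)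
    obtain ⟨c1, n1, hc1, hp1⟩ := mono_of_dvd p hp0 (by
      have : p ∣ (Polynomial.C (d:k)) * (Polynomial.X * Polynomial.derivative p * q) :=
        ⟨Polynomial.C (⟨μ, hμ⟩ : k) * q + Polynomial.C (d:k) * Polynomial.X * Polynomial.derivative q, by linear_combination hpoly⟩
      exact hcop.dvd_of_dvd_mul_right (hCd.dvd_mul_left.1 this))
    obtain ⟨c2, n2, hc2, hq1⟩ := mono_of_dvd q hq0 (by
      have : q ∣ (Polynomial.C (d:k)) * (Polynomial.X * Polynomial.derivative q * p) :=
        ⟨-Polynomial.C (⟨μ, hμ⟩ : k) * p + Polynomial.C (d:k) * Polynomial.X * Polynomial.derivative p, by linear_combination -hpoly⟩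
      exact hcop.symm.dvd_of_dvd_mul_right (hCd.dvd_mul_left.1 this))
    refine ⟨c1 / c2, ?_, n1 - n2, ?_⟩
    · exact (c1 / c2 : k).2
    · rw [hpq, hp1, hq1, Polynomial.eval₂_monomial, Polynomial.eval₂_monomial, zpow_sub₀ he0]
      simp only [zpow_natCast, Subfield.coe_subtype]
      rw [mul_div_mul_comm]
  · let τ0 : Polynomial k →+* P := Polynomial.eval₂RingHom k.subtype (-e)
    have hτ0 : Function.Injective τ0 := transc_of_der k (-(d * e)⁻¹ • D) (by intro a ha; simp [(mem_kerS D a).1 ha]) (-e)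
      (by simp [he]; field_simp)
    obtain ⟨τ, hτ⟩ := ext_hom (Polynomial.eval₂RingHom k.subtype e) hinj 
      (fun z => by obtain ⟨p, q, h⟩ := closure_frac k e z (hfr z); exact ⟨p, q, h⟩) τ0 hτ0
    refine ⟨τ, ?_, ?_⟩
    · intro a ha
      have := hτ (Polynomial.C ⟨a, ha⟩)
      simpa [τ0] using this
    · have := hτ Polynomial.X
      simpa [τ0] using this

theorem mul_struct {P : Type*} [Field P] [CharZero P] (D : Derivation ℤ P P) (gens : Set P)
    (hgen : Subfield.closure ({a | D a = 0} ∪ gens) = ⊤)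
    (hrat : ∀ f ∈ gens, RatPS (csP D 1 f)) (hD : D ≠ 0) :
    ∃ (e : P) (d : ℤ), d ≠ 0 ∧ e ≠ 0 ∧ D e = d * e ∧ Subfield.closure ({a | D a = 0} ∪ {e}) = ⊤ := by
  have htop : Subfield.closure {b : P | ∃ n : ℤ, D b = n * b} = ⊤ := by
    rw [eq_top_iff, ← hgen, Subfield.closure_le]
    rintro f (hf | hf)
    · exact Subfield.subset_closure ⟨0, by simpa using hf⟩
    · exact rat_mul D f (hrat f hf)
  have hzp : ∀ (b : P) (c : P), b ≠ 0 → D b = c * b → ∀ m : ℤ, D (b ^ m) = m * c * b ^ m := by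
    intro b c hb h m
    rw [Derivation.leibniz_zpow, h]
    simp only [smul_eq_mul, zsmul_eq_mul]
    rw [zpow_sub_one₀ hb]; field_simp
  let S : AddSubgroup ℤ :=
    { carrier := {n | ∃ b, b ≠ 0 ∧ D b = n * b}
      add_mem' := by
        rintro m n ⟨a, ha, h1⟩ ⟨b, hb, h2⟩
        refine ⟨a * b, mul_ne_zero ha hb, ?_⟩
        rw [Derivation.leibniz, h1, h2]; simp; ring
      zero_mem' := ⟨1, one_ne_zero, by simp⟩
      neg_mem' := by
        rintro n ⟨a, ha, h1⟩
        refine ⟨a⁻¹, inv_ne_zero ha, ?_⟩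
        rw [Derivation.leibniz_inv, h1]; simp; field_simp }
  obtain ⟨d, hd⟩ := Int.subgroup_cyclic S
  have hdS : d ∈ S := by rw [hd]; exact AddSubgroup.subset_closure rfl
  obtain ⟨e, he0, he⟩ := hdS
  have hall : ∀ b n, b ≠ 0 → D b = (n:ℤ) * b → ∃ m : ℤ, n = m * d := by
    intro b n hb h
    have : n ∈ S := ⟨b, hb, h⟩
    rw [hd, AddSubgroup.mem_closure_singleton] at this
    obtain ⟨m, hm⟩ := this
    exact ⟨m, by simpa using hm.symm⟩
  refine ⟨e, d, ?_, he0, he, ?_⟩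
  · rintro rfl
    apply hD
    have : kerS D = ⊤ := by
      rw [eq_top_iff, ← htop, Subfield.closure_le]
      rintro b ⟨n, hn⟩
      by_cases hb : b = 0
      · simp [hb]
      obtain ⟨m, hm⟩ := hall b n hb hn
      simp at hm
      simpa [hm] using hn
    ext a
    have h1 : a ∈ kerS D := by rw [this]; trivial
    simpa using h1
  · rw [eq_top_iff, ← htop, Subfield.closure_le]
    rintro b ⟨n, hn⟩
    by_cases hb : b = 0
    · rw [hb]; exact zero_mem _
    obtain ⟨m, hm⟩ := hall b n hb hn
    have h1 : b / e ^ m ∈ Subfield.closure ({a | D a = 0} ∪ {e}) := by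
      apply Subfield.subset_closure; left
      show D (b / e ^ m) = 0
      rw [div_eq_mul_inv, ← zpow_neg, Derivation.leibniz, hn, hzp e d he0 he, hm]
      simp; ring
    have he' : e ∈ Subfield.closure ({a | D a = 0} ∪ {e}) := Subfield.subset_closure (Or.inr rfl)
    have h2 := zpow_mem he' m
    have := mul_mem h1 h2
    rwa [div_mul_cancel₀ _ (zpow_ne_zero _ he0)] at this


/-- conjugation of a derivation by an automorphism -/
def conjD {L : Type*} [Field L] (ρ : L ≃+* L) (D : Derivation ℤ L L) : Derivation ℤ L L :=
  Derivation.mk' { toFun := fun z => ρ (D (ρ.symm z)), map_add' := by intro a b; simp, map_smul' := by intro a b; simp }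
    (by intro a b; simp)

@[simp] theorem conjD_apply {L : Type*} [Field L] (ρ : L ≃+* L) (D : Derivation ℤ L L) (z : L) :
    conjD ρ D z = ρ (D (ρ.symm z)) := rfl

theorem der_comm_ext {K L : Type*} [Field K] [CharZero K] [Field L] [Algebra K L] [Algebra.IsAlgebraic K L]
    (D : Derivation ℤ L L) (ρ : L ≃+* L) (g : K ≃+* K) (hg : ∀ f, ρ (algebraMap K L f) = algebraMap K L (g f))
    (h : ∀ f : K, ρ (D (algebraMap K L f)) = D (ρ (algebraMap K L f))) (z : L) : ρ (D z) = D (ρ z) := by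
  have h1 : ∀ f : K, (conjD ρ D - D) (algebraMap K L f) = 0 := by
    intro f
    have : algebraMap K L f = ρ (algebraMap K L (g.symm f)) := by rw [hg]; simp
    rw [this, Derivation.sub_apply, conjD_apply, RingEquiv.symm_apply_apply, h, sub_self]
  have := der_alg_zero h1 (Algebra.IsAlgebraic.isAlgebraic (R := K) (ρ z))
  rw [Derivation.sub_apply, conjD_apply, RingEquiv.symm_apply_apply, sub_eq_zero] at this
  exact this

theorem sub_closure {L : Type*} [Field L] (P : Subfield L) (S : Set L) (hS : Subfield.closure S = P) :
    Subfield.closure ((fun p : P => (p : L)) ⁻¹' S) = ⊤ := by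
  have h1 : (Subfield.closure ((fun p : P => (p : L)) ⁻¹' S)).map P.subtype = P := by
    rw [RingHom.map_field_closure]
    have : P.subtype '' ((fun p : P => (p : L)) ⁻¹' S) = S := by
      ext z; constructor
      · rintro ⟨p, hp, rfl⟩; exact hp
      · intro hz; exact ⟨⟨z, hS ▸ Subfield.subset_closure hz⟩, hz, rfl⟩
    rw [this, hS]
  rw [eq_top_iff]
  intro p _
  have : (p : L) ∈ (Subfield.closure ((fun p : P => (p : L)) ⁻¹' S)).map P.subtype := by rw [h1]; exact p.2
  obtain ⟨q, hq, hqp⟩ := this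
  rwa [Subtype.ext (a1 := q) (a2 := p) hqp] at hq

theorem L2 {K Ω : Type*} [Field K] [CharZero K] [Field Ω] [CharZero Ω] [IsAlgClosed Ω] [Algebra K Ω] [Algebra.IsAlgebraic K Ω]
    (D₀ : Derivation ℤ K K) (dΩ : Derivation ℤ Ω Ω) (hdΩ : ∀ f, dΩ (algebraMap K Ω f) = algebraMap K Ω (D₀ f))
    (a : Ω) (ha : a ≠ 0) (hda : dΩ a = 0) (gens : Set K)
    (hgens : Subfield.closure ({f | D₀ f = 0} ∪ gens) = ⊤)
    (hrat : ∀ f ∈ gens, RatPS (csP (a • dΩ) 1 (algebraMap K Ω f))) (hD : D₀ ≠ 0) :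
    ∃ τ : K →+* K, (∃ f, τ f ≠ f) ∧ (∀ f, τ (τ f) = f) ∧ (∀ f, D₀ f = 0 → τ f = f) ∧
      ∀ g : K ≃+* K, (∀ f, g (D₀ f) = D₀ (g f)) → ∀ f, g (τ f) = τ (g f) := by
  set Λ := kerS dΩ with hΛ
  set S : Set Ω := (Λ : Set Ω) ∪ algebraMap K Ω '' gens with hS
  set P := Subfield.closure S with hP
  have hΛP : ∀ z, dΩ z = 0 → z ∈ P := fun z hz => Subfield.subset_closure (Or.inl hz)
  have hKP : ∀ f, algebraMap K Ω f ∈ P := by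
    have : Subfield.closure ({f | D₀ f = 0} ∪ gens) ≤ P.comap (algebraMap K Ω) := by
      rw [Subfield.closure_le]
      rintro f (hf | hf)
      · exact hΛP _ (by rw [hdΩ, show D₀ f = 0 from hf, map_zero])
      · exact Subfield.subset_closure (Or.inr ⟨f, hf, rfl⟩)
    intro f
    exact this (hgens ▸ Subfield.mem_top f)
  have hPle : ∀ Q : Subfield Ω, (∀ z, dΩ z = 0 → z ∈ Q) → (∀ f, algebraMap K Ω f ∈ Q) → ∀ z ∈ P, z ∈ Q := by
    intro Q h1 h2
    have : P ≤ Q := by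
      rw [hP, Subfield.closure_le]
      rintro z (hz | ⟨f, hf, rfl⟩)
      · exact h1 z hz
      · exact h2 f
    exact this
  have hdP : ∀ z ∈ P, (a • dΩ) z ∈ P := by
    intro z hz
    refine mul_mem (hΛP a hda) ?_
    show dΩ z ∈ P
    induction hz using Subfield.closure_induction with
    | mem z hz =>
      rcases hz with hz | ⟨f, hf, rfl⟩
      · rw [show dΩ z = 0 from hz]; exact zero_mem _
      · rw [hdΩ]; exact hKP _
    | one => simp
    | add x y hx hy h1 h2 => rw [map_add]; exact add_mem h1 h2
    | neg x hx h1 => rw [map_neg]; exact neg_mem h1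
    | inv x hx h1 => rw [Derivation.leibniz_inv]; exact mul_mem (neg_mem (pow_mem (inv_mem hx) _)) h1
    | mul x y hx hy h1 h2 => rw [Derivation.leibniz]; exact add_mem (mul_mem hx h2) (mul_mem hy h1)
  obtain ⟨dP, hdP'⟩ := der_restrict (a • dΩ) P hdP
  have hdP0 : ∀ p : P, dP p = 0 ↔ dΩ p = 0 := by
    intro p
    rw [← Subtype.coe_inj, hdP']; simp [ha]
  have htop : Subfield.closure ({p | dP p = 0} ∪ (fun p : P => (p:Ω)) ⁻¹' (algebraMap K Ω '' gens)) = ⊤ := by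
    rw [← sub_closure P S rfl, hS, Set.preimage_union]
    congr 2
    ext p; exact hdP0 p
  have hdPne : dP ≠ 0 := by
    intro h0
    apply hD
    ext f
    have := (hdP0 ⟨_, hKP f⟩).1 (by rw [h0]; rfl)
    simpa [hdΩ] using this
  obtain ⟨e, d, hd, he0, he, hegen⟩ := mul_struct dP _ htop (by
    rintro p ⟨f, hf, hfp⟩
    apply rat_descend (L := Ω)
    rw [← csP_map (algebraMap P Ω) dP (a • dΩ) (fun p => (hdP' p).symm)]
    rw [map_one]
    have : algebraMap P Ω p = algebraMap K Ω f := hfp.symm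
    rw [this]; exact hrat f hf) hdPne
  obtain ⟨heig, τ, hτ, hτe⟩ := eig dP e d hd he0 he hegen
  have hd' : (d : P) ≠ 0 := by exact_mod_cast hd
  -- eigenvector images
  have hlam : ∀ ρ : Ω ≃+* Ω, (∀ z, ρ (dΩ z) = dΩ (ρ z)) → ∀ p : P, (p : Ω) = ρ e → ∃ l, dP l = 0 ∧ ∃ n : ℤ, p = l * e ^ n := by
    intro ρ hρ p hp
    have hρa : ρ a ≠ 0 := by simpa using ha
    have hda' : dΩ (a * d / ρ a) = 0 := by
      have : a * d / ρ a ∈ Λ := div_mem (mul_mem hda (intCast_mem _ d)) (by rw [mem_kerS, ← hρ, hda, map_zero])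
      exact this
    refine heig p ⟨a * d / ρ a, hΛP _ hda'⟩ ?_ ?_ ?_
    · rintro rfl; apply he0; ext; simpa using hp.symm
    · rw [hdP0]; exact hda'
    · ext
      have h1 : a * dΩ e = d * e := by
        have := congrArg (fun p : P => (p:Ω)) he
        simpa [hdP'] using this
      have h2 := congrArg ρ h1
      rw [map_mul, map_mul, hρ, map_intCast] at h2
      rw [hdP', hp]
      simp only [Derivation.smul_apply, smul_eq_mul, Subfield.coe_mul, hp]
      field_simp
      linear_combination h2
  have key : ∀ ρ : Ω ≃+* Ω, (∀ z, ρ (dΩ z) = dΩ (ρ z)) → (hρ : ∀ z ∈ P, ρ z ∈ P) → (∀ z ∈ P, ρ.symm z ∈ P) → 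
      ∀ p : P, (τ ⟨ρ p, hρ p p.2⟩ : Ω) = ρ (τ p) := by
    intro ρ hρd hρ hρ'
    let ρP : P →+* P := (ρ.toRingHom.comp P.subtype).codRestrict P (fun p => hρ p p.2)
    have hρP : ∀ p, (ρP p : Ω) = ρ p := fun p => rfl
    have hker : ∀ p, dP p = 0 → dP (ρP p) = 0 := by
      intro p hp
      rw [hdP0] at hp ⊢
      rw [hρP, ← hρd, hp, map_zero]
    obtain ⟨l, hl, n, hn⟩ := hlam ρ hρd (ρP e) rfl
    obtain ⟨l', hl', m, hm⟩ := hlam ρ.symm (by intro z; apply ρ.injective; rw [hρd]; simp) ⟨ρ.symm e, hρ' e e.2⟩ rfl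
    have hodd : n * m = 1 := by
      have h1 : e = ρP ⟨ρ.symm e, hρ' e e.2⟩ := by ext; rw [hρP]; simp
      rw [hm, map_mul, map_zpow₀, hn, mul_zpow, ← zpow_mul, ← mul_assoc] at h1
      have hc : dP (ρP l' * l ^ m) = 0 := by
        have : ρP l' * l ^ m ∈ kerS dP := mul_mem (hker _ hl') (zpow_mem (show l ∈ kerS dP from hl) m)
        exact this
      have h2 := congrArg dP h1
      rw [Derivation.leibniz, hc, Derivation.leibniz_zpow, he] at h2
      simp only [smul_eq_mul, mul_zero, add_zero, zsmul_eq_mul] at h2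
      rw [zpow_sub_one₀ he0] at h2
      have h3 : (d : P) * e = (n * m : ℤ) * d * e := by
        rw [h2]; nth_rewrite 4 [h1]; field_simp
      have h4 : ((n * m : ℤ) : P) = 1 := by
        have : (d : P) * e ≠ 0 := mul_ne_zero hd' he0
        apply mul_right_cancel₀ this; linear_combination -h3
      exact_mod_cast h4
    have hn_odd : Odd n := by
      rcases Int.isUnit_iff.1 (IsUnit.of_mul_eq_one m hodd) with h | h <;> rw [h] <;> decide
    have heq : (P.subtype.comp τ).comp ρP = (ρ.toRingHom.comp P.subtype).comp τ := by
      apply RingHom.eq_of_eqOn_of_field_closure_eq_top hegen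
      rintro p (hp | hp)
      · show (τ (ρP p) : Ω) = ρ (τ p)
        rw [hτ _ (hker p hp), hτ p hp, hρP]
      · rw [Set.mem_singleton_iff] at hp
        subst hp
        show (τ (ρP p) : Ω) = ρ (τ p)
        have : τ (ρP p) = - ρP p := by
          rw [hn, map_mul, map_zpow₀, hτ _ hl, hτe, hn_odd.neg_zpow]; ring
        rw [this, hτe]
        simp [hρP]
    intro p
    exact RingHom.congr_fun heq p
  have hlift : ∀ (ρ : Ω ≃+* Ω) (g : K ≃+* K), (∀ f, ρ (algebraMap K Ω f) = algebraMap K Ω (g f)) → 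
     (∀ f, g (D₀ f) = D₀ (g f)) → (∀ z, ρ (dΩ z) = dΩ (ρ z)) ∧ (∀ z ∈ P, ρ z ∈ P) ∧ ∀ z ∈ P, ρ.symm z ∈ P := by
    intro ρ g hρ hg
    have h1 := der_comm_ext dΩ ρ g hρ (by intro f; rw [hdΩ, hρ, hρ, hg, hdΩ])
    refine ⟨h1, ?_, ?_⟩
    · apply hPle (P.comap ρ.toRingHom)
      · intro z hz; exact hΛP _ (by show dΩ (ρ z) = 0; rw [← h1, hz, map_zero])
      · intro f; show ρ _ ∈ P; rw [hρ]; exact hKP _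
    · apply hPle (P.comap ρ.symm.toRingHom)
      · intro z hz; exact hΛP _ (by show dΩ (ρ.symm z) = 0; apply ρ.injective; rw [h1]; simp [hz])
      · intro f; show ρ.symm _ ∈ P
        have : ρ.symm (algebraMap K Ω f) = algebraMap K Ω (g.symm f) := by
          apply ρ.injective; rw [hρ]; simp
        rw [this]; exact hKP _
  have hτK : ∀ f, ∃ f', (τ ⟨algebraMap K Ω f, hKP f⟩ : Ω) = algebraMap K Ω f' := by
    intro f
    by_contra! hcon
    obtain ⟨σ, hσ, hσ'⟩ := exists_aut (algebraMap K Ω).fieldRange (c := (τ ⟨algebraMap K Ω f, hKP f⟩ : Ω)) (by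
        obtain ⟨p, hp0, hp⟩ := Algebra.IsAlgebraic.isAlgebraic (R := K) (τ ⟨algebraMap K Ω f, hKP f⟩ : Ω)
        refine ⟨p.map (algebraMap K Ω).rangeRestrictField, ?_, ?_⟩
        · rwa [Ne, Polynomial.map_eq_zero]
        · rw [Polynomial.aeval_def, Polynomial.eval₂_map]
          exact hp) (by rintro ⟨f', hf'⟩; exact hcon f' hf'.symm)
    apply hσ'
    have hσK : ∀ f, σ (algebraMap K Ω f) = algebraMap K Ω (RingEquiv.refl K f) := fun f => hσ _ ⟨f, rfl⟩
    obtain ⟨h1, h2, h3⟩ := hlift σ (RingEquiv.refl K) hσK (fun f => rfl)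
    rw [← key σ h1 h2 h3]
    congr 3
    exact hσK f
  choose t ht using hτK
  have hinj : Function.Injective (algebraMap K Ω) := (algebraMap K Ω).injective
  let iK : K →+* P := (algebraMap K Ω).codRestrict P hKP
  have hiK : Function.Injective iK := iK.injective
  have ht2 : ∀ f, τ (iK f) = iK (t f) := fun f => Subtype.ext (ht f)
  let t' : K →+* K :=
    { toFun := t
      map_one' := by apply hiK; rw [← ht2]; simp
      map_mul' := by intro f g; apply hiK; rw [map_mul, ← ht2, ← ht2, ← ht2]; simp
      map_zero' := by apply hiK; rw [← ht2]; simp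
      map_add' := by intro f g; apply hiK; rw [map_add, ← ht2, ← ht2, ← ht2]; simp }
  have ht' : ∀ f, algebraMap K Ω (t' f) = (τ ⟨algebraMap K Ω f, hKP f⟩ : Ω) := fun f => (ht f).symm
  have hττ : ∀ p, τ (τ p) = p := by
    have : τ.comp τ = RingHom.id P := by
      apply RingHom.eq_of_eqOn_of_field_closure_eq_top hegen
      rintro p (hp | hp)
      · simp [hτ p hp]
      · rw [Set.mem_singleton_iff] at hp; subst hp; simp [hτe]
    exact fun p => RingHom.congr_fun this p
  refine ⟨t', ?_, ?_, ?_, ?_⟩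
  · by_contra! hcon
    have : τ = RingHom.id P := by
      apply RingHom.eq_of_eqOn_of_field_closure_eq_top htop
      rintro p (hp | ⟨f, hf, hfp⟩)
      · exact hτ p hp
      · ext
        have h1 := ht' f
        rw [hcon] at h1
        have h2 : (⟨algebraMap K Ω f, hKP f⟩ : P) = p := Subtype.ext hfp
        rw [h2] at h1
        simp [← h1, hfp]
    rw [this] at hτe
    simp at hτe
    have : (2 : P) * e = 0 := by linear_combination hτe
    simp [he0] at this
  · intro f
    apply hinj
    rw [ht']
    have : (⟨algebraMap K Ω (t' f), hKP (t' f)⟩ : P) = τ ⟨algebraMap K Ω f, hKP f⟩ := Subtype.ext (ht' f)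
    rw [this, hττ]
  · intro f hf
    apply hinj
    rw [ht', hτ]
    rw [hdP0, hdΩ, hf, map_zero]
  · intro g hg f
    obtain ⟨ρ, hρ⟩ := aut_lift (L := Ω) g
    obtain ⟨h1, h2, h3⟩ := hlift ρ g hρ hg
    apply hinj
    rw [← hρ, ht', ← key ρ h1 h2 h3, ht']
    congr 3
    exact hρ f

end B2

set_option linter.all false

noncomputable section D1

abbrev R2 := MvPolynomial (Fin 2) ℂ

variable {K : Type} [Field K] [CharZero K] [Algebra R2 K] [IsFractionRing R2 K]

def zz (i : Fin 2) : K := algebraMap R2 K (MvPolynomial.X i)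
def ccH (K : Type) [Field K] [Algebra R2 K] : ℂ →+* K := (algebraMap R2 K).comp MvPolynomial.C
abbrev cc (a : ℂ) : K := ccH K a

theorem cc_eq (a : ℂ) : (cc a : K) = algebraMap R2 K (MvPolynomial.C a) := rfl

theorem K2_le (Q : Subfield K) (hc : ∀ a, cc a ∈ Q) (hz : ∀ i, zz i ∈ Q) (f : K) : f ∈ Q := by
  have hp : ∀ p : R2, algebraMap R2 K p ∈ Q := by
    intro p
    induction p using MvPolynomial.induction_on with
    | C a => exact hc a
    | add p q hp hq => rw [map_add]; exact add_mem hp hq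
    | mul_X p i hp => rw [map_mul]; exact mul_mem hp (hz i)
  obtain ⟨p, q, hq, rfl⟩ := IsFractionRing.div_surjective (A := R2) f
  exact div_mem (hp p) (hp q)

theorem K2_gen : Subfield.closure (Set.range cc ∪ Set.range zz) = (⊤ : Subfield K) := by
  rw [eq_top_iff]
  intro f _
  apply K2_le
  · intro a; exact Subfield.subset_closure (Or.inl ⟨a, rfl⟩)
  · intro a; exact Subfield.subset_closure (Or.inr ⟨a, rfl⟩)

theorem K2_hom_ext {L : Type*} [Field L] (u v : K →+* L) (hc : ∀ a, u (cc a) = v (cc a)) (hz : ∀ i, u (zz i) = v (zz i)) :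
    u = v := by
  apply RingHom.eq_of_eqOn_of_field_closure_eq_top K2_gen
  rintro f (⟨a, rfl⟩ | ⟨i, rfl⟩)
  · exact hc a
  · exact hz i

theorem K2_aut_ext (u v : K ≃+* K) (hc : ∀ a, u (cc a) = v (cc a)) (hz : ∀ i, u (zz i) = v (zz i)) :
    u = v := by
  have := K2_hom_ext u.toRingHom v.toRingHom hc hz
  ext f
  exact RingHom.congr_fun this f

theorem K2_der_zero (D : Derivation ℤ K K) (hc : ∀ a, D (cc a) = 0) (hz : ∀ i, D (zz i) = 0) : D = 0 := by
  ext f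
  exact K2_le (kerS D) hc hz f

theorem K2_der_ext (D E : Derivation ℤ K K) (hc : ∀ a, D (cc a) = E (cc a)) (hz : ∀ i, D (zz i) = E (zz i)) : D = E := by
  rw [← sub_eq_zero]
  apply K2_der_zero <;> intro i <;> simp [hc, hz]

theorem exists_pd (i : Fin 2) : ∃ D : Derivation ℤ K K, ∀ p : R2, D (algebraMap R2 K p) = algebraMap R2 K (MvPolynomial.pderiv i p) := by
  let d : Derivation ℤ R2 K := Derivation.mk'
    { toFun := fun p => algebraMap R2 K (MvPolynomial.pderiv i p)
      map_add' := by intro a b; simp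
      map_smul' := by intro a b; simp }
    (by intro a b; simp [Algebra.smul_def])
  haveI : Algebra.IsAlgebraic R2 K := (IsFractionRing.comap_isAlgebraic_iff (A := R2) (K := K) (C := K)).2 inferInstance
  exact der_ext_alg d

def pd (i : Fin 2) : Derivation ℤ K K := (exists_pd i).choose
theorem pd_poly (i : Fin 2) (p : R2) : (pd i : Derivation ℤ K K) (algebraMap R2 K p) = algebraMap R2 K (MvPolynomial.pderiv i p) :=
  (exists_pd i).choose_spec p

@[simp] theorem pd_cc (i : Fin 2) (a : ℂ) : (pd i : Derivation ℤ K K) (cc a) = 0 := by rw [cc_eq, pd_poly]; simp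
@[simp] theorem pd_zz (i j : Fin 2) : (pd i : Derivation ℤ K K) (zz j) = if i = j then 1 else 0 := by
  rw [zz, pd_poly, MvPolynomial.pderiv_X]
  by_cases h : i = j
  · subst h; simp
  · simp [h, Pi.single_apply, Ne.symm h]

theorem exists_hatD (δ : Derivation ℤ ℂ ℂ) : ∃ D : Derivation ℤ K K, (∀ a, D (cc a) = cc (δ a)) ∧ ∀ i, D (zz i) = 0 := by
  letI : Algebra ℂ K := (ccH K).toAlgebra
  let d : Derivation ℤ ℂ K := Derivation.mk'
    { toFun := fun p => cc (δ p)
      map_add' := by intro a b; simp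
      map_smul' := by intro a b; simp }
    (by intro a b; simp [Algebra.smul_def]; rfl)
  haveI : IsScalarTower ℂ R2 K := IsScalarTower.of_algebraMap_eq (fun a => rfl)
  haveI : Algebra.FormallyEtale R2 K := Algebra.FormallyEtale.of_isLocalization (nonZeroDivisors R2)
  haveI : Algebra.FormallySmooth ℂ K := Algebra.FormallySmooth.comp ℂ R2 K
  obtain ⟨D, hD⟩ := der_ext (A := ℂ) (L := K) d
  refine ⟨D - D (zz 0) • pd 0 - D (zz 1) • pd 1, ?_, ?_⟩
  · intro a
    have : D (cc a) = cc (δ a) := hD a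
    simp [this]
  · intro i
    fin_cases i <;> simp

def hatD (δ : Derivation ℤ ℂ ℂ) : Derivation ℤ K K := (exists_hatD δ).choose
@[simp] theorem hatD_cc (δ : Derivation ℤ ℂ ℂ) (a : ℂ) : (hatD δ : Derivation ℤ K K) (cc a) = cc (δ a) := (exists_hatD δ).choose_spec.1 a
@[simp] theorem hatD_zz (δ : Derivation ℤ ℂ ℂ) (i : Fin 2) : (hatD δ : Derivation ℤ K K) (zz i) = 0 := (exists_hatD δ).choose_spec.2 i

def hatS (σ : ℂ ≃+* ℂ) : K ≃+* K := IsFractionRing.ringEquivOfRingEquiv (A := R2) (B := R2) (MvPolynomial.mapEquiv (Fin 2) σ)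
@[simp] theorem hatS_cc (σ : ℂ ≃+* ℂ) (a : ℂ) : (hatS σ : K ≃+* K) (cc a) = cc (σ a) := by
  rw [hatS, cc_eq, IsFractionRing.ringEquivOfRingEquiv_algebraMap]; simp [cc_eq]
@[simp] theorem hatS_zz (σ : ℂ ≃+* ℂ) (i : Fin 2) : (hatS σ : K ≃+* K) (zz i) = zz i := by
  rw [hatS, zz, IsFractionRing.ringEquivOfRingEquiv_algebraMap]; simp

theorem cc_inj : Function.Injective (cc : ℂ → K) := (ccH K).injective

theorem alg_closed_mem {F : Type*} [Field F] (k : Subfield F) [IsAlgClosed k] {f : F} (hf : IsAlgebraic k f) : f ∈ k := by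
  let L := IntermediateField.adjoin k {f}
  haveI : Algebra.IsAlgebraic k L := IntermediateField.isAlgebraic_adjoin_simple hf.isIntegral
  obtain ⟨a, ha⟩ := (IsAlgClosed.algebraMap_bijective_of_isIntegral (k := k) (K := L)).2 ⟨f, IntermediateField.mem_adjoin_simple_self k f⟩
  have := congrArg Subtype.val ha
  have h2 : (a : F) = f := this
  rw [← h2]; exact a.2

instance ccR_closed : IsAlgClosed (ccH K).fieldRange := IsAlgClosed.of_ringEquiv ℂ _ (ccH K).rangeRestrictFieldEquiv

theorem cc_alg {f : K} (hf : ∀ a, f ≠ cc a) : Transcendental (ccH K).fieldRange f := by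
  intro h
  obtain ⟨a, ha⟩ := alg_closed_mem _ h
  exact hf a ha.symm

/-- Three derivations of K2 over ℂ are dependent. -/
theorem three_dep (D : Fin 3 → Derivation ℤ K K) (hD : ∀ j a, D j (cc a) = 0) :
    ∃ v : Fin 3 → K, v ≠ 0 ∧ ∑ j, v j • D j = 0 := by
  have : ¬ LinearIndependent K (fun j => fun i => D j (zz i) : Fin 3 → Fin 2 → K) := by
    intro h
    have := h.fintype_card_le_finrank
    simp at this
  rw [Fintype.not_linearIndependent_iff] at this
  obtain ⟨v, hv, j, hj⟩ := this
  refine ⟨v, fun h => hj (congrFun h j), ?_⟩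
  apply K2_der_zero
  · intro a; rw [der_sum_apply]; simp [hD]
  · intro i; rw [der_sum_apply]
    have := congrFun hv i
    simpa using this

/-- evaluation at a point with dual derivations does not vanish -/
theorem nonvanish {F k : Type*} [Field F] [CharZero F] [Field k] (φ : k →+* F) (d : Fin 2 → Derivation ℤ F F) (z : Fin 2 → F)
    (hk : ∀ i a, d i (φ a) = 0) (hz : ∀ i j, d i (z j) = if i = j then 1 else 0) (p : MvPolynomial (Fin 2) k)
    (hp : p.eval₂ φ z = 0) : p = 0 := by
  have hder : ∀ i (p : MvPolynomial (Fin 2) k), d i (p.eval₂ φ z) = (MvPolynomial.pderiv i p).eval₂ φ z := by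
    intro i p
    induction p using MvPolynomial.induction_on with
    | C a => simp [hk]
    | add p q hp hq => simp [hp, hq]
    | mul_X p j hp => 
      rw [MvPolynomial.eval₂_mul, Derivation.leibniz, hp, Derivation.leibniz, MvPolynomial.pderiv_X]
      by_cases hij : i = j
      · subst hij; simp [hz]
      · simp [hz, Pi.single_apply, hij, Ne.symm hij]
  haveI : CharZero k := (φ.charZero_iff φ.injective).2 inferInstance
  have main : ∀ n (p : MvPolynomial (Fin 2) k), p.eval₂ φ z = 0 → (∀ m : Fin 2 →₀ ℕ, n ≤ m.degree → p.coeff m = 0) → p = 0 := by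
    intro n
    induction n with
    | zero => intro p _ h; ext m; simpa using h m (Nat.zero_le _)
    | succ n ih =>
      intro p hp h
      have hpd : ∀ i, MvPolynomial.pderiv i p = 0 := by
        intro i
        apply ih
        · rw [← hder, hp, map_zero]
        · intro m hm
          rw [MvPolynomial.coeff_pderiv, h, zero_mul]
          rw [map_add]; simp; omega
      have hC : p = MvPolynomial.C (p.coeff 0) := by
        ext m
        rw [MvPolynomial.coeff_C]
        split_ifs with h0
        · rw [h0]
        · obtain ⟨i, hi⟩ : ∃ i, m i ≠ 0 := by
            by_contra! hh; exact h0 (Finsupp.ext hh).symm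
          have := congrArg (MvPolynomial.coeff (m - Finsupp.single i 1)) (hpd i)
          rw [MvPolynomial.coeff_pderiv, tsub_add_cancel_of_le (by simpa [Nat.one_le_iff_ne_zero] using hi)] at this
          rw [MvPolynomial.coeff_zero] at this
          refine (mul_eq_zero.1 this).resolve_right ?_
          exact Nat.cast_add_one_ne_zero _
      rw [hC] at hp ⊢
      simp at hp
      simp [hp]
  exact main (p.totalDegree + 1) p hp (by
    intro m hm
    exact MvPolynomial.coeff_eq_zero_of_totalDegree_lt (by rw [← Finsupp.degree_apply]; omega))
end D1

set_option linter.all false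

noncomputable section D2

theorem lift_range {A B C : Type*} [CommRing A] [CommRing B] [CommRing C] (i : B →+* C) (hi : Function.Injective i) (g : A →+* C)
    (h : ∀ a, ∃ b, i b = g a) : ∃ e : A →+* B, ∀ a, i (e a) = g a := by
  choose e he using h
  refine ⟨RingHom.mk' ⟨⟨e, ?_⟩, ?_⟩ ?_, he⟩
  · exact hi (by rw [he, map_one, map_one])
  · exact fun a b => hi (by rw [map_mul, he, map_mul, he, he])
  · exact fun a b => hi (by simp only [MonoidHom.coe_mk, OneHom.coe_mk]; rw [map_add, he, map_add, he, he])

def gsub (i : Fin 2) (l : ℂ) : R2 →+* Polynomial (Polynomial ℂ) :=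
  MvPolynomial.eval₂Hom (Polynomial.C.comp Polynomial.C) (fun j => if j = i then Polynomial.C Polynomial.X else Polynomial.X + Polynomial.C (Polynomial.C l))

theorem gsub_eval (i : Fin 2) (l : ℂ) (p : R2) (v : Fin 2 → ℂ) :
    ((gsub i l p).eval (Polynomial.C (v (1 - i) - l))).eval (v i) = MvPolynomial.eval v p := by
  suffices h : ((Polynomial.evalRingHom (v i)).comp ((Polynomial.evalRingHom (Polynomial.C (v (1 - i) - l))).comp (gsub i l))) = MvPolynomial.eval v from RingHom.congr_fun h p
  apply MvPolynomial.ringHom_ext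
  · intro a; simp [gsub]
  · intro j
    by_cases h : j = i
    · subst h; simp [gsub]
    · have : j = 1 - i := by fin_cases i <;> fin_cases j <;> simp_all
      rw [← this]
      simp [gsub, h]

theorem gsub_inj (i : Fin 2) (l : ℂ) : Function.Injective (gsub i l) := by
  rw [injective_iff_map_eq_zero]
  intro p hp
  apply MvPolynomial.funext
  intro v
  rw [← gsub_eval i l, hp]; simp

theorem gsub_coeff_eval (i : Fin 2) (l : ℂ) (p : R2) (v : Fin 2 → ℂ) (hv : v (1 - i) = l) :
    ((gsub i l p).coeff 0).eval (v i) = MvPolynomial.eval v p := by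
  rw [← gsub_eval i l, hv]; simp [Polynomial.coeff_zero_eq_eval_zero]

theorem gsub_der (i : Fin 2) (l : ℂ) (p : R2) :
    (gsub i l (MvPolynomial.pderiv i p)).coeff 0 = Polynomial.derivative ((gsub i l p).coeff 0) := by
  have key : ∀ q, (gsub i l q).coeff 0 = (Polynomial.constantCoeff.comp (gsub i l)) q := fun q => rfl
  rw [key, key]
  induction p using MvPolynomial.induction_on with
  | C a => simp [gsub]
  | add p q hp hq => rw [map_add, map_add, map_add, hp, hq, Polynomial.derivative_add]
  | mul_X p j hp =>
    rw [Derivation.leibniz, map_add, smul_eq_mul, smul_eq_mul, map_mul, map_mul, map_mul, hp, Polynomial.derivative_mul]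
    by_cases h : j = i
    · subst h; simp [gsub]; ring
    · rw [MvPolynomial.pderiv_X]; simp [gsub, h, Pi.single_apply, Ne.symm h]; ring

variable {K : Type} [Field K] [CharZero K] [Algebra R2 K] [IsFractionRing R2 K]

theorem pd_exists {t : K} (ht : ∀ a, t ≠ cc a) : ∃ i, (pd i : Derivation ℤ K K) t ≠ 0 := by
  obtain ⟨d, hd, hdt⟩ := exists_der _ (cc_alg ht)
  by_contra! h
  have : d = d (zz 0) • pd 0 + d (zz 1) • pd 1 := by
    apply K2_der_ext
    · intro a; simp [hd _ ⟨a, rfl⟩]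
    · intro i; fin_cases i <;> simp
  rw [this] at hdt
  simp [h] at hdt

theorem place (L : Subfield K) (hc : ∀ a, cc a ∈ L) (t : K) (htL : t ∈ L) (ht : ∀ a, t ≠ cc a)
    (halg : ∀ f ∈ L, IsAlgebraic (Subfield.closure (((ccH K).fieldRange : Set K) ∪ {t})) f) :
    ∃ φ : L →+* RatFunc ℂ, ∀ a, φ ⟨cc a, hc a⟩ = RatFunc.C a := by
  obtain ⟨i, hi⟩ := pd_exists ht
  obtain ⟨p, q, hq0, hpq⟩ := IsFractionRing.div_surjective (A := R2) t
  have hq : q ≠ 0 := nonZeroDivisors.ne_zero hq0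
  have hq' : algebraMap R2 K q ≠ 0 := by simpa using hq
  set W := MvPolynomial.pderiv i p * q - p * MvPolynomial.pderiv i q with hW
  have hW0 : W ≠ 0 := by
    intro h
    have h1 := congrArg (algebraMap R2 K) h
    have h2 : algebraMap R2 K p = t * algebraMap R2 K q := by rw [← hpq]; field_simp
    have h3 := congrArg (pd i) h2
    rw [Derivation.leibniz, pd_poly, pd_poly] at h3
    rw [hW, map_sub, map_mul, map_mul, h3, h2, map_zero] at h1
    have : algebraMap R2 K q ^ 2 * pd i t = 0 := by rw [← h1]; simp; ring
    simp [hq', hi] at this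
  obtain ⟨v, hv⟩ : ∃ v, MvPolynomial.eval v (q * W) ≠ 0 := by
    by_contra! h
    exact mul_ne_zero hq hW0 (MvPolynomial.funext (by simpa using h))
  rw [map_mul] at hv
  have hvq := left_ne_zero_of_mul hv
  have hvW := right_ne_zero_of_mul hv
  let l := v (1 - i)
  let m : Polynomial ℂ →+* (RatFunc ℂ) := algebraMap _ _
  have hm : Function.Injective m := RatFunc.algebraMap_injective ℂ
  let g1 : R2 →+* PowerSeries (RatFunc ℂ) := (Polynomial.coeToPowerSeries.ringHom.comp (Polynomial.mapRingHom m)).comp (gsub i l)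
  have hg1 : Function.Injective g1 := by
    apply Function.Injective.comp (g := (Polynomial.coeToPowerSeries.ringHom.comp (Polynomial.mapRingHom m))) _ (gsub_inj i l)
    apply Function.Injective.comp (g := Polynomial.coeToPowerSeries.ringHom (R := (RatFunc ℂ)))
    · exact Polynomial.coe_injective (RatFunc ℂ)
    · exact Polynomial.map_injective m hm
  have hg1c : ∀ r, PowerSeries.constantCoeff (g1 r) = m ((gsub i l r).coeff 0) := by
    intro r
    rw [← PowerSeries.coeff_zero_eq_constantCoeff_apply]; simp [g1]
  let ip : PowerSeries (RatFunc ℂ) →+* LaurentSeries (RatFunc ℂ) := algebraMap _ _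
  have hip : Function.Injective ip := FaithfulSMul.algebraMap_injective _ _
  obtain ⟨g, hg⟩ := ext_hom (L' := LaurentSeries (RatFunc ℂ)) (algebraMap R2 K) (IsFractionRing.injective R2 K) (fun z => by
    obtain ⟨x, y, _, h⟩ := IsFractionRing.div_surjective (A := R2) z
    exact ⟨x, y, h.symm⟩) (ip.comp g1) (by rw [RingHom.coe_comp]; exact hip.comp hg1)
  have hgcc : ∀ a, g (cc a) = ip (PowerSeries.C (RatFunc.C a)) := by
    intro a
    rw [cc_eq, hg]
    simp [g1, gsub, m]
  -- t lies in the power series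
  have hq0 : PowerSeries.constantCoeff (g1 q) ≠ 0 := by
    rw [hg1c]
    intro h
    rw [map_eq_zero_iff _ hm] at h
    apply hvq
    rw [← gsub_coeff_eval i l q v rfl, h]; simp
  obtain ⟨τ, hτ⟩ : ∃ τ, τ * g1 q = g1 p := by
    obtain ⟨u, hu⟩ := (PowerSeries.isUnit_iff_constantCoeff.2 hq0.isUnit : IsUnit (g1 q))
    exact ⟨g1 p * ↑u⁻¹, by rw [← hu]; simp [mul_assoc]⟩
  have hgt : g t = ip τ := by
    rw [← hpq, map_div₀, hg, hg]
    have : ip (g1 q) ≠ 0 := by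
      rw [Ne, map_eq_zero_iff _ hip, map_eq_zero_iff _ hg1]; exact hq
    simp only [RingHom.comp_apply]
    rw [← hτ, map_mul]; field_simp
  set τ0 := PowerSeries.constantCoeff τ with hτ0
  have hτ0' : ∀ a, τ0 ≠ RatFunc.C a := by
    intro a ha
    have h1 := congrArg PowerSeries.constantCoeff hτ
    rw [map_mul, ← hτ0, ha, hg1c, hg1c] at h1
    have h2 : Polynomial.C a * (gsub i l q).coeff 0 = (gsub i l p).coeff 0 := by
      apply hm; rw [map_mul, ← h1]; simp [m]
    apply hvW
    rw [hW, map_sub, map_mul, map_mul, ← gsub_coeff_eval i l p v rfl, ← gsub_coeff_eval i l q v rfl,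
      ← gsub_coeff_eval i l (MvPolynomial.pderiv i p) v rfl, ← gsub_coeff_eval i l (MvPolynomial.pderiv i q) v rfl, gsub_der, gsub_der, ← h2]
    simp; ring
  have htr : Transcendental ℂ τ0 := by
    intro h
    haveI : IsAlgClosed (algebraMap ℂ (RatFunc ℂ)).fieldRange := IsAlgClosed.of_ringEquiv ℂ _ (algebraMap ℂ (RatFunc ℂ)).rangeRestrictFieldEquiv
    have h2 : IsAlgebraic (algebraMap ℂ (RatFunc ℂ)).fieldRange τ0 := by
      obtain ⟨P, hP, hP2⟩ := h
      refine ⟨P.map (algebraMap ℂ (RatFunc ℂ)).rangeRestrictField, ?_, ?_⟩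
      · rwa [Ne, Polynomial.map_eq_zero]
      · rw [Polynomial.aeval_def, Polynomial.eval₂_map]; exact hP2
    obtain ⟨a, ha⟩ := alg_closed_mem _ h2
    exact hτ0' a (by rw [← ha]; rfl)
  have hcl : ∀ z ∈ Subfield.closure (((ccH K).fieldRange : Set K) ∪ {t}), ∃ b, ip b = g z := by
    intro z hz
    obtain ⟨P, Q, rfl⟩ := closure_frac _ _ _ hz
    let e : (ccH K).fieldRange ≃+* ℂ := (ccH K).rangeRestrictFieldEquiv.symm
    have he : ∀ a, (ccH K).fieldRange.subtype a = cc (e a) := by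
      intro a
      obtain ⟨b, rfl⟩ := (ccH K).rangeRestrictFieldEquiv.surjective a
      simp [e]
    have ev : ∀ P : Polynomial (ccH K).fieldRange, g (P.eval₂ (ccH K).fieldRange.subtype t) = ip (P.eval₂ ((PowerSeries.C.comp RatFunc.C).comp e.toRingHom) τ) := by
      intro P
      rw [Polynomial.hom_eval₂, Polynomial.hom_eval₂, hgt]
      congr 1
      ext a
      simp only [RingHom.comp_apply]
      rw [he, hgcc]; rfl
    have ev2 : ∀ P : Polynomial (ccH K).fieldRange, P ≠ 0 → IsUnit (P.eval₂ ((PowerSeries.C.comp RatFunc.C).comp e.toRingHom) τ) := by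
      intro P hP
      rw [PowerSeries.isUnit_iff_constantCoeff, isUnit_iff_ne_zero, Polynomial.hom_eval₂]
      intro h
      apply hP
      have h3 : Polynomial.aeval τ0 (P.map e.toRingHom) = 0 := by
        rw [Polynomial.aeval_def, Polynomial.eval₂_map, ← h]
        congr 1
      have := (transcendental_iff.1 htr) _ h3
      rwa [Polynomial.map_eq_zero_iff e.injective] at this
    by_cases hQ : Q = 0
    · exact ⟨0, by simp [hQ]⟩
    obtain ⟨u, hu⟩ := ev2 Q hQ
    refine ⟨P.eval₂ ((PowerSeries.C.comp RatFunc.C).comp e.toRingHom) τ * ↑u⁻¹, ?_⟩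
    rw [map_div₀, ev, ev, ← hu, map_mul, eq_div_iff, mul_assoc, ← map_mul]
    · simp
    · rw [Ne, map_eq_zero_iff _ hip]; exact u.ne_zero
  obtain ⟨e0, he0⟩ := lift_range ip hip (g.comp (Subfield.closure (((ccH K).fieldRange : Set K) ∪ {t})).subtype) (fun a => hcl a a.2)
  have hL : ∀ f : L, ∃ b, ip b = g.comp L.subtype f := by
    intro f
    apply (IsIntegrallyClosed.isIntegral_iff (R := PowerSeries (RatFunc ℂ)) (K := LaurentSeries (RatFunc ℂ))).1
    have hf := (halg f f.2).isIntegral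
    obtain ⟨P, hP, hP2⟩ := hf
    refine ⟨P.map e0, hP.map e0, ?_⟩
    rw [Polynomial.eval₂_map]
    have := congrArg g hP2
    rw [Polynomial.hom_eval₂, map_zero] at this
    rw [← this]
    show _ = Polynomial.eval₂ _ (g.comp L.subtype f) P
    congr 1
    exact RingHom.ext fun a => he0 a
  obtain ⟨eL, heL⟩ := lift_range ip hip (g.comp L.subtype) hL
  refine ⟨PowerSeries.constantCoeff.comp eL, fun a => ?_⟩
  have : eL ⟨cc a, hc a⟩ = PowerSeries.C (RatFunc.C a) := by
    apply hip
    rw [heL]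
    exact hgcc a
  rw [RingHom.comp_apply, this]; simp
end D2

set_option linter.all false

noncomputable section D3

variable {K : Type} [Field K] [CharZero K] [Algebra R2 K] [IsFractionRing R2 K]

theorem luroth_sub (L : Subfield K) (hc : ∀ a, cc a ∈ L) (t : K) (htL : t ∈ L) (ht : ∀ a, t ≠ cc a)
    (halg : ∀ f ∈ L, IsAlgebraic (Subfield.closure (((ccH K).fieldRange : Set K) ∪ {t})) f) :
    ∃ t1 ∈ L, (∀ a, t1 ≠ cc a) ∧ L = Subfield.closure (Set.range cc ∪ {t1}) := by
  obtain ⟨φ, hφ⟩ := place L hc t htL ht halg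
  have hal : ∀ a, algebraMap ℂ (RatFunc ℂ) a = RatFunc.C a := fun a => rfl
  let E : IntermediateField ℂ (RatFunc ℂ) := φ.fieldRange.toIntermediateField (by
    intro a; exact ⟨_, hφ a⟩)
  have hE : ∀ z, z ∈ E ↔ ∃ f, φ f = z := fun z => Iff.rfl
  have hEbot : E ≠ ⊥ := by
    intro h
    have : φ ⟨t, htL⟩ ∈ E := (hE _).2 ⟨_, rfl⟩
    rw [h, IntermediateField.mem_bot] at this
    obtain ⟨a, ha⟩ := this
    rw [hal, ← hφ] at ha
    have := φ.injective ha
    exact ht a (congrArg Subtype.val this).symm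
  obtain ⟨t1, ht1⟩ := (hE _).1 (RatFunc.Luroth.generator_mem (E := E))
  have hn := RatFunc.Luroth.generator_ne_C hEbot
  refine ⟨t1, t1.2, ?_, ?_⟩
  · intro a ha
    apply hn
    refine ⟨a, ?_⟩
    rw [← hφ, ← ht1]; congr 1; exact Subtype.ext ha
  · apply le_antisymm
    · intro f hf
      let P : Subfield (RatFunc ℂ) := ((Subfield.closure (Set.range cc ∪ {(t1 : K)})).comap L.subtype).map φ
      have hP : φ ⟨f, hf⟩ ∈ P := by
        have h1 : φ ⟨f, hf⟩ ∈ E := (hE _).2 ⟨_, rfl⟩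
        rw [RatFunc.Luroth.eq_adjoin_generator (E := E)] at h1
        have h2 : (IntermediateField.adjoin ℂ {RatFunc.Luroth.generator E}).toSubfield ≤ P := by
          rw [IntermediateField.adjoin_toSubfield, Subfield.closure_le]
          rintro z (⟨a, rfl⟩ | rfl)
          · refine ⟨⟨cc a, hc a⟩, ?_, hφ a⟩
            exact Subfield.subset_closure (Or.inl ⟨a, rfl⟩)
          · exact ⟨t1, Subfield.subset_closure (Or.inr rfl), ht1⟩
        exact h2 h1
      obtain ⟨u, hu, hu2⟩ := hP
      have := φ.injective hu2
      subst this
      exact hu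
    · rw [Subfield.closure_le]
      rintro z (⟨a, rfl⟩ | rfl)
      · exact hc a
      · exact t1.2

def CYg (K : Type) [Field K] [Algebra R2 K] : Subfield K := Subfield.closure (Set.range cc ∪ {zz 1})

theorem der_basis (d : Derivation ℤ K K) (hd : ∀ a, d (cc a) = 0) : d = d (zz 0) • pd 0 + d (zz 1) • pd 1 := by
  apply K2_der_ext
  · intro a; simp [hd a]
  · intro i; fin_cases i <;> simp

theorem M1 (D₀ : Derivation ℤ K K) (hD : ∀ a, D₀ (cc a) = 0) (s : K) (hs : D₀ s = 1)
    (hcl : Subfield.closure ({a | D₀ a = 0} ∪ {s}) = ⊤) :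
    ∃ ψ : K ≃+* K, (∀ a, ψ (cc a) = cc a) ∧ ∀ g : K ≃+* K, (∀ f, D₀ (g f) = 0 ↔ D₀ f = 0) →
      ∀ f, ψ (g (ψ.symm f)) ∈ CYg K ↔ f ∈ CYg K := by
  -- a nonconstant element of the kernel
  have hcl' : ∀ D : Derivation ℤ K K, (∀ a, D₀ a = 0 → D a = 0) → D s = 0 → D = 0 := by
    intro D h1 h2
    have : (⊤ : Subfield K) ≤ kerS D := by
      rw [← hcl, Subfield.closure_le]
      rintro z (hz | rfl)
      · exact h1 z hz
      · exact h2
    ext f; exact this (Subfield.mem_top f)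
  obtain ⟨t, htL, ht⟩ : ∃ t, D₀ t = 0 ∧ ∀ a, t ≠ cc a := by
    by_contra! h
    have key : ∀ D : Derivation ℤ K K, (∀ a, D (cc a) = 0) → D s = 0 → D = 0 := by
      intro D h1 h2
      refine hcl' D (fun a ha => ?_) h2
      obtain ⟨b, rfl⟩ := h a ha
      exact h1 b
    have h1 := key ((pd 1 s : K) • pd 0 - (pd 0 s : K) • pd 1) (by intro a; simp) (by simp [mul_comm])
    have h2 := congrArg (fun D : Derivation ℤ K K => D (zz 0)) h1
    have h3 := congrArg (fun D : Derivation ℤ K K => D (zz 1)) h1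
    simp at h2 h3
    have := der_basis D₀ hD
    have h4 := congrArg (fun D : Derivation ℤ K K => D s) this
    simp [h2, h3, hs] at h4
  have hkc : ∀ a, cc a ∈ kerS D₀ := hD
  have halg : ∀ f ∈ kerS D₀, IsAlgebraic (Subfield.closure (((ccH K).fieldRange : Set K) ∪ {t})) f := by
    intro f hf
    by_contra hn
    obtain ⟨d1, h11, h12⟩ := exists_der _ hn
    obtain ⟨d2, h21, h22⟩ := exists_der _ (cc_alg ht)
    have h1c : ∀ a, d1 (cc a) = 0 := fun a => h11 _ (Subfield.subset_closure (Or.inl ⟨a, rfl⟩))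
    have h1t : d1 t = 0 := h11 _ (Subfield.subset_closure (Or.inr rfl))
    have h2c : ∀ a, d2 (cc a) = 0 := fun a => h21 _ ⟨a, rfl⟩
    obtain ⟨v, hv, hv0⟩ := three_dep ![D₀, d1, d2] (by intro j a; fin_cases j <;> simp [hD, h1c, h2c])
    rw [Fin.sum_univ_three] at hv0
    simp at hv0
    have e1 := congrArg (fun D : Derivation ℤ K K => D t) hv0
    simp [htL, h1t, h22] at e1
    have e2 := congrArg (fun D : Derivation ℤ K K => D f) hv0
    have hf' : D₀ f = 0 := hf
    simp [hf', h12, e1] at e2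
    have e3 := congrArg (fun D : Derivation ℤ K K => D s) hv0
    simp [hs, e1, e2] at e3
    apply hv
    ext j; fin_cases j <;> simp [e1, e2, e3]
  obtain ⟨t1, ht1, ht1c, hL⟩ := luroth_sub (kerS D₀) hkc t htL ht halg
  obtain ⟨d1, hd1, hd1t⟩ := exists_der _ (cc_alg ht1c)
  have hd1c : ∀ a, d1 (cc a) = 0 := fun a => hd1 _ ⟨a, rfl⟩
  have ht1' : D₀ t1 = 0 := ht1
  let z : Fin 2 → K := ![s, t1]
  let d : Fin 2 → Derivation ℤ K K := ![D₀, d1 - d1 s • D₀]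
  let g1 : R2 →+* K := MvPolynomial.eval₂Hom (ccH K) z
  have hg1 : Function.Injective g1 := by
    rw [injective_iff_map_eq_zero]
    intro p hp
    refine nonvanish (ccH K) d z ?_ ?_ p hp
    · intro i a
      have e1 := hD a
      have e2 := hd1c a
      fin_cases i <;> simp [d, e1, e2]
    · intro i j; fin_cases i <;> fin_cases j <;> simp [d, z, hs, hd1t, ht1']
  obtain ⟨u, hu⟩ := ext_hom (L' := K) (algebraMap R2 K) (IsFractionRing.injective R2 K) (fun z => by
    obtain ⟨x, y, _, h⟩ := IsFractionRing.div_surjective (A := R2) z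
    exact ⟨x, y, h.symm⟩) g1 hg1
  have hucc : ∀ a, u (cc a) = cc a := by
    intro a; rw [cc_eq, hu]; simp [g1, cc_eq]
  have hu0 : u (zz 0) = s := by rw [zz, hu]; simp [g1, z]
  have hu1 : u (zz 1) = t1 := by rw [zz, hu]; simp [g1, z]
  have hmap : (CYg K).map u = kerS D₀ := by
    rw [CYg, RingHom.map_field_closure, hL]
    congr 1
    rw [Set.image_union, Set.image_singleton, hu1, ← Set.range_comp]
    congr 2
    ext a; exact hucc a
  have hsurj : Function.Surjective u := by
    have : (⊤ : Subfield K) ≤ u.fieldRange := by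
      rw [← hcl, Subfield.closure_le]
      rintro w (hw | rfl)
      · have : w ∈ (CYg K).map u := by rw [hmap]; exact hw
        obtain ⟨y, _, hy⟩ := this
        exact ⟨y, hy⟩
      · exact ⟨_, hu0⟩
    intro f
    exact this (Subfield.mem_top f)
  let ψ0 : K ≃+* K := RingEquiv.ofBijective u ⟨u.injective, hsurj⟩
  have hψ0 : ∀ f, ψ0 f = u f := fun f => rfl
  have hmem : ∀ f, f ∈ CYg K ↔ D₀ (ψ0 f) = 0 := by
    intro f
    rw [← mem_kerS, ← hmap, hψ0]
    constructor
    · intro h; exact ⟨f, h, rfl⟩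
    · rintro ⟨y, hy, hyf⟩
      rw [← u.injective hyf]; exact hy
  refine ⟨ψ0.symm, ?_, ?_⟩
  · intro a
    rw [RingEquiv.symm_apply_eq, hψ0, hucc]
  · intro g hg f
    rw [hmem, hmem]
    simp [hg]
end D3

set_option linter.all false

noncomputable section D4

theorem min_rep0 {K : Type*} [Field K] (A : Subfield K) {ι : Type*} (m : ι → K) (hm : LinearIndependent A m) (f : K)
    (hex : ∃ p q : ι →₀ A, q ≠ 0 ∧ f * Finsupp.linearCombination A m q = Finsupp.linearCombination A m p) :
    ∃ p q : ι →₀ A, q ≠ 0 ∧ f * Finsupp.linearCombination A m q = Finsupp.linearCombination A m p ∧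
      ∀ θ : K →+ K, (∀ a ∈ A, θ a ∈ A) → θ 1 = 0 → (∀ a ∈ A, ∀ i, θ (a * m i) = θ a * m i) → (∀ z, θ (f * z) = f * θ z) →
        ∀ i, θ (p i) = 0 ∧ θ (q i) = 0 := by
  classical
  let good : ℕ → Prop := fun n => ∃ p q : ι →₀ A, q ≠ 0 ∧ f * Finsupp.linearCombination A m q = Finsupp.linearCombination A m p ∧
    p.support.card + q.support.card = n
  have hg : ∃ n, good n := by
    obtain ⟨p, q, h1, h2⟩ := hex
    exact ⟨_, p, q, h1, h2, rfl⟩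
  obtain ⟨p1, q1, hq1, hpq1, hn1⟩ := Nat.find_spec hg
  have hmin : ∀ p q : ι →₀ A, q ≠ 0 → f * Finsupp.linearCombination A m q = Finsupp.linearCombination A m p →
      Nat.find hg ≤ p.support.card + q.support.card := fun p q h1 h2 => Nat.find_min' hg ⟨p, q, h1, h2, rfl⟩
  obtain ⟨i0, hi0⟩ : ∃ i, q1 i ≠ 0 := by
    by_contra! h; exact hq1 (Finsupp.ext h)
  let c := (q1 i0)⁻¹
  have hc : c ≠ 0 := inv_ne_zero hi0
  have hsp : (c • p1).support = p1.support := Finsupp.support_smul_eq hc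
  have hsq : (c • q1).support = q1.support := Finsupp.support_smul_eq hc
  have hrel : f * Finsupp.linearCombination A m (c • q1) = Finsupp.linearCombination A m (c • p1) := by
    rw [map_smul, map_smul, ← hpq1, mul_smul_comm]
  have hq0 : (c • q1) ≠ 0 := smul_ne_zero hc hq1
  have hqi0 : (c • q1) i0 = 1 := by simp [c, hi0]
  have hcard : (c • p1).support.card + (c • q1).support.card = Nat.find hg := by rw [hsp, hsq, hn1]
  generalize c • p1 = p at *
  generalize c • q1 = q at *
  have uniq : ∀ p' q' : ι →₀ A, (∀ i, p i = 0 → p' i = 0) → (∀ i, q i = 0 → q' i = 0) → q' i0 = 0 →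
      f * Finsupp.linearCombination A m q' = Finsupp.linearCombination A m p' → p' = 0 ∧ q' = 0 := by
    intro p' q' hp' hq' h0 hr
    have hq'0 : q' = 0 := by
      by_contra hne
      obtain ⟨j, hj⟩ : ∃ i, q' i ≠ 0 := by
        by_contra! h; exact hne (Finsupp.ext h)
      let e := q j / q' j
      have h3 : (q - e • q') i0 = 1 := by simp [h0, hqi0]
      have h4 : (q - e • q') j = 0 := by simp [e, hj]
      have := hmin (p - e • p') (q - e • q') (by intro h; rw [h] at h3; simp at h3) (by
        rw [map_sub, map_sub, map_smul, map_smul, mul_sub, mul_smul_comm, hr, hrel])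
      have s1 : (p - e • p').support ⊆ p.support := by
        intro i hi
        rw [Finsupp.mem_support_iff] at hi ⊢
        intro h; apply hi; simp [h, hp' i h]
      have s2 : (q - e • q').support ⊂ q.support := by
        rw [Finset.ssubset_iff_of_subset]
        · refine ⟨j, ?_, ?_⟩
          · rw [Finsupp.mem_support_iff]; intro h; exact hj (hq' j h)
          · rw [Finsupp.notMem_support_iff]; exact h4
        · intro i hi
          rw [Finsupp.mem_support_iff] at hi ⊢
          intro h; apply hi; simp [h, hq' i h]
      have c1 := Finset.card_le_card s1
      have c2 := Finset.card_lt_card s2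
      omega
    refine ⟨?_, hq'0⟩
    rw [hq'0, map_zero, mul_zero] at hr
    exact (linearIndependent_iff.1 hm) p' hr.symm
  refine ⟨p, q, hq0, hrel, ?_⟩
  intro θ hA h1 hmul hf
  let θA : A → A := fun a => ⟨θ a, hA a a.2⟩
  have hθ0 : θA 0 = 0 := Subtype.ext (by simp [θA])
  have key : ∀ r : ι →₀ A, Finsupp.linearCombination A m (r.mapRange θA hθ0) = θ (Finsupp.linearCombination A m r) := by
    intro r
    rw [Finsupp.linearCombination_apply, Finsupp.linearCombination_apply, Finsupp.sum_mapRange_index (by simp), Finsupp.sum, Finsupp.sum, map_sum]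
    apply Finset.sum_congr rfl
    intro i _
    show θ (r i) * m i = θ (r i * m i)
    rw [hmul _ (r i).2]
  obtain ⟨e1, e2⟩ := uniq (p.mapRange θA hθ0) (q.mapRange θA hθ0) (fun i hi => by simp [hi, hθ0]) (fun i hi => by simp [hi, hθ0])
    (by rw [Finsupp.mapRange_apply, hqi0]; exact Subtype.ext h1) (by rw [key, key, ← hf, hrel])
  intro i
  constructor
  · have := DFunLike.congr_fun e1 i
    rw [Finsupp.mapRange_apply] at this
    exact congrArg Subtype.val this
  · have := DFunLike.congr_fun e2 i
    rw [Finsupp.mapRange_apply] at this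
    exact congrArg Subtype.val this

theorem min_rep {K : Type*} [Field K] (A : Subfield K) (S : Set K) (f u v : K)
    (hu : u ∈ Submodule.span A S) (hv : v ∈ Submodule.span A S) (hv0 : v ≠ 0) (huv : f * v = u) :
    ∃ (b : Set K) (p q : b →₀ A), b ⊆ S ∧ (q.sum fun i a => (a : K) * i) ≠ 0 ∧
      f * (q.sum fun i a => (a : K) * i) = (p.sum fun i a => (a : K) * i) ∧
      (∀ D : Derivation ℤ K K, (∀ a ∈ A, D a ∈ A) → (∀ z ∈ S, D z = 0) → D f = 0 → ∀ i, D (p i) = 0 ∧ D (q i) = 0) ∧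
      (∀ s : K →+* K, (∀ a ∈ A, s a ∈ A) → (∀ z ∈ S, s z = z) → s f = f → ∀ i, s (p i) = p i ∧ s (q i) = q i) := by
  obtain ⟨b, hbS, hspan, hli⟩ := exists_linearIndependent A S
  rw [← hspan] at hu hv
  rw [← Subtype.range_coe (s := b)] at hu hv
  rw [Finsupp.mem_span_range_iff_exists_finsupp] at hu hv
  obtain ⟨p0, hp0⟩ := hu
  obtain ⟨q0, hq0⟩ := hv
  obtain ⟨p, q, h1, h2, h3⟩ := min_rep0 A (Subtype.val : b → K) hli f ⟨p0, q0, by rintro rfl; simp at hq0; exact hv0 hq0.symm, by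
    rw [Finsupp.linearCombination_apply, Finsupp.linearCombination_apply, hp0, hq0, huv]⟩
  refine ⟨b, p, q, hbS, ?_, ?_, ?_, ?_⟩
  · intro h; exact h1 ((linearIndependent_iff.1 hli) q h)
  · exact h2
  · intro D hA hz hf
    exact h3 D.toLinearMap.toAddMonoidHom hA (by simp) (by intro a ha i; simp [hz _ (hbS i.2), mul_comm]) (by intro z; simp [hf])
  · intro s hA hz hf i
    have := h3 (s.toAddMonoidHom - AddMonoidHom.id K) (by intro a ha; exact sub_mem (hA a ha) ha) (by simp) (by intro a ha i; simp [hz _ (hbS i.2), sub_mul]) (by intro z; simp [hf, mul_sub]) i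
    simpa [sub_eq_zero] using this
end D4

set_option linter.all false

noncomputable section D5

theorem clos_countable {F : Type*} [Field F] (S : Set F) (hS : S.Countable) : ((Subfield.closure S : Subfield F) : Set F).Countable := by
  have := Subfield.cardinalMk_closure_le_max S
  rw [← Cardinal.le_aleph0_iff_set_countable] at hS ⊢
  exact this.trans (max_le hS le_rfl)

def Kil (S : Set ℂ) (δ : Derivation ℤ ℂ ℂ) : Prop := ∀ a ∈ S, δ a = 0

theorem Kil.mono {S T : Set ℂ} (h : S ⊆ T) {δ : Derivation ℤ ℂ ℂ} (hT : Kil T δ) : Kil S δ := fun a ha => hT a (h ha)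

def clS (S : Set ℂ) : Subfield ℂ := ⨅ δ : {δ // Kil S δ}, kerS δ.1
theorem mem_clS {S : Set ℂ} {c : ℂ} : c ∈ clS S ↔ ∀ δ, Kil S δ → δ c = 0 := by
  simp [clS, Subfield.mem_iInf]

theorem clS_sub (S : Set ℂ) : S ⊆ clS S := fun a ha => mem_clS.2 fun δ h => h a ha
theorem clS_mono {S T : Set ℂ} (h : S ⊆ T) : clS S ≤ clS T := fun a ha => mem_clS.2 fun δ hδ => mem_clS.1 ha δ (hδ.mono h)
theorem Kil_clS {S : Set ℂ} {δ : Derivation ℤ ℂ ℂ} (h : Kil S δ) : Kil (clS S) δ := fun a ha => mem_clS.1 ha δ h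
theorem clS_le {S T : Set ℂ} (h : S ⊆ clS T) : clS S ≤ clS T := fun a ha => mem_clS.2 fun δ hδ => mem_clS.1 ha δ ((Kil_clS hδ).mono h)

theorem clS_alg {S : Set ℂ} {c : ℂ} (hc : c ∈ clS S) : IsAlgebraic (Subfield.closure S) c := by
  by_contra h
  obtain ⟨D, h1, h2⟩ := exists_der _ h
  have := mem_clS.1 hc D (fun a ha => h1 a (Subfield.subset_closure ha))
  rw [h2] at this; exact one_ne_zero this

theorem not_clS {S : Set ℂ} {c : ℂ} (hc : c ∉ clS S) : ∃ δ, Kil S δ ∧ δ c = 1 := by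
  rw [mem_clS] at hc
  push Not at hc
  obtain ⟨δ, h1, h2⟩ := hc
  exact ⟨(δ c)⁻¹ • δ, fun a ha => by simp [h1 a ha], by simp [h2]⟩

theorem clS_countable {S : Set ℂ} (hS : S.Countable) : (clS S : Set ℂ).Countable := by
  haveI : Countable (Subfield.closure S) := (clos_countable S hS).to_subtype
  exact (Algebraic.countable (Subfield.closure S) ℂ).mono fun c hc => clS_alg hc

theorem alg_clS {S : Set ℂ} {k : Subfield ℂ} (hk : ∀ a ∈ k, a ∈ clS S) {c : ℂ} (hc : IsAlgebraic k c) : c ∈ clS S := by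
  rw [mem_clS]
  intro δ hδ
  exact der_alg_zero (K := k) (fun a => mem_clS.1 (hk a a.2) δ hδ) hc

theorem clS_fin {S : Set ℂ} {c : ℂ} (hc : c ∈ clS S) : ∃ S0 : Finset ℂ, (S0 : Set ℂ) ⊆ S ∧ c ∈ clS (S0 : Set ℂ) := by
  classical
  have h1 : ∀ a ∈ Subfield.closure S, ∃ S0 : Finset ℂ, (S0 : Set ℂ) ⊆ S ∧ a ∈ clS (S0 : Set ℂ) := by
    intro a ha
    induction ha using Subfield.closure_induction with
    | mem x hx => exact ⟨{x}, by simpa using hx, clS_sub _ (by simp)⟩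
    | one => exact ⟨∅, by simp, one_mem _⟩
    | add x y hx hy h1 h2 =>
      obtain ⟨S1, a1, b1⟩ := h1
      obtain ⟨S2, a2, b2⟩ := h2
      exact ⟨S1 ∪ S2, by simp [a1, a2], add_mem (clS_mono (by simp) b1) (clS_mono (by simp) b2)⟩
    | neg x hx h1 =>
      obtain ⟨S1, a1, b1⟩ := h1
      exact ⟨S1, a1, neg_mem b1⟩
    | inv x hx h1 =>
      obtain ⟨S1, a1, b1⟩ := h1
      exact ⟨S1, a1, inv_mem b1⟩
    | mul x y hx hy h1 h2 =>
      obtain ⟨S1, a1, b1⟩ := h1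
      obtain ⟨S2, a2, b2⟩ := h2
      exact ⟨S1 ∪ S2, by simp [a1, a2], mul_mem (clS_mono (by simp) b1) (clS_mono (by simp) b2)⟩
  choose! N hN1 hN2 using h1
  obtain ⟨P, hP, hPc⟩ := clS_alg hc
  let S0 : Finset ℂ := P.support.biUnion fun i => N (P.coeff i)
  refine ⟨S0, ?_, ?_⟩
  · intro a ha
    simp only [S0, Finset.coe_biUnion, Set.mem_iUnion] at ha
    obtain ⟨i, _, hi⟩ := ha
    exact hN1 _ (P.coeff i).2 hi
  · have hco : ∀ i, (P.coeff i : ℂ) ∈ clS (S0 : Set ℂ) := by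
      intro i
      by_cases hi : P.coeff i = 0
      · rw [hi]; exact zero_mem _
      · refine clS_mono ?_ (hN2 _ (P.coeff i).2)
        intro a ha
        simp only [S0, Finset.coe_biUnion, Set.mem_iUnion]
        exact ⟨i, by simpa using hi, ha⟩
    refine alg_clS (k := clS (S0 : Set ℂ)) (fun a ha => ha) ?_
    have hcoef : (↑(P.map (Subfield.closure S).subtype).coeffs : Set ℂ) ⊆ (clS (S0 : Set ℂ)).toSubring := by
      intro a ha
      obtain ⟨i, _, hi⟩ := Polynomial.mem_coeffs_iff.1 (Finset.mem_coe.1 ha)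
      rw [hi, Polynomial.coeff_map]; exact hco i
    refine ⟨(P.map (Subfield.closure S).subtype).toSubring (clS (S0 : Set ℂ)).toSubring hcoef, ?_, ?_⟩
    · intro h
      have h9 := Polynomial.map_toSubring (P.map (Subfield.closure S).subtype) (clS (S0 : Set ℂ)).toSubring hcoef
      rw [h, Polynomial.map_zero] at h9
      exact hP ((Polynomial.map_eq_zero _).1 h9.symm)
    · rw [Polynomial.aeval_def]
      have := Polynomial.eval₂_map (clS (S0 : Set ℂ)).toSubring.subtype (RingHom.id ℂ) c (p := (P.map (Subfield.closure S).subtype).toSubring (clS (S0 : Set ℂ)).toSubring hcoef)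
      rw [Polynomial.map_toSubring, Polynomial.eval₂_map] at this
      exact this.symm.trans hPc

variable {K : Type} [Field K] [CharZero K] [Algebra R2 K] [IsFractionRing R2 K]

theorem coef_rep (f : K) : ∃ S0 : Finset ℂ, f ∈ Subfield.closure (cc '' (S0 : Set ℂ) ∪ Set.range zz) ∧
    (∀ δ, hatD δ f = 0 → ∀ c ∈ S0, δ c = 0) ∧ (∀ σ, hatS σ f = f → ∀ c ∈ S0, σ c = c) := by
  classical
  let A := (ccH K).fieldRange
  let S : Set K := Set.range fun m : Fin 2 →₀ ℕ => algebraMap R2 K (MvPolynomial.monomial m 1)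
  have hspan : ∀ p : R2, algebraMap R2 K p ∈ Submodule.span A S := by
    intro p
    induction p using MvPolynomial.induction_on' with
    | monomial m a =>
      have : algebraMap R2 K (MvPolynomial.monomial m a) = (⟨cc a, a, rfl⟩ : A) • algebraMap R2 K (MvPolynomial.monomial m 1) := by
        show _ = (cc a : K) * _
        rw [cc_eq, ← map_mul, MvPolynomial.C_mul_monomial, mul_one]
      rw [this]
      exact Submodule.smul_mem _ _ (Submodule.subset_span ⟨m, rfl⟩)
    | add p q hp hq => rw [map_add]; exact add_mem hp hq
  obtain ⟨u, v, hv, huv⟩ := IsFractionRing.div_surjective (A := R2) f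
  have hv' : algebraMap R2 K v ≠ 0 := by simpa using nonZeroDivisors.ne_zero hv
  obtain ⟨b, p, q, hb, hq, hpq, hD, hs⟩ := min_rep A S f _ _ (hspan u) (hspan v) hv' (by rw [← huv]; field_simp)
  have hSz : ∀ z ∈ S, z ∈ Subfield.closure (Set.range (zz : Fin 2 → K)) := by
    rintro z ⟨m, rfl⟩
    simp only [MvPolynomial.monomial_eq]
    rw [Finsupp.prod, map_mul, map_prod]
    refine mul_mem (by simp) (prod_mem fun i _ => ?_)
    rw [map_pow]; exact pow_mem (Subfield.subset_closure (Set.mem_range_self (f := (zz : Fin 2 → K)) i)) _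
  have hch : ∀ a : A, ∃ c, cc c = (a : K) := fun a => a.2
  choose ch hch using hch
  let S0 : Finset ℂ := p.support.image (fun i => ch (p i)) ∪ q.support.image (fun i => ch (q i))
  have hcl : ∀ r : b →₀ A, (∀ i ∈ r.support, ch (r i) ∈ S0) → (r.sum fun i a => (a : K) * i) ∈ Subfield.closure (cc '' (S0 : Set ℂ) ∪ Set.range zz) := by
    intro r hr
    refine sum_mem fun i hi => mul_mem ?_ ?_
    · refine Subfield.subset_closure (Or.inl ⟨_, hr i hi, hch _⟩)
    · exact Subfield.closure_mono (by simp) (hSz _ (hb i.2))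
  refine ⟨S0, ?_, ?_, ?_⟩
  · rw [← eq_div_iff hq] at hpq
    rw [hpq]
    refine div_mem (hcl p ?_) (hcl q ?_)
    · intro i hi; exact Finset.mem_union_left _ (Finset.mem_image_of_mem _ hi)
    · intro i hi; exact Finset.mem_union_right _ (Finset.mem_image_of_mem _ hi)
  · intro δ hδ
    have := hD (hatD δ) (by rintro a ⟨c, rfl⟩; exact ⟨δ c, (hatD_cc δ c).symm⟩) (by
      have : Subfield.closure (Set.range (zz : Fin 2 → K)) ≤ kerS (hatD δ) := by
        rw [Subfield.closure_le]; rintro z ⟨i, rfl⟩; exact hatD_zz δ i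
      exact fun z hz => this (hSz z hz)) hδ
    intro c hc
    simp only [S0, Finset.mem_union, Finset.mem_image] at hc
    rcases hc with ⟨i, _, rfl⟩ | ⟨i, _, rfl⟩
    · have h := (this i).1
      rw [← hch, hatD_cc] at h
      exact (map_eq_zero_iff _ cc_inj).1 h
    · have h := (this i).2
      rw [← hch, hatD_cc] at h
      exact (map_eq_zero_iff _ cc_inj).1 h
  · intro σ hσ
    have := hs (hatS σ).toRingHom (by rintro a ⟨c, rfl⟩; exact ⟨σ c, (hatS_cc σ c).symm⟩) (by
      have : Subfield.closure (Set.range (zz : Fin 2 → K)) ≤ (hatS σ : K ≃+* K).toRingHom.eqLocusField (RingHom.id K) := by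
        rw [Subfield.closure_le]; rintro z ⟨i, rfl⟩; exact hatS_zz σ i
      exact fun z hz => this (hSz z hz)) hσ
    intro c hc
    simp only [S0, Finset.mem_union, Finset.mem_image] at hc
    rcases hc with ⟨i, _, rfl⟩ | ⟨i, _, rfl⟩
    · have h : (hatS σ : K ≃+* K) (p i) = p i := (this i).1
      rw [← hch, hatS_cc] at h
      exact cc_inj h
    · have h : (hatS σ : K ≃+* K) (q i) = q i := (this i).2
      rw [← hch, hatS_cc] at h
      exact cc_inj h

def Kc (K : Type) [Field K] [CharZero K] [Algebra R2 K] [IsFractionRing R2 K] (S : Set ℂ) : Subfield K := ⨅ δ : {δ // Kil S δ}, kerS (hatD δ.1)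
theorem mem_Kc {S : Set ℂ} {f : K} : f ∈ Kc K S ↔ ∀ δ, Kil S δ → hatD δ f = 0 := by
  simp [Kc, Subfield.mem_iInf]

theorem Kc_mono {S T : Set ℂ} (h : S ⊆ clS T) : Kc K S ≤ Kc K T := fun a ha => mem_Kc.2 fun δ hδ => mem_Kc.1 ha δ ((Kil_clS hδ).mono h)

theorem zz_Kc (S : Set ℂ) (i : Fin 2) : zz i ∈ Kc K S := mem_Kc.2 fun δ _ => hatD_zz δ i
theorem cc_Kc {S : Set ℂ} {c : ℂ} : cc c ∈ Kc K S ↔ c ∈ clS S := by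
  rw [mem_Kc, mem_clS]
  simp only [hatD_cc]
  exact forall_congr' fun δ => forall_congr' fun _ => map_eq_zero_iff _ cc_inj

theorem clos_Kc {S0 S : Set ℂ} (h : S0 ⊆ clS S) : Subfield.closure (cc '' S0 ∪ Set.range zz) ≤ Kc K S := by
  rw [Subfield.closure_le]
  rintro z (⟨c, hc, rfl⟩ | ⟨i, rfl⟩)
  · exact cc_Kc.2 (h hc)
  · exact zz_Kc S i

theorem Kc_clos {S : Set ℂ} {f : K} (hf : f ∈ Kc K S) : f ∈ Subfield.closure (cc '' (clS S : Set ℂ) ∪ Set.range zz) := by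
  obtain ⟨S0, h1, h2, _⟩ := coef_rep f
  refine Subfield.closure_mono ?_ h1
  refine Set.union_subset_union_left _ (Set.image_mono ?_)
  intro c hc
  exact mem_clS.2 fun δ hδ => h2 δ (mem_Kc.1 hf δ hδ) c hc

theorem Kc_countable {S : Set ℂ} (hS : S.Countable) : (Kc K S : Set K).Countable := by
  refine (clos_countable (cc '' (clS S : Set ℂ) ∪ Set.range zz) ?_).mono fun f hf => Kc_clos hf
  exact ((clS_countable hS).image _).union (Set.countable_range _)

theorem Kc_fin {S : Set ℂ} {f : K} (hf : f ∈ Kc K S) : ∃ S0 : Finset ℂ, (S0 : Set ℂ) ⊆ S ∧ f ∈ Kc K (S0 : Set ℂ) := by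
  classical
  obtain ⟨S0, h1, h2, _⟩ := coef_rep f
  have h3 : ∀ c ∈ S0, c ∈ clS S := fun c hc => mem_clS.2 fun δ hδ => h2 δ (mem_Kc.1 hf δ hδ) c hc
  choose! N hN1 hN2 using fun c hc => clS_fin (h3 c hc)
  refine ⟨S0.biUnion N, ?_, clos_Kc ?_ h1⟩
  · intro a ha
    simp only [Finset.coe_biUnion, Set.mem_iUnion] at ha
    obtain ⟨c, hc, ha⟩ := ha
    exact hN1 c hc ha
  · intro c hc
    refine clS_mono ?_ (hN2 c hc)
    intro a ha
    simp only [Finset.coe_biUnion, Set.mem_iUnion]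
    exact ⟨c, hc, ha⟩

theorem Kc_all (f : K) : ∃ S0 : Finset ℂ, f ∈ Kc K (S0 : Set ℂ) := by
  obtain ⟨S0, h1, _⟩ := coef_rep f
  exact ⟨S0, clos_Kc (clS_sub _) h1⟩

/-- automorphisms defined over S -/
def BB (K : Type) [Field K] [CharZero K] [Algebra R2 K] [IsFractionRing R2 K] (S : Set ℂ) (h : K ≃+* K) : Prop :=
  ∀ δ, Kil S δ → ∀ f, h (hatD δ f) = hatD δ (h f)

theorem BB_mono {S T : Set ℂ} (hST : S ⊆ clS T) {h : K ≃+* K} (hh : BB K S h) : BB K T h :=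
  fun δ hδ => hh δ ((Kil_clS hδ).mono hST)

theorem comm_hat {h : K ≃+* K} (hc : ∀ a, h (cc a) = cc a) {δ : Derivation ℤ ℂ ℂ} (hz : ∀ i, hatD δ (h (zz i)) = 0) (f : K) :
    h (hatD δ f) = hatD δ (h f) := by
  have : conjD h (hatD δ) = hatD δ := by
    have key : conjD h.symm (hatD δ) = hatD δ := by
      apply K2_der_ext
      · intro a; simp [hc, RingEquiv.symm_apply_eq]
      · intro i; simp [hz, RingEquiv.symm_apply_eq]
    have : conjD h (conjD h.symm (hatD δ)) = conjD h (hatD δ) := by rw [key]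
    rw [← this]; ext z; simp
  have h2 := congrArg (fun D : Derivation ℤ K K => D (h f)) this
  simpa using h2

theorem BB_iff {S : Set ℂ} {h : K ≃+* K} (hc : ∀ a, h (cc a) = cc a) : BB K S h ↔ ∀ i, h (zz i) ∈ Kc K S := by
  constructor
  · intro hB i
    rw [mem_Kc]
    intro δ hδ
    rw [← hB δ hδ]; simp
  · intro hz δ hδ f
    exact comm_hat hc (fun i => mem_Kc.1 (hz i) δ hδ) f

theorem BB_Kc {S : Set ℂ} {h : K ≃+* K} (hB : BB K S h) {f : K} (hf : f ∈ Kc K S) : h f ∈ Kc K S := by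
  rw [mem_Kc] at hf ⊢
  intro δ hδ; rw [← hB δ hδ, hf δ hδ, map_zero]

theorem BB_fin {S : Set ℂ} {h : K ≃+* K} (hc : ∀ a, h (cc a) = cc a) (hB : BB K S h) : ∃ S0 : Finset ℂ, (S0 : Set ℂ) ⊆ S ∧ BB K (S0 : Set ℂ) h := by
  classical
  choose N hN1 hN2 using fun i => Kc_fin ((BB_iff hc).1 hB i)
  refine ⟨Finset.univ.biUnion N, ?_, (BB_iff hc).2 fun i => Kc_mono ?_ (hN2 i)⟩
  · intro a ha
    simp only [Finset.coe_biUnion, Set.mem_iUnion] at ha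
    obtain ⟨c, hc, ha⟩ := ha
    exact hN1 c ha
  · refine Set.Subset.trans ?_ (clS_sub _)
    intro a ha
    simp only [Finset.coe_biUnion, Set.mem_iUnion]
    exact ⟨i, by simp, ha⟩

theorem BB_all {h : K ≃+* K} (hc : ∀ a, h (cc a) = cc a) : ∃ S0 : Finset ℂ, BB K (S0 : Set ℂ) h := by
  have : BB K Set.univ h := by
    rw [BB_iff hc]; intro i; rw [mem_Kc]; intro δ hδ
    have : δ = 0 := by ext a; exact hδ a trivial
    subst this
    have : (hatD 0 : Derivation ℤ K K) = 0 := K2_der_zero _ (by simp) (by simp)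
    rw [this]; rfl
  obtain ⟨S0, _, h⟩ := BB_fin hc this
  exact ⟨S0, h⟩

theorem BB_countable {S : Set ℂ} (hS : S.Countable) : {h : K ≃+* K | (∀ a, h (cc a) = cc a) ∧ BB K S h}.Countable := by
  haveI : Countable (Kc K S) := (Kc_countable hS).to_subtype
  let Φ : {h : K ≃+* K | (∀ a, h (cc a) = cc a) ∧ BB K S h} → (Fin 2 → Kc K S) := fun h i => ⟨h.1 (zz i), (BB_iff h.2.1).1 h.2.2 i⟩
  have : Function.Injective Φ := by
    intro h1 h2 h
    apply Subtype.ext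
    apply K2_aut_ext
    · intro a; rw [h1.2.1, h2.2.1]
    · intro i; exact congrArg Subtype.val (congrFun h i)
  exact Set.countable_coe_iff.1 this.countable

/-- closing up -/
theorem closing (N : Finset ℂ → Set ℂ) (hN : ∀ S, (N S).Countable) (F0 : Set ℂ) (h0 : F0.Countable) :
    ∃ F : Set ℂ, F.Countable ∧ F0 ⊆ F ∧ ∀ S : Finset ℂ, (S : Set ℂ) ⊆ F → N S ⊆ F := by
  let st : Set ℂ → Set ℂ := fun F => F ∪ ⋃ S ∈ {S : Finset ℂ | (S : Set ℂ) ⊆ F}, N S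
  let ch : ℕ → Set ℂ := fun n => st^[n] F0
  have hs : ∀ n, ch (n + 1) = st (ch n) := fun n => Function.iterate_succ_apply' st n F0
  have hc : ∀ n, (ch n).Countable := by
    intro n
    induction n with
    | zero => exact h0
    | succ n ih =>
      rw [hs]
      have h5 : {S : Finset ℂ | (S : Set ℂ) ⊆ ch n}.Countable :=
        ((Set.countable_setOf_finite_subset ih).preimage_of_injOn (f := fun S : Finset ℂ => (S : Set ℂ)) (Finset.coe_injective.injOn)).mono
          (fun S hS => (⟨S.finite_toSet, hS⟩ : (S : Set ℂ) ∈ {t : Set ℂ | t.Finite ∧ t ⊆ ch n}))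
      exact ih.union (h5.biUnion fun S _ => hN S)
  have hmono : Monotone ch := monotone_nat_of_le_succ fun n => by rw [hs]; exact Set.subset_union_left
  refine ⟨⋃ n, ch n, Set.countable_iUnion hc, Set.subset_iUnion ch 0, ?_⟩
  intro S hS
  obtain ⟨n, hn⟩ : ∃ n, (S : Set ℂ) ⊆ ch n := by
    exact (directed_of_isDirected_le hmono).exists_mem_subset_of_finset_subset_biUnion hS
  refine Set.Subset.trans ?_ (Set.subset_iUnion ch (n + 1))
  rw [hs]
  intro a ha
  exact Or.inr (Set.mem_biUnion hn ha)
end D5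

set_option linter.all false

noncomputable section D6

variable {K : Type} [Field K] [CharZero K] [Algebra R2 K] [IsFractionRing R2 K]

structure GD (G : Set (K ≃+* K)) : Prop where
  fc : ∀ g ∈ G, ∀ a, g (cc a) = cc a
  ab : ∀ g ∈ G, ∀ h ∈ G, ∀ f, g (h f) = h (g f)
  cen : ∀ a : K ≃+* K, (∀ c, a (cc c) = cc c) → (∀ g ∈ G, ∀ f, a (g f) = g (a f)) → a ∈ G
  tf : ∀ a ∈ G, ∀ n : ℕ, 0 < n → (∀ f, a^[n] f = f) → ∀ f, a f = f
  unc : ¬ G.Countable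

def fixG (G : Set (K ≃+* K)) : Subfield K := ⨅ g : G, (g.1.toRingHom.eqLocusField (RingHom.id K))
theorem mem_fixG {G : Set (K ≃+* K)} {f : K} : f ∈ fixG G ↔ ∀ g ∈ G, g f = f := by
  simp only [fixG, Subfield.mem_iInf, Subtype.forall]
  rfl

def Dp (k : Subfield K) (T : Set (K ≃+* K)) (D : Derivation ℤ K K) : Prop := (∀ f ∈ k, D f = 0) ∧ ∀ t ∈ T, ∀ f, t (D f) = D (t f)

def vec (D : Derivation ℤ K K) : Fin 2 → K := fun i => D (zz i)

theorem der_basis_exists (s : Set (Derivation ℤ K K)) (hs : ∀ D ∈ s, ∀ a, D (cc a) = 0) :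
    ∃ (n : ℕ) (D : Fin n → Derivation ℤ K K), (∀ l, D l ∈ s) ∧ (∀ c : Fin n → K, ∑ l, c l • D l = 0 → c = 0) ∧
      ∀ E : Derivation ℤ K K, (∀ a, E (cc a) = 0) → vec E ∈ Submodule.span K (vec '' s) → ∃ c : Fin n → K, E = ∑ l, c l • D l := by
  classical
  obtain ⟨b, hb, hspan, hli⟩ := exists_linearIndependent K (vec '' s)
  haveI : Finite b := hli.finite
  haveI : Fintype b := Fintype.ofFinite b
  let e := Fintype.equivFin b
  have hch : ∀ l, ∃ D ∈ s, vec D = (e.symm l : Fin 2 → K) := fun l => hb (e.symm l).2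
  choose D hD1 hD2 using hch
  refine ⟨Fintype.card b, D, hD1, ?_, ?_⟩
  · intro c hc
    have hli2 : LinearIndependent K (fun l => (e.symm l : Fin 2 → K)) := hli.comp _ e.symm.injective
    rw [Fintype.linearIndependent_iff] at hli2
    funext l
    refine hli2 c ?_ l
    funext i
    have := congrArg (fun E : Derivation ℤ K K => E (zz i)) hc
    simp only [der_sum_apply] at this
    rw [Finset.sum_apply]
    simp only [← hD2]
    simpa [vec] using this
  · intro E hE hv
    rw [← hspan] at hv
    have : (b : Set (Fin 2 → K)) = Set.range (fun l => (e.symm l : Fin 2 → K)) := by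
      ext z; constructor
      · intro hz; exact ⟨e ⟨z, hz⟩, by simp⟩
      · rintro ⟨l, rfl⟩; exact (e.symm l).2
    rw [this, Submodule.mem_span_range_iff_exists_fun] at hv
    obtain ⟨c, hc⟩ := hv
    refine ⟨c, K2_der_ext _ _ ?_ ?_⟩
    · intro a; rw [hE, der_sum_apply]; simp [hs _ (hD1 _)]
    · intro i; rw [der_sum_apply]
      have := congrFun hc i
      rw [Finset.sum_apply] at this
      simp only [← hD2] at this
      exact this.symm

theorem coef_fix {n : ℕ} {D : Fin n → Derivation ℤ K K} (hli : ∀ c : Fin n → K, ∑ l, c l • D l = 0 → c = 0) (t : K ≃+* K)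
    (hD : ∀ l f, t (D l f) = D l (t f)) (c : Fin n → K) (hE : ∀ f, t ((∑ l, c l • D l) f) = (∑ l, c l • D l) (t f)) (l : Fin n) : t (c l) = c l := by
  have : (fun l => t (c l) - c l) = 0 := by
    apply hli
    ext z
    obtain ⟨f, rfl⟩ := t.surjective z
    have := hE f
    rw [der_sum_apply, der_sum_apply, map_sum] at this
    rw [der_sum_apply]
    simp only [Derivation.smul_apply, smul_eq_mul, map_mul, hD] at this ⊢
    simp only [sub_mul, Finset.sum_sub_distrib, this]
    simp
  exact sub_eq_zero.1 (congrFun this l)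

structure M5D (G : Set (K ≃+* K)) (F : Set ℂ) (n : ℕ) (D : Fin n → Derivation ℤ K K) : Prop where
  cnt : F.Countable
  DG : ∀ l, Dp (fixG G) G (D l)
  li : ∀ c : Fin n → K, ∑ l, c l • D l = 0 → c = 0
  coef : ∀ l i, D l (zz i) ∈ Kc K F
  A : ∀ f, (∀ t ∈ G, BB K F t → t f = f) → f ∈ fixG G
  B : ∀ a : K ≃+* K, (∀ c, a (cc c) = cc c) → BB K F a → (∀ t ∈ G, BB K F t → ∀ f, a (t f) = t (a f)) → a ∈ G
  C : ∀ E, Dp (fixG G) {t | t ∈ G ∧ BB K F t} E → Dp (fixG G) G E ∧ ∃ c : Fin n → K, E = ∑ l, c l • D l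

theorem cc_fixG {G : Set (K ≃+* K)} (hG : GD G) (a : ℂ) : cc a ∈ fixG G := mem_fixG.2 fun g hg => hG.fc g hg a

theorem M5 {G : Set (K ≃+* K)} (hG : GD G) : ∃ F n D, M5D G F n D := by
  classical
  set k := fixG G with hk
  have hkc : ∀ a, cc a ∈ k := cc_fixG hG
  have hDpc : ∀ T D, Dp k T D → ∀ a, D (cc a) = 0 := fun T D h a => h.1 _ (hkc a)
  let V : Set (K ≃+* K) → Submodule K (Fin 2 → K) := fun T => Submodule.span K (vec '' {D | Dp k T D})
  have hDmono : ∀ T T' D, T ⊆ T' → Dp k T' D → Dp k T D := fun T T' D h hD => ⟨hD.1, fun t ht => hD.2 t (h ht)⟩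
  have hVmono : ∀ T T', T ⊆ T' → V T' ≤ V T := fun T T' h => Submodule.span_mono (Set.image_mono fun D hD => hDmono T T' D h hD)
  obtain ⟨W, ⟨Tm, hTmc, hTmG, hTmV⟩, hmin⟩ := WellFounded.has_min (wellFounded_lt (α := Submodule K (Fin 2 → K)))
    {W | ∃ T : Set (K ≃+* K), T.Countable ∧ T ⊆ G ∧ V T = W} ⟨V ∅, ∅, Set.countable_empty, Set.empty_subset _, rfl⟩
  have hTmin : ∀ T, T.Countable → T ⊆ G → Tm ⊆ T → V T = V Tm := by
    intro T h1 h2 h3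
    have h4 := hVmono _ _ h3
    have h5 := hmin (V T) ⟨T, h1, h2, rfl⟩
    rw [← hTmV] at h5
    exact eq_of_le_of_not_lt h4 h5
  obtain ⟨n, D, hD1, hD2, hD3⟩ := der_basis_exists {D | Dp k G D} (fun D hD => hDpc _ D hD)
  -- closing
  have e1 : ∀ f : K, ∃ C : Finset ℂ, (∃ g ∈ G, g f ≠ f) → ∃ g ∈ G, g f ≠ f ∧ BB K (C : Set ℂ) g := by
    intro f
    by_cases h : ∃ g ∈ G, g f ≠ f
    · obtain ⟨g, hg, hgf⟩ := h
      obtain ⟨C, hC⟩ := BB_all (hG.fc g hg)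
      exact ⟨C, fun _ => ⟨g, hg, hgf, hC⟩⟩
    · exact ⟨∅, fun h' => absurd h' h⟩
  have e2 : ∀ a : K ≃+* K, ∃ C : Finset ℂ, (∃ g ∈ G, ∃ f, a (g f) ≠ g (a f)) → ∃ g ∈ G, (∃ f, a (g f) ≠ g (a f)) ∧ BB K (C : Set ℂ) g := by
    intro a
    by_cases h : ∃ g ∈ G, ∃ f, a (g f) ≠ g (a f)
    · obtain ⟨g, hg, hgf⟩ := h
      obtain ⟨C, hC⟩ := BB_all (hG.fc g hg)
      exact ⟨C, fun _ => ⟨g, hg, hgf, hC⟩⟩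
    · exact ⟨∅, fun h' => absurd h' h⟩
  choose C1 hC1 using e1
  choose C2 hC2 using e2
  have e3 : ∀ t : K ≃+* K, ∃ C : Finset ℂ, t ∈ G → BB K (C : Set ℂ) t := by
    intro t
    by_cases h : t ∈ G
    · obtain ⟨C, hC⟩ := BB_all (hG.fc t h)
      exact ⟨C, fun _ => hC⟩
    · exact ⟨∅, fun h' => absurd h' h⟩
  choose C3 hC3 using e3
  choose C4 hC4 using fun f : K => Kc_all f
  let N : Finset ℂ → Set ℂ := fun S => (⋃ f ∈ (Kc K (S : Set ℂ) : Set K), (C1 f : Set ℂ)) ∪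
    ⋃ a ∈ {h : K ≃+* K | (∀ a, h (cc a) = cc a) ∧ BB K (S : Set ℂ) h}, (C2 a : Set ℂ)
  have hN : ∀ S, (N S).Countable := fun S =>
    ((Kc_countable S.countable_toSet).biUnion fun f _ => (C1 f).countable_toSet).union
      ((BB_countable S.countable_toSet).biUnion fun f _ => (C2 f).countable_toSet)
  let F0 : Set ℂ := (⋃ t ∈ Tm, (C3 t : Set ℂ)) ∪ ⋃ l, ⋃ i, (C4 (D l (zz i)) : Set ℂ)
  have hF0 : F0.Countable := (hTmc.biUnion fun f _ => (C3 f).countable_toSet).union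
    (Set.countable_iUnion fun l => Set.countable_iUnion fun i => (C4 _).countable_toSet)
  obtain ⟨F, hFc, hF0F, hFN⟩ := closing N hN F0 hF0
  have hA0 : ∀ f ∈ Kc K F, (∀ t ∈ G, BB K F t → t f = f) → f ∈ k := by
    intro f hf ht
    by_contra hn
    rw [hk, mem_fixG] at hn
    push Not at hn
    obtain ⟨S, hSF, hfS⟩ := Kc_fin hf
    obtain ⟨g, hg, hgf, hgB⟩ := hC1 f hn
    apply hgf
    apply ht g hg
    refine BB_mono ?_ hgB
    refine Set.Subset.trans ?_ (clS_sub F)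
    refine Set.Subset.trans ?_ (hFN S hSF)
    exact fun c hc => Or.inl (Set.mem_biUnion (show f ∈ (Kc K (S : Set ℂ) : Set K) from hfS) hc)
  have hB : ∀ a : K ≃+* K, (∀ c, a (cc c) = cc c) → BB K F a → (∀ t ∈ G, BB K F t → ∀ f, a (t f) = t (a f)) → a ∈ G := by
    intro a hac hf ht
    by_contra hn
    have hn : ∃ g ∈ G, ∃ f, a (g f) ≠ g (a f) := by
      by_contra! h'
      exact hn (hG.cen a hac h')
    obtain ⟨S, hSF, hfS⟩ := BB_fin hac hf
    obtain ⟨g, hg, ⟨f, hgf⟩, hgB⟩ := hC2 a hn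
    apply hgf
    apply ht g hg
    refine BB_mono ?_ hgB
    refine Set.Subset.trans ?_ (clS_sub F)
    refine Set.Subset.trans ?_ (hFN S hSF)
    exact fun c hc => Or.inr (Set.mem_biUnion (show a ∈ {h : K ≃+* K | (∀ a, h (cc a) = cc a) ∧ BB K (S : Set ℂ) h} from ⟨hac, hfS⟩) hc)
  have hA : ∀ f, (∀ t ∈ G, BB K F t → t f = f) → f ∈ k := by
    intro f hf
    have hspan : ∀ p : R2, algebraMap R2 K p ∈ Submodule.span (Kc K F) (Set.range (cc : ℂ → K)) := by
      intro p
      induction p using MvPolynomial.induction_on with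
      | C a => exact Submodule.subset_span ⟨a, rfl⟩
      | add p q hp hq => rw [map_add]; exact add_mem hp hq
      | mul_X p i hp =>
        rw [map_mul, mul_comm]
        exact Submodule.smul_mem _ (⟨zz i, zz_Kc F i⟩ : Kc K F) hp
    obtain ⟨u, v, hv, huv⟩ := IsFractionRing.div_surjective (A := R2) f
    have hv' : algebraMap R2 K v ≠ 0 := by simpa using nonZeroDivisors.ne_zero hv
    obtain ⟨b, p, q, hb, hq, hpq, _, hs⟩ := min_rep (Kc K F) (Set.range (cc : ℂ → K)) f _ _ (hspan u) (hspan v) hv' (by rw [← huv]; field_simp)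
    have hpk : ∀ i, (p i : K) ∈ k ∧ (q i : K) ∈ k := by
      intro i
      have : ∀ t ∈ G, BB K F t → t (p i) = p i ∧ t (q i) = q i := fun t ht htB =>
        hs t.toRingHom (fun a ha => BB_Kc htB ha) (by rintro z ⟨a, rfl⟩; exact hG.fc t ht a) (hf t ht htB) i
      exact ⟨hA0 _ (p i).2 fun t ht htB => (this t ht htB).1, hA0 _ (q i).2 fun t ht htB => (this t ht htB).2⟩
    have hbk : ∀ i : b, (i : K) ∈ k := by
      intro i
      obtain ⟨a, ha⟩ := hb i.2
      rw [← ha]; exact hkc a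
    rw [← eq_div_iff hq] at hpq
    rw [hpq]
    exact div_mem (sum_mem fun i _ => mul_mem (hpk i).1 (hbk i)) (sum_mem fun i _ => mul_mem (hpk i).2 (hbk i))
  refine ⟨F, n, D, hFc, hD1, hD2, ?_, hA, hB, ?_⟩
  · intro l i
    refine Kc_mono ?_ (hC4 (D l (zz i)))
    refine Set.Subset.trans ?_ (clS_sub F)
    refine Set.Subset.trans ?_ hF0F
    exact fun c hc => Or.inr (Set.mem_iUnion.2 ⟨l, Set.mem_iUnion.2 ⟨i, hc⟩⟩)
  · intro E hE
    set T := {t | t ∈ G ∧ BB K F t} with hT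
    have hTc : T.Countable := (BB_countable (K := K) hFc).mono fun t (ht : t ∈ G ∧ BB K F t) => (show (∀ a, t (cc a) = cc a) ∧ BB K F t from ⟨hG.fc t ht.1, ht.2⟩)
    have hTm : Tm ⊆ T := by
      intro t ht
      refine ⟨hTmG ht, BB_mono ?_ (hC3 t (hTmG ht))⟩
      refine Set.Subset.trans ?_ (clS_sub F)
      refine Set.Subset.trans ?_ hF0F
      exact fun c hc => Or.inl (Set.mem_biUnion ht hc)
    have hEG : Dp k G E := by
      refine ⟨hE.1, fun g hg => ?_⟩
      have hins : V (insert g T) = V T := by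
        rw [hTmin _ (hTc.insert g) (Set.insert_subset hg fun t ht => ht.1) (hTm.trans (Set.subset_insert _ _)), hTmin T hTc (fun t ht => ht.1) hTm]
      obtain ⟨m, D', hD'1, hD'2, hD'3⟩ := der_basis_exists {D | Dp k (insert g T) D} (fun D hD => hDpc _ D hD)
      obtain ⟨c, hc⟩ := hD'3 E (hDpc _ _ hE) (by
        show vec E ∈ V (insert g T)
        rw [hins]; exact Submodule.subset_span (Set.mem_image_of_mem vec hE))
      have hck : ∀ l, c l ∈ k := by
        intro l
        apply hA
        intro t htG htB
        refine coef_fix hD'2 t (fun l => (hD'1 l).2 t (Set.mem_insert_of_mem g (show t ∈ T from ⟨htG, htB⟩))) c ?_ l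
        rw [← hc]; exact hE.2 t ⟨htG, htB⟩
      intro f
      rw [hc, der_sum_apply, der_sum_apply, map_sum]
      refine Finset.sum_congr rfl fun l _ => ?_
      simp only [Derivation.smul_apply, smul_eq_mul, map_mul]
      rw [mem_fixG.1 (hck l) g hg, (hD'1 l).2 g (Set.mem_insert g T)]
    exact ⟨hEG, hD3 E (hDpc _ _ hE) (Submodule.subset_span (Set.mem_image_of_mem vec hEG))⟩
end D6

set_option linter.all false

noncomputable section D7

variable {K : Type} [Field K] [CharZero K] [Algebra R2 K] [IsFractionRing R2 K]

theorem hat_add (δ ε : Derivation ℤ ℂ ℂ) : (hatD (δ + ε) : Derivation ℤ K K) = hatD δ + hatD ε := by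
  apply K2_der_ext <;> intro a <;> simp
theorem hat_sub (δ ε : Derivation ℤ ℂ ℂ) : (hatD (δ - ε) : Derivation ℤ K K) = hatD δ - hatD ε := by
  apply K2_der_ext <;> intro a <;> simp
theorem hat_smul (a : ℂ) (δ : Derivation ℤ ℂ ℂ) : (hatD (a • δ) : Derivation ℤ K K) = (cc a : K) • hatD δ := by
  apply K2_der_ext <;> intro a <;> simp
theorem hat_lie (δ ε : Derivation ℤ ℂ ℂ) (f : K) : hatD δ (hatD ε f) = hatD ε (hatD δ f) + hatD ⁅δ, ε⁆ f := by
  have : (hatD ⁅δ, ε⁆ : Derivation ℤ K K) = ⁅(hatD δ : Derivation ℤ K K), (hatD ε : Derivation ℤ K K)⁆ := by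
    apply K2_der_ext <;> intro a <;> simp [Derivation.commutator_apply]
  rw [this, Derivation.commutator_apply]; ring
theorem hat_pd (δ : Derivation ℤ ℂ ℂ) (i) (f : K) : hatD δ (pd i f) = pd i (hatD δ f) := by
  have : ⁅(hatD δ : Derivation ℤ K K), (pd i : Derivation ℤ K K)⁆ = 0 := by
    apply K2_der_zero <;> intro a <;> simp [Derivation.commutator_apply]
    split_ifs <;> simp
  have := congrArg (fun D : Derivation ℤ K K => D f) this
  simp only [Derivation.commutator_apply] at this
  exact sub_eq_zero.1 this
theorem hatS_conj (σ : ℂ ≃+* ℂ) (δ : Derivation ℤ ℂ ℂ) : conjD (hatS σ) (hatD δ : Derivation ℤ K K) = hatD (conjD σ δ) := by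
  have h1 : ∀ a, (hatS σ : K ≃+* K).symm (cc a) = cc (σ.symm a) := fun a => by rw [RingEquiv.symm_apply_eq]; simp
  have h2 : ∀ a, (hatS σ : K ≃+* K).symm (zz a) = zz a := fun a => by rw [RingEquiv.symm_apply_eq]; simp
  apply K2_der_ext <;> intro a <;> simp [h1, h2]

def DD (h : K ≃+* K) (δ : Derivation ℤ ℂ ℂ) : Derivation ℤ K K := hatD δ - conjD h (hatD δ)
theorem DD_apply (h : K ≃+* K) (δ) (f : K) : DD h δ f = hatD δ f - h (hatD δ (h.symm f)) := by simp [DD]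
theorem DD_cc {h : K ≃+* K} (hc : ∀ a, h (cc a) = cc a) (δ) (a : ℂ) : DD h δ (cc a) = 0 := by
  have : h.symm (cc a) = cc a := by rw [RingEquiv.symm_apply_eq, hc]
  simp [DD_apply, this, hc]
theorem BB_DD {S : Set ℂ} {h : K ≃+* K} : BB K S h ↔ ∀ δ, Kil S δ → DD h δ = 0 := by
  constructor
  · intro H δ hδ; ext f; rw [DD_apply, H δ hδ]; simp
  · intro H δ hδ f
    have := congrArg (fun D : Derivation ℤ K K => D (h f)) (H δ hδ)
    simp only [DD_apply, RingEquiv.symm_apply_apply] at this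
    exact (sub_eq_zero.1 this).symm
theorem DD_mul (a b : RingAut K) (δ) (f : K) : DD (a * b) δ f = DD a δ f + a (DD b δ (a⁻¹ f)) := by
  simp only [DD_apply, RingAut.mul_apply, map_sub]
  have : ∀ z, RingEquiv.symm (a * b) z = b.symm (a.symm z) := fun z => rfl
  have h3 : ∀ z, a⁻¹ z = RingEquiv.symm a z := fun z => rfl
  rw [this, h3]; ring
theorem DD_sub (h : K ≃+* K) (δ ε : Derivation ℤ ℂ ℂ) : DD h (δ - ε) = DD h δ - DD h ε := by
  ext f; simp [DD_apply, hat_sub]; ring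
theorem DD_smul {h : K ≃+* K} (hc : ∀ a, h (cc a) = cc a) (a) (δ : Derivation ℤ ℂ ℂ) : DD h (a • δ) = (cc a : K) • DD h δ := by
  ext f; simp [DD_apply, hat_smul, hc]; ring
theorem DD_conj (s : ℂ ≃+* ℂ) (h : RingAut K) (δ : Derivation ℤ ℂ ℂ) (f : K) :
    DD ((hatS s : RingAut K) * h * (hatS s : RingAut K)⁻¹) δ f = hatS s (DD h (conjD s.symm δ) ((hatS s).symm f)) := by
  have h1 : ∀ g : K, hatS s (hatD (conjD s.symm δ) ((hatS s).symm g)) = hatD δ g := by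
    intro g
    have : conjD s (conjD s.symm δ) = δ := by ext a; simp
    rw [← conjD_apply, hatS_conj, this]
  have h2 : ∀ g : K, (hatS s) (hatD (conjD s.symm δ) g) = hatD δ (hatS s g) := by
    intro g; rw [← h1]; simp
  simp only [DD_apply, map_sub, h2, RingEquiv.apply_symm_apply, RingAut.mul_apply]
  congr 1
  show (hatS s) (h ((hatS s).symm (hatD δ ((hatS s) (h.symm ((hatS s).symm f)))))) = _
  rw [← h2]; simp

theorem hatS_mul (σ τ : RingAut ℂ) : (hatS (σ * τ) : RingAut K) = (hatS σ : RingAut K) * hatS τ := by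
  apply K2_aut_ext <;> intro a <;> simp

theorem hatS_Kc {F : Set ℂ} {σ : ℂ ≃+* ℂ} (hσ : ∀ a ∈ clS F, σ a = a) {f : K} (hf : f ∈ Kc K F) : hatS σ f = f := by
  have : Subfield.closure (cc '' (clS F : Set ℂ) ∪ Set.range zz) ≤ (hatS σ : K ≃+* K).toRingHom.eqLocusField (RingHom.id K) := by
    rw [Subfield.closure_le]
    rintro z (⟨a, ha, rfl⟩ | ⟨i, rfl⟩)
    · show (hatS σ : K ≃+* K) (cc a) = cc a
      rw [hatS_cc, hσ a ha]
    · exact hatS_zz σ i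
  exact this (Kc_clos hf)
theorem hatS_comm {F : Set ℂ} {σ : ℂ ≃+* ℂ} (hσ : ∀ a ∈ clS F, σ a = a) {t : K ≃+* K} (hc : ∀ a, t (cc a) = cc a) (ht : BB K F t) (f : K) :
    hatS σ (t f) = t (hatS σ f) := by
  have : (hatS σ : RingAut K) * t = t * (hatS σ : RingAut K) := by
    apply K2_aut_ext <;> intro a <;> simp [hc]
    exact hatS_Kc hσ ((BB_iff hc).1 ht a)
  exact congrArg (fun u : RingAut K => u f) this

structure Gam (G : Set (K ≃+* K)) (F : Set ℂ) (b : RingAut K) : Prop where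
  fc : ∀ a, b (cc a) = cc a
  T : ∀ t ∈ G, BB K F t → ∀ f, b (t f) = t (b f)
  k : ∀ f ∈ fixG G, b f = f
  E : ∀ E, Dp (fixG G) G E → ∀ f, b (E f) = E (b f)

variable {G : Set (K ≃+* K)} {F : Set ℂ}
theorem Gam.mul {a b : RingAut K} (ha : Gam G F a) (hb : Gam G F b) : Gam G F (a * b) where
  fc c := by simp [ha.fc, hb.fc]
  T t h1 h2 f := by simp [hb.T t h1 h2, ha.T t h1 h2]
  k f hf := by simp [ha.k f hf, hb.k f hf]
  E E hE f := by simp [ha.E E hE, hb.E E hE]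
theorem Gam.one : Gam G F 1 where
  fc c := rfl
  T t h1 h2 f := rfl
  k f hf := rfl
  E E hE f := rfl
theorem Gam.inv {a : RingAut K} (ha : Gam G F a) : Gam G F a⁻¹ where
  fc c := by show a.symm _ = _; rw [RingEquiv.symm_apply_eq, ha.fc]
  T t h1 h2 f := by show a.symm _ = t (a.symm f); rw [RingEquiv.symm_apply_eq, ha.T t h1 h2]; simp
  k f hf := by show a.symm _ = _; rw [RingEquiv.symm_apply_eq, ha.k f hf]
  E E hE f := by show a.symm _ = E (a.symm f); rw [RingEquiv.symm_apply_eq, ha.E E hE]; simp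
theorem Gam.of (hG : GD G) {h : K ≃+* K} (hh : h ∈ G) : Gam G F h where
  fc := hG.fc h hh
  T t h1 h2 := hG.ab h hh t h1
  k f hf := mem_fixG.1 hf h hh
  E E hE := hE.2 h hh

variable {n : ℕ} {D : Fin n → Derivation ℤ K K}
theorem Gam.DD (hG : GD G) (hM : M5D G F n D) {b : RingAut K} (hb : Gam G F b) {δ : Derivation ℤ ℂ ℂ} (hδ : Kil F δ) :
    Dp (fixG G) G (DD b δ) := by
  refine (hM.C _ ⟨?_, ?_⟩).1
  · intro f hf
    have h1 : hatD δ f ∈ fixG G := hM.A _ fun t ht hB => by rw [hB δ hδ, mem_fixG.1 hf t ht]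
    rw [DD_apply]
    have : RingEquiv.symm b f = f := by rw [RingEquiv.symm_apply_eq, hb.k f hf]
    rw [this, hb.k _ h1, sub_self]
  · rintro t ⟨ht, hB⟩ f
    have h3 := hb.inv.T t ht hB f
    have : ∀ z, RingEquiv.symm b z = b⁻¹ z := fun z => rfl
    rw [DD_apply, DD_apply, this, this, h3, ← hB δ hδ (b⁻¹ f), hb.T t ht hB, ← hB δ hδ, map_sub]
theorem Gam.DDmul (hG : GD G) (hM : M5D G F n D) {a b : RingAut K} (ha : Gam G F a) (hb : Gam G F b) {δ : Derivation ℤ ℂ ℂ} (hδ : Kil F δ) :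
    _root_.DD (a * b) δ = _root_.DD a δ + _root_.DD b δ := by
  ext f
  rw [DD_mul, ha.E _ (hb.DD hG hM hδ)]
  have : a (a⁻¹ f) = f := a.apply_symm_apply f
  rw [this]; rfl

theorem Gam.list (hG : GD G) (hM : M5D G F n D) (L : List (RingAut K)) (hL : ∀ x ∈ L, Gam G F x) {δ : Derivation ℤ ℂ ℂ} (hδ : Kil F δ) :
    Gam G F L.prod ∧ _root_.DD L.prod δ = (L.map fun x => _root_.DD x δ).sum := by
  induction L with
  | nil => exact ⟨Gam.one, by ext f; rw [DD_apply]; exact sub_self _⟩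
  | cons x L ih =>
    obtain ⟨h1, h2⟩ := ih fun y hy => hL y (List.mem_cons_of_mem _ hy)
    have h3 := hL x List.mem_cons_self
    rw [List.prod_cons, List.map_cons, List.sum_cons, ← h2]
    exact ⟨h3.mul h1, h3.DDmul hG hM h1 hδ⟩

theorem Dp_conj (hG : GD G) (hM : M5D G F n D) {σ : ℂ ≃+* ℂ} (hσ : ∀ a ∈ clS F, σ a = a) {E} (hE : Dp (fixG G) G E) : 
    Dp (fixG G) G (conjD (hatS σ) E) := by
  have hc : ∀ t ∈ G, BB K F t → ∀ f, (hatS σ).symm (t f) = t ((hatS σ).symm f) := by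
    intro t ht hB f; rw [RingEquiv.symm_apply_eq, hatS_comm hσ (hG.fc t ht) hB]; simp
  refine (hM.C _ ⟨?_, ?_⟩).1
  · intro f hf
    have h1 : (hatS σ).symm f ∈ fixG G := hM.A _ fun t ht hB => by rw [← hc t ht hB, mem_fixG.1 hf t ht]
    rw [conjD_apply, hE.1 _ h1, map_zero]
  · rintro t ⟨ht, hB⟩ f
    rw [conjD_apply, conjD_apply, ← hatS_comm hσ (hG.fc t ht) hB, hE.2 t ht, hc t ht hB]

theorem Gam.conj (hG : GD G) (hM : M5D G F n D) {σ : ℂ ≃+* ℂ} (hσ : ∀ a ∈ clS F, σ a = a) {b : RingAut K} (hb : Gam G F b) :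
    Gam G F ((hatS σ : RingAut K) * b * (hatS σ : RingAut K)⁻¹) := by
  have hi : ∀ f, (hatS σ : RingAut K)⁻¹ f = (hatS σ).symm f := fun f => rfl
  have hc : ∀ t ∈ G, BB K F t → ∀ f, (hatS σ).symm (t f) = t ((hatS σ).symm f) := by
    intro t ht hB f; rw [RingEquiv.symm_apply_eq, hatS_comm hσ (hG.fc t ht) hB]; simp
  have hσ' : ∀ a ∈ clS F, σ.symm a = a := fun a ha => by rw [RingEquiv.symm_apply_eq, hσ a ha]
  refine ⟨fun a => ?_, fun t ht hB f => ?_, fun f hf => ?_, fun E hE f => ?_⟩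
  · have : (hatS σ : K ≃+* K).symm (cc a) = cc (σ.symm a) := by rw [RingEquiv.symm_apply_eq]; simp
    simp only [RingAut.mul_apply, hi, this, hb.fc]; simp
  · simp only [RingAut.mul_apply, hi]
    rw [hc t ht hB, hb.T t ht hB, hatS_comm hσ (hG.fc t ht) hB]
  · have h1 : (hatS σ).symm f ∈ fixG G := hM.A _ fun t ht hB => by rw [← hc t ht hB, mem_fixG.1 hf t ht]
    simp only [RingAut.mul_apply, hi]
    rw [hb.k _ h1]; simp
  · have h2 := hb.E _ (Dp_conj hG hM hσ' hE) ((hatS σ).symm f)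
    have h3 : (hatS σ.symm : K ≃+* K) = (hatS σ).symm := by
      apply K2_aut_ext <;> intro a <;> symm <;> rw [RingEquiv.symm_apply_eq] <;> simp
    simp only [conjD_apply, h3, RingEquiv.symm_symm, RingEquiv.apply_symm_apply] at h2
    simp only [RingAut.mul_apply, hi]
    rw [h2]; simp
end D7

set_option linter.all false

noncomputable section D8

variable {K : Type} [Field K] [CharZero K] [Algebra R2 K] [IsFractionRing R2 K]

/-- `f` is regular at `z` with value `v` -/
def Ev (z : Fin 2 → ℂ) (f : K) (v : ℂ) : Prop := ∃ p q : R2, MvPolynomial.eval z q ≠ 0 ∧ f * algebraMap R2 K q = algebraMap R2 K p ∧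
  v * MvPolynomial.eval z q = MvPolynomial.eval z p

variable {z : Fin 2 → ℂ}
theorem R2_inj : Function.Injective (algebraMap R2 K) := IsFractionRing.injective R2 K

theorem Ev.uniq {f : K} {v w : ℂ} (h1 : Ev z f v) (h2 : Ev z f w) : v = w := by
  obtain ⟨p, q, a1, a2, a3⟩ := h1
  obtain ⟨p', q', b1, b2, b3⟩ := h2
  have : p * q' = p' * q := by
    apply R2_inj (K := K); rw [map_mul, map_mul, ← a2, ← b2]; ring
  have := congrArg (MvPolynomial.eval z) this
  rw [map_mul, map_mul, ← a3, ← b3] at this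
  have h : (v - w) * (MvPolynomial.eval z q * MvPolynomial.eval z q') = 0 := by linear_combination this
  exact sub_eq_zero.1 ((mul_eq_zero.1 h).resolve_right (mul_ne_zero a1 b1))
theorem Ev.poly (p : R2) : Ev z (algebraMap R2 K p) (MvPolynomial.eval z p) := ⟨p, 1, by simp, by simp, by simp⟩
theorem Ev.cc (a : ℂ) : Ev z (cc a : K) a := by have := Ev.poly (K := K) (z := z) (MvPolynomial.C a); rw [MvPolynomial.eval_C] at this; exact this
theorem Ev.zz (i) : Ev z (zz i : K) (z i) := by have := Ev.poly (K := K) (z := z) (MvPolynomial.X i); rw [MvPolynomial.eval_X] at this; exact this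
theorem Ev.add {f g : K} {v w : ℂ} (h1 : Ev z f v) (h2 : Ev z g w) : Ev z (f + g) (v + w) := by
  obtain ⟨p, q, a1, a2, a3⟩ := h1
  obtain ⟨p', q', b1, b2, b3⟩ := h2
  refine ⟨p * q' + p' * q, q * q', by simp [a1, b1], ?_, ?_⟩
  · simp only [map_add, map_mul, ← a2, ← b2]; ring
  · simp only [map_add, map_mul, ← a3, ← b3]; ring
theorem Ev.mul {f g : K} {v w : ℂ} (h1 : Ev z f v) (h2 : Ev z g w) : Ev z (f * g) (v * w) := by
  obtain ⟨p, q, a1, a2, a3⟩ := h1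
  obtain ⟨p', q', b1, b2, b3⟩ := h2
  refine ⟨p * p', q * q', by simp [a1, b1], ?_, ?_⟩
  · simp only [map_mul, ← a2, ← b2]; ring
  · simp only [map_mul, ← a3, ← b3]; ring
theorem Ev.inv {f : K} {v : ℂ} (h1 : Ev z f v) (hv : v ≠ 0) : Ev z f⁻¹ v⁻¹ := by
  obtain ⟨p, q, a1, a2, a3⟩ := h1
  have hp : MvPolynomial.eval z p ≠ 0 := by rw [← a3]; exact mul_ne_zero hv a1
  have hp0 : algebraMap R2 K p ≠ 0 := by
    intro h; rw [map_eq_zero_iff _ R2_inj] at h; rw [h] at hp; simp at hp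
  have hf : f ≠ 0 := by rintro rfl; rw [zero_mul] at a2; exact hp0 a2.symm
  refine ⟨q, p, hp, ?_, ?_⟩
  · rw [← a2]; field_simp
  · rw [← a3]; field_simp
theorem Ev.neg {f : K} {v : ℂ} (h1 : Ev z f v) : Ev z (-f) (-v) := by
  have := (Ev.cc (z := z) (K := K) (-1)).mul h1
  simpa using this
theorem Ev.sub {f g : K} {v w : ℂ} (h1 : Ev z f v) (h2 : Ev z g w) : Ev z (f - g) (v - w) := by
  rw [sub_eq_add_neg, sub_eq_add_neg]; exact h1.add h2.neg
theorem Ev.sum {ι : Type*} (s : Finset ι) (f : ι → K) (v : ι → ℂ) (h : ∀ i ∈ s, Ev z (f i) (v i)) : Ev z (∑ i ∈ s, f i) (∑ i ∈ s, v i) := by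
  classical
  induction s using Finset.induction_on with
  | empty => have := Ev.cc (z := z) (K := K) 0; simpa using this
  | insert a s ha ih =>
    rw [Finset.sum_insert ha, Finset.sum_insert ha]
    exact (h a (by simp)).add (ih fun i hi => h i (by simp [hi]))
theorem hatS_poly (σ : ℂ ≃+* ℂ) (p : R2) : (hatS σ : K ≃+* K) (algebraMap R2 K p) = algebraMap R2 K (MvPolynomial.map σ.toRingHom p) := by
  rw [hatS, IsFractionRing.ringEquivOfRingEquiv_algebraMap]; rfl
theorem Ev.hatS {σ : ℂ ≃+* ℂ} (hz : ∀ i, σ (z i) = z i) {f : K} {v : ℂ} (h : Ev z f v) : Ev z (hatS σ f) (σ v) := by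
  obtain ⟨p, q, a1, a2, a3⟩ := h
  have he : ∀ p : R2, MvPolynomial.eval z (MvPolynomial.map σ.toRingHom p) = σ (MvPolynomial.eval z p) := by
    intro p
    induction p using MvPolynomial.induction_on with
    | C a => simp
    | add p q hp hq => rw [map_add, map_add, map_add, hp, hq, map_add]
    | mul_X p i hp => rw [map_mul, map_mul, map_mul, hp, map_mul]; simp [hz]
  refine ⟨MvPolynomial.map σ.toRingHom p, MvPolynomial.map σ.toRingHom q, ?_, ?_, ?_⟩
  · rw [he]; simpa using a1
  · rw [← hatS_poly, ← hatS_poly, ← a2, map_mul]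
  · rw [he, he, ← a3, map_mul]
theorem Ev.der (δ : Derivation ℤ ℂ ℂ) {f : K} {v : ℂ} (h : Ev z f v) : ∃ (v0 : ℂ) (va : Fin 2 → ℂ), Ev z (hatD δ f) v0 ∧ (∀ a, Ev z (pd a f) (va a)) ∧
    δ v = v0 + ∑ a, va a * δ (z a) := by
  have hp : ∀ p : R2, ∃ (v0 : ℂ) (va : Fin 2 → ℂ), Ev z (hatD δ (algebraMap R2 K p)) v0 ∧ (∀ a, Ev z (pd a (algebraMap R2 K p)) (va a)) ∧
    δ (MvPolynomial.eval z p) = v0 + ∑ a, va a * δ (z a) := by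
    intro p
    induction p using MvPolynomial.induction_on with
    | C a =>
      refine ⟨δ a, 0, ?_, ?_, by simp⟩
      · rw [← cc_eq, hatD_cc]; exact Ev.cc _
      · intro i; rw [← cc_eq, pd_cc]; have := Ev.cc (z := z) (K := K) 0; simpa using this
    | add p q hp hq =>
      obtain ⟨v0, va, a1, a2, a3⟩ := hp
      obtain ⟨w0, wa, b1, b2, b3⟩ := hq
      refine ⟨v0 + w0, va + wa, ?_, ?_, ?_⟩
      · rw [map_add, map_add]; exact a1.add b1
      · intro i; rw [map_add, map_add]; exact (a2 i).add (b2 i)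
      · rw [map_add, map_add, a3, b3]; simp [add_mul]; ring
    | mul_X p i hp =>
      obtain ⟨v0, va, a1, a2, a3⟩ := hp
      refine ⟨v0 * z i, fun a => MvPolynomial.eval z p * (if a = i then 1 else 0) + z i * va a, ?_, ?_, ?_⟩
      · rw [map_mul, Derivation.leibniz, ← _root_.zz, hatD_zz, smul_zero, zero_add, smul_eq_mul, mul_comm]; exact a1.mul (Ev.zz i)
      · intro a; rw [map_mul, Derivation.leibniz, ← _root_.zz, pd_zz, smul_eq_mul, smul_eq_mul]
        refine Ev.add ((Ev.poly p).mul ?_) ((Ev.zz i).mul (a2 a))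
        have := Ev.cc (z := z) (K := K) (if a = i then 1 else 0)
        split_ifs at this ⊢ <;> simpa using this
      · rw [map_mul, Derivation.leibniz, a3]
        fin_cases i <;> simp <;> ring
  obtain ⟨p, q, a1, a2, a3⟩ := h
  obtain ⟨p0, pa, b1, b2, b3⟩ := hp p
  obtain ⟨q0, qa, c1, c2, c3⟩ := hp q
  have hf : Ev z f v := ⟨p, q, a1, a2, a3⟩
  have hq0 : algebraMap R2 K q ≠ 0 := by
    intro h; rw [map_eq_zero_iff _ R2_inj] at h; rw [h] at a1; simp at a1
  have hD : ∀ d : Derivation ℤ K K, d f = (d (algebraMap R2 K p) - f * d (algebraMap R2 K q)) * (algebraMap R2 K q)⁻¹ := by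
    intro d
    rw [← a2, Derivation.leibniz]; simp; field_simp
  have hi := (Ev.poly (K := K) q).inv a1
  refine ⟨(p0 - v * q0) * (MvPolynomial.eval z q)⁻¹, fun a => (pa a - v * qa a) * (MvPolynomial.eval z q)⁻¹, ?_, ?_, ?_⟩
  · rw [hD]; exact (b1.sub (hf.mul c1)).mul hi
  · intro a; rw [hD]; exact ((b2 a).sub (hf.mul (c2 a))).mul hi
  · have := congrArg δ a3
    rw [Derivation.leibniz, b3, c3] at this
    simp only [Fin.sum_univ_two, smul_eq_mul] at this ⊢
    field_simp
    linear_combination this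
theorem Ev.exists {S : Set ℂ} (d : Fin 2 → Derivation ℤ ℂ ℂ) (hd : ∀ i, Kil S (d i)) (hz : ∀ i j, d i (z j) = if i = j then 1 else 0)
    {f : K} (hf : f ∈ Kc K S) : ∃ v, Ev z f v ∧ (f ≠ 0 → v ≠ 0) := by
  have hf := Kc_clos hf
  rw [Subfield.mem_closure_iff] at hf
  let i : clS S →+* ℂ := (clS S).subtype
  let θ : MvPolynomial (Fin 2) (clS S) →+* K := (algebraMap R2 K).comp (MvPolynomial.map i)
  have hs : Subring.closure (_root_.cc '' (clS S : Set ℂ) ∪ Set.range _root_.zz) ≤ θ.range := by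
    rw [Subring.closure_le]
    rintro w (⟨a, ha, rfl⟩ | ⟨i, rfl⟩)
    · exact ⟨MvPolynomial.C ⟨a, ha⟩, by simp [θ, cc_eq, i]⟩
    · exact ⟨MvPolynomial.X i, by simp [θ, _root_.zz]⟩
  have hnv : ∀ p : MvPolynomial (Fin 2) (clS S), MvPolynomial.eval z (MvPolynomial.map i p) = 0 → p = 0 := by
    intro p hp
    apply nonvanish i d z (fun j a => mem_clS.1 a.2 _ (hd j)) hz
    rwa [MvPolynomial.eval_map] at hp
  obtain ⟨y, hy, w, hw, rfl⟩ := hf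
  obtain ⟨p, rfl⟩ := hs hy
  obtain ⟨q, rfl⟩ := hs hw
  by_cases hq : q = 0
  · subst hq; exact ⟨0, by simpa using Ev.cc (z := z) (K := K) 0, by simp⟩
  have hq1 : MvPolynomial.eval z (MvPolynomial.map i q) ≠ 0 := fun h => hq (hnv q h)
  refine ⟨_, by rw [div_eq_mul_inv]; exact (Ev.poly (MvPolynomial.map i p)).mul ((Ev.poly (MvPolynomial.map i q)).inv hq1), ?_⟩
  intro h
  refine mul_ne_zero (fun h0 => h ?_) (inv_ne_zero hq1)
  rw [hnv p h0]; simp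
end D8

set_option linter.all false

noncomputable section D9

variable {K : Type} [Field K] [CharZero K] [Algebra R2 K] [IsFractionRing R2 K]
variable {G : Set (K ≃+* K)} {F : Set ℂ} {n : ℕ} {D : Fin n → Derivation ℤ K K}

structure M6D (G : Set (K ≃+* K)) (F F' : Set ℂ) (c : ℂ) (h : K ≃+* K) (E : Derivation ℤ K K) : Prop where
  hG : h ∈ G
  cF : (clS F : Set ℂ) ⊆ F'
  cnt : F'.Countable
  bb : BB K (insert c F') h
  dp : Dp (fixG G) G E
  e0 : E ≠ 0
  eq : ∀ δ, Kil F' δ → DD h δ = (cc (δ c) : K) • E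
  ex : ∃ δ, Kil F' δ ∧ δ c = 1 ∧ E = DD h δ

theorem M6a (hG : GD G) (hM : M5D G F n D) : ∃ F' c h E, M6D G F F' c h E := by
  classical
  obtain ⟨h, hh, hB⟩ : ∃ h ∈ G, ¬ BB K F h := by
    by_contra! hn
    refine hG.unc ((BB_countable (K := K) hM.cnt).mono ?_)
    intro g hg
    exact And.intro (hG.fc g hg) (hn g hg)
  have hc := hG.fc h hh
  have key : ∀ S0 : Finset ℂ, BB K ((clS F : Set ℂ) ∪ S0) h → ∃ (s : Finset ℂ) (c : ℂ), ¬ BB K ((clS F : Set ℂ) ∪ s) h ∧ BB K (insert c ((clS F : Set ℂ) ∪ s)) h := by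
    intro S0
    induction S0 using Finset.induction_on with
    | empty => intro h1; exact absurd (BB_mono (S := (clS F : Set ℂ) ∪ (∅ : Finset ℂ)) (by simp) h1) hB
    | insert a s ha ih =>
      intro h1
      by_cases h2 : BB K ((clS F : Set ℂ) ∪ s) h
      · exact ih h2
      · exact ⟨s, a, h2, by simpa [Set.union_insert] using h1⟩
  obtain ⟨S0, hS0⟩ := BB_all hc
  obtain ⟨s, c, h1, h2⟩ := key S0 (BB_mono (Set.subset_union_right.trans (clS_sub _)) hS0)
  set F' := (clS F : Set ℂ) ∪ s with hF'
  have hlin : ∀ δ, Kil F' δ → δ c = 1 → ∀ ε, Kil F' ε → DD h ε = (cc (ε c) : K) • DD h δ := by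
    intro δ h3 h4 ε h5
    have : DD h (ε - ε c • δ) = 0 := by
      refine BB_DD.1 h2 _ ?_
      rintro a (rfl | ha)
      · simp [h4]
      · simp [h3 a ha, h5 a ha]
    rw [DD_sub, DD_smul hc, sub_eq_zero] at this
    exact this
  have hcF : c ∉ clS F' := by
    intro hcc
    apply h1
    refine BB_mono ?_ h2
    exact Set.insert_subset hcc (clS_sub _)
  obtain ⟨δ, h3, h4⟩ := not_clS hcF
  have hKF : Kil F δ := h3.mono ((clS_sub F).trans Set.subset_union_left)
  refine ⟨F', c, h, DD h δ, hh, Set.subset_union_left, (clS_countable hM.cnt).union s.countable_toSet, h2, (Gam.of hG hh).DD hG hM hKF, ?_, hlin δ h3 h4, δ, h3, h4, rfl⟩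
  intro h0
  apply h1
  rw [BB_DD]
  intro ε hε
  rw [hlin δ h3 h4 ε hε, h0, smul_zero]

structure P4D (F' : Set ℂ) (c : ℂ) (E : Derivation ℤ K K) (z : Fin 2 → ℂ) (w : ℂ) (d : Fin 2 → Derivation ℤ ℂ ℂ) (e : Fin 2 → ℂ) : Prop where
  dF : ∀ a, Kil F' (d a)
  dw : ∀ a, d a w = 0
  dz : ∀ a b, d a (z b) = if a = b then 1 else 0
  ev : ∀ a, Ev z (E (zz a)) (e a)
  sm : ∑ a, d a c * e a = 1
  cl : c ∈ clS (F' ∪ Set.range z ∪ {w})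

theorem unc_not {S : Set ℂ} (hS : S.Countable) : ∃ c, c ∉ clS S := by
  by_contra! h
  exact not_countable_complex ((clS_countable hS).mono fun c _ => h c)

theorem M6b (hG : GD G) {F' c h E} (hM : M6D G F F' c h E) : ∃ z w d e, P4D F' c E z w d e := by
  classical
  obtain ⟨δ, hδ, hδc, hE⟩ := hM.ex
  have hc := hG.fc h hM.hG
  set S := insert c F' with hS
  have hSc : S.Countable := hM.cnt.insert c
  have hF'S : F' ⊆ S := Set.subset_insert _ _
  have hδK : ∀ f ∈ Kc K S, hatD δ f ∈ Kc K S := by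
    intro f hf
    rw [mem_Kc] at hf ⊢
    intro ε hε
    rw [hat_lie, hf ε hε, map_zero, zero_add]
    apply hf
    rintro a (rfl | ha)
    · rw [Derivation.commutator_apply, hδc, hε a (Set.mem_insert _ _)]; simp
    · rw [Derivation.commutator_apply, hδ a ha, hε a (hF'S ha)]; simp
  have hsB : ∀ f, h.symm f ∈ Kc K S ↔ f ∈ Kc K S := by
    intro f
    rw [mem_Kc, mem_Kc]
    refine forall_congr' fun ε => forall_congr' fun hε => ?_
    have := hM.bb ε hε (h.symm f)
    rw [RingEquiv.apply_symm_apply] at this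
    rw [← this]; simp
  have hhK : ∀ f ∈ Kc K S, h f ∈ Kc K S := fun f hf => (hsB _).1 (by simpa using hf)
  have hEK : ∀ f ∈ Kc K S, E f ∈ Kc K S := by
    intro f hf
    rw [hE, DD_apply]
    exact sub_mem (hδK f hf) (hhK _ (hδK _ ((hsB f).2 hf)))
  have hpK : ∀ a, ∀ f ∈ Kc K S, pd a f ∈ Kc K S := by
    intro a f hf
    rw [mem_Kc] at hf ⊢
    intro ε hε; rw [hat_pd, hf ε hε, map_zero]
  -- dual
  obtain ⟨x, hx⟩ := unc_not hSc
  obtain ⟨y, hy⟩ := unc_not (hSc.insert x)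
  obtain ⟨δ1', a1, a2⟩ := not_clS hx
  obtain ⟨δ2, b1, b2⟩ := not_clS hy
  have b3 : δ2 x = 0 := b1 x (Set.mem_insert _ _)
  have b4 : Kil S δ2 := b1.mono (Set.subset_insert _ _)
  let δ1 := δ1' - δ1' y • δ2
  have c1 : Kil S δ1 := fun a ha => by simp [δ1, a1 a ha, b4 a ha]
  have c2 : δ1 x = 1 := by simp [δ1, a2, b3]
  have c3 : δ1 y = 0 := by simp [δ1, b2]
  let z : Fin 2 → ℂ := ![x, y]
  let da : Fin 2 → Derivation ℤ ℂ ℂ := ![δ1, δ2]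
  have hda : ∀ a, Kil S (da a) := by intro a; fin_cases a; exacts [c1, b4]
  have hdz : ∀ a b, da a (z b) = if a = b then 1 else 0 := by
    intro a b; fin_cases a <;> fin_cases b <;> simp [da, z, b2, b3, c2, c3]
  let η := δ - δ x • δ1 - δ y • δ2
  have η1 : Kil F' η := fun a ha => by simp [η, hδ a ha, c1 a (hF'S ha), b4 a (hF'S ha)]
  have η2 : η c = 1 := by simp [η, hδc, c1 c (Set.mem_insert _ _), b4 c (Set.mem_insert _ _)]
  have η3 : ∀ b, η (z b) = 0 := by
    intro b; fin_cases b <;> simp [η, z, b2, b3, c2, c3]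
  have hev : ∀ f ∈ Kc K S, ∃ v, Ev z f v ∧ (f ≠ 0 → v ≠ 0) := fun f hf => Ev.exists da hda hdz hf
  obtain ⟨j, hj⟩ : ∃ j, E (zz j) ≠ 0 := by
    by_contra! hn
    exact hM.e0 (K2_der_zero E (fun a => hM.dp.1 _ (cc_fixG hG a)) hn)
  set u := h.symm (zz j) with hu
  have hhu : h u = zz j := by simp [hu]
  have huK : u ∈ Kc K S := (hsB _).2 (zz_Kc S j)
  obtain ⟨w, hw, _⟩ := hev u huK
  obtain ⟨A, hA, hA0⟩ := hev (E u) (hEK u huK)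
  have hEu : E u ≠ 0 := by
    intro h0; apply hj; rw [← hhu, ← hM.dp.2 h hM.hG, h0, map_zero]
  have hA0 := hA0 hEu
  have hhat : ∀ ε, Kil F' ε → hatD ε u = -(cc (ε c) * E u) := by
    intro ε hε
    have := congrArg (fun D : Derivation ℤ K K => D (zz j)) (hM.eq ε hε)
    simp only [DD_apply, Derivation.smul_apply, smul_eq_mul, hatD_zz, zero_sub] at this
    apply h.injective
    rw [map_neg, map_mul, hc, hM.dp.2 h hM.hG, hhu, ← this]
    simp [hu]
  choose B hB _ using fun a => hev (pd a u) (hpK a u huK)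
  choose e he _ using fun a => hev (E (zz a)) (hEK _ (zz_Kc S a))
  have hdw : ∀ ε, Kil F' ε → ε w = -(ε c * A) + ∑ a, B a * ε (z a) := by
    intro ε hε
    obtain ⟨v0, va, p1, p2, p3⟩ := hw.der ε
    rw [hhat ε hε] at p1
    rw [p3, p1.uniq ((Ev.cc (ε c)).mul hA).neg]
    congr 1
    exact Finset.sum_congr rfl fun a _ => by rw [(p2 a).uniq (hB a)]
  have hAe : A = e 0 * B 0 + e 1 * B 1 := by
    have := der_basis E (fun a => hM.dp.1 _ (cc_fixG hG a))
    have h2 := congrArg (fun D : Derivation ℤ K K => D u) this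
    simp only [Derivation.add_apply, Derivation.smul_apply, smul_eq_mul] at h2
    rw [h2] at hA
    exact hA.uniq (((he 0).mul (hB 0)).add ((he 1).mul (hB 1)))
  refine ⟨z, w, fun a => da a + (B a / A) • η, e, ⟨?_, ?_, ?_, he, ?_, ?_⟩⟩
  · intro a b hb
    simp [hda a b (hF'S hb), η1 b hb]
  · intro a
    have h1 := hdw (da a) ((hda a).mono hF'S)
    have h2 := hdw η η1
    simp only [η2, η3, hdz, hda a c (Set.mem_insert _ _)] at h1 h2
    simp only [Derivation.add_apply, Derivation.smul_apply, h1, h2]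
    simp; field_simp; ring
  · intro a b; simp [hdz, η3]
  · have : ∀ a, da a c = 0 := fun a => hda a c (Set.mem_insert _ _)
    simp [Fin.sum_univ_two, this, η2]
    field_simp
    rw [hAe]; ring
  · rw [mem_clS]
    intro ε hε
    have h1 := hdw ε (hε.mono fun a ha => Or.inl (Or.inl ha))
    rw [hε w (Or.inr rfl)] at h1
    have h2 : ∀ a, ε (z a) = 0 := fun a => hε _ (Or.inl (Or.inr ⟨a, rfl⟩))
    simp [h2, hA0] at h1
    exact h1
end D9

set_option linter.all false

noncomputable section D10

variable {K : Type} [Field K] [CharZero K] [Algebra R2 K] [IsFractionRing R2 K]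
variable {G : Set (K ≃+* K)} {F : Set ℂ} {n : ℕ} {D : Fin n → Derivation ℤ K K}

theorem orbit_fin (h : RingAut K) (hc : ∀ a, h (cc a) = cc a) (W : Set ℂ) (hB : BB K W h) :
    (((fun σ : RingAut ℂ => (hatS σ : RingAut K) * h * (hatS σ : RingAut K)⁻¹) '' {σ | ∀ a ∈ Subfield.closure W, σ a = a}) : Set (RingAut K)).Finite := by
  classical
  choose S0 h1 h2 h3 using fun i => coef_rep (h (zz i))
  let C : Finset ℂ := Finset.univ.biUnion S0
  have hC : ∀ c ∈ C, IsAlgebraic (Subfield.closure W) c := by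
    intro c hcC
    obtain ⟨i, -, hi⟩ := Finset.mem_biUnion.1 hcC
    exact clS_alg (mem_clS.2 fun δ hδ => h2 i δ (by rw [← hB δ hδ]; simp) c hi)
  let cj := fun σ : RingAut ℂ => (hatS σ : RingAut K) * h * (hatS σ : RingAut K)⁻¹
  let R : Set (C → ℂ) := Set.univ.pi fun c : C => {r : ℂ | (minpoly (Subfield.closure W) (c : ℂ)).aeval r = 0}
  have hR : R.Finite := by
    refine Set.Finite.pi ?_
    intro c
    refine ((minpoly (Subfield.closure W) (c : ℂ)).rootSet_finite ℂ).subset ?_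
    intro r hr
    rw [Polynomial.mem_rootSet']
    refine ⟨?_, hr⟩
    exact (Polynomial.map_ne_zero (minpoly.ne_zero (hC c c.2).isIntegral))
  have hRR : ((fun σ : RingAut ℂ => fun c : C => σ c) '' {σ | ∀ a ∈ Subfield.closure W, σ a = a}).Finite := by
    refine hR.subset ?_
    rintro _ ⟨σ, hσ, rfl⟩ c -
    let τ : ℂ →ₐ[Subfield.closure W] ℂ := { (σ : ℂ →+* ℂ) with commutes' := fun a => hσ a a.2 }
    show Polynomial.aeval (τ c) _ = 0
    rw [Polynomial.aeval_algHom_apply, minpoly.aeval, map_zero]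
  have key : ∀ σ τ : RingAut ℂ, (∀ c ∈ C, σ c = τ c) → cj σ = cj τ := by
    intro σ τ hst
    have hsy : ∀ (σ : RingAut ℂ) a, (hatS σ : K ≃+* K).symm (cc a) = cc (σ.symm a) := fun σ a => by rw [RingEquiv.symm_apply_eq]; simp
    have hsz : ∀ (σ : RingAut ℂ) i, (hatS σ : K ≃+* K).symm (zz i) = zz i := fun σ a => by rw [RingEquiv.symm_apply_eq]; simp
    have hi : ∀ σ f, (hatS σ : RingAut K)⁻¹ f = (hatS σ).symm f := fun σ f => rfl
    apply K2_aut_ext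
    · intro a; simp [cj, hi, hsy, hc]
    · intro i; simp only [cj, RingAut.mul_apply, hi, hsz]
      have : Subfield.closure (cc '' (S0 i : Set ℂ) ∪ Set.range zz) ≤ (hatS σ : K ≃+* K).toRingHom.eqLocusField (hatS τ : K ≃+* K).toRingHom := by
        rw [Subfield.closure_le]
        rintro z (⟨a, ha, rfl⟩ | ⟨i, rfl⟩)
        · show (hatS σ : K ≃+* K) (cc a) = hatS τ (cc a)
          rw [hatS_cc, hatS_cc, hst a (Finset.mem_biUnion.2 ⟨i, Finset.mem_univ _, ha⟩)]
        · show (hatS σ : K ≃+* K) (zz i) = hatS τ (zz i)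
          simp
      exact this (h1 i)
  let g : (C → ℂ) → RingAut K := fun r => if hr : ∃ σ : RingAut ℂ, ∀ c : C, σ c = r c then cj hr.choose else 1
  refine (hRR.image g).subset ?_
  rintro _ ⟨σ, hσ, rfl⟩
  refine ⟨_, ⟨σ, hσ, rfl⟩, ?_⟩
  have hr : ∃ τ : RingAut ℂ, ∀ c : C, τ c = σ c := ⟨σ, fun _ => rfl⟩
  show dite _ _ _ = _
  rw [dif_pos hr]
  exact key _ _ fun c hcC => hr.choose_spec ⟨c, hcC⟩

/-- invariance of the product under a field automorphism -/
theorem H_inv (hG : GD G) (hM : M5D G F n D) (O : Finset (RingAut K)) (hO : ∀ x ∈ O, Gam G F x) (σ : RingAut ℂ)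
    (hσ : ∀ a ∈ clS F, σ a = a) (hσO : ∀ x ∈ O, (hatS σ : RingAut K) * x * (hatS σ : RingAut K)⁻¹ ∈ O) :
    (hatS σ : RingAut K) * O.toList.prod = O.toList.prod * hatS σ := by
  classical
  set s : RingAut K := hatS σ with hs
  set H := O.toList.prod with hH
  have hL : ∀ x ∈ O.toList, Gam G F x := fun x hx => hO x (Finset.mem_toList.1 hx)
  have hKil0 : Kil F 0 := fun a _ => rfl
  have hHG : Gam G F H := (Gam.list hG hM _ hL hKil0).1
  let b := s * H * s⁻¹ * H⁻¹
  have hb : Gam G F b := (Gam.conj hG hM hσ hHG).mul hHG.inv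
  have hconj : ∀ (u : RingAut K) (L : List (RingAut K)), u * L.prod * u⁻¹ = (L.map fun x => u * x * u⁻¹).prod := by
    intro u L
    have := map_list_prod (MulAut.conj u) L
    exact this
  have hbH : b * H = s * H * s⁻¹ := by simp [b]
  have hbB : BB K F b := by
    rw [BB_DD]
    intro δ hδ
    have h1 := hb.DDmul hG hM hHG hδ
    rw [hbH, hconj] at h1
    have h2 := (Gam.list hG hM (O.toList.map fun x => s * x * s⁻¹) (by
      intro x hx
      obtain ⟨y, hy, rfl⟩ := List.mem_map.1 hx
      exact Gam.conj hG hM hσ (hL y hy)) hδ).2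
    have h3 := (Gam.list hG hM _ hL hδ).2
    rw [h2, ← hH.symm, h3, List.map_map, Finset.sum_map_toList, Finset.sum_map_toList] at h1
    have h4 : ∑ x ∈ O, ((fun x => DD x δ) ∘ fun x => s * x * s⁻¹) x = ∑ x ∈ O, DD x δ := by
      refine Finset.sum_bij (fun x _ => s * x * s⁻¹) hσO (fun a _ c _ h => by simpa using h) ?_ (fun a _ => rfl)
      have := Finset.surj_on_of_inj_on_of_card_le (s := O) (t := O) (fun x _ => s * x * s⁻¹) hσO (fun a c _ _ h => by simpa using h) le_rfl
      intro y hy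
      obtain ⟨x, hx, h⟩ := this y hy
      exact ⟨x, hx, h.symm⟩
    rw [h4] at h1
    exact left_eq_add.1 (h1.trans (add_comm _ _))
  have hbG : b ∈ G := hM.B b hb.fc hbB hb.T
  have hsb : s * b = b * s := by
    ext f
    exact hatS_comm hσ hb.fc hbB f
  have hpow : ∀ m : ℕ, s ^ m * H * (s ^ m)⁻¹ = b ^ m * H := by
    intro m
    induction m with
    | zero => simp
    | succ m ih =>
      have : s ^ (m + 1) * H * (s ^ (m + 1))⁻¹ = s * (s ^ m * H * (s ^ m)⁻¹) * s⁻¹ := by rw [pow_succ']; group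
      have hc : s * b ^ m = b ^ m * s := (Commute.pow_right (show Commute s b from hsb) m)
      rw [this, ih, ← mul_assoc, hc, mul_assoc, mul_assoc, ← mul_assoc s, ← hbH, ← mul_assoc, pow_succ]
  have hsO : ∀ m : ℕ, ∀ x ∈ O, s ^ m * x * (s ^ m)⁻¹ ∈ O := by
    intro m
    induction m with
    | zero => simp
    | succ m ih =>
      intro x hx
      have : s ^ (m + 1) * x * (s ^ (m + 1))⁻¹ = s * (s ^ m * x * (s ^ m)⁻¹) * s⁻¹ := by rw [pow_succ']; group
      rw [this]; exact hσO _ (ih x hx)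
  let Φ : ℕ → (O → O) := fun m x => ⟨s ^ m * x * (s ^ m)⁻¹, hsO m x x.2⟩
  obtain ⟨m, k, hmk, hΦ⟩ := Finite.exists_ne_map_eq_of_infinite Φ
  have hbb : b ^ m = b ^ k := by
    have : b ^ m * H = b ^ k * H := by
      rw [← hpow, ← hpow, hconj, hconj]
      congr 1
      apply List.map_congr_left
      intro x hx
      exact congrArg Subtype.val (congrFun hΦ ⟨x, Finset.mem_toList.1 hx⟩)
    exact mul_right_cancel this
  have hb1 : b = 1 := by
    have : ∃ N : ℕ, 0 < N ∧ b ^ N = 1 := by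
      rcases lt_or_gt_of_ne hmk with h | h
      · exact ⟨k - m, by omega, by rw [pow_sub _ h.le, hbb]; simp⟩
      · exact ⟨m - k, by omega, by rw [pow_sub _ h.le, hbb]; simp⟩
    obtain ⟨N, hN, hbN⟩ := this
    ext f
    have hit : ∀ (N : ℕ) f, b^[N] f = (b ^ N) f := by
      intro N
      induction N with
      | zero => intro f; rfl
      | succ N ih => intro f; rw [Function.iterate_succ_apply, ih, pow_succ]; rfl
    exact hG.tf b hbG N hN (fun f => by rw [hit, hbN]; rfl) f
  have : s * H * s⁻¹ = H := by rw [← hbH, hb1, one_mul]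
  exact mul_inv_eq_iff_eq_mul.1 this

end D10

set_option linter.all false

noncomputable section D11

variable {K : Type} [Field K] [CharZero K] [Algebra R2 K] [IsFractionRing R2 K]
variable {G : Set (K ≃+* K)} {F : Set ℂ} {n : ℕ} {D : Fin n → Derivation ℤ K K}

theorem M6 (hG : GD G) (hM : M5D G F n D) : ∃ (H : RingAut K) (d : Derivation ℤ ℂ ℂ) (x : ℂ), Gam G F H ∧ Kil F d ∧ d x = 1 ∧ DD H d ≠ 0 ∧
    ∀ i, H (zz i) ∈ Subfield.closure ({f : K | hatD d f = 0} ∪ {cc x}) ∧ H⁻¹ (zz i) ∈ Subfield.closure ({f : K | hatD d f = 0} ∪ {cc x}) := by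
  classical
  obtain ⟨F', c, h, E, h6⟩ := M6a hG hM
  obtain ⟨z, w, d, e, h4⟩ := M6b hG h6
  set W := F' ∪ Set.range z ∪ {w} with hW
  have hF'W : F' ⊆ W := fun a ha => Or.inl (Or.inl ha)
  have hFW : ∀ a ∈ clS F, a ∈ Subfield.closure W := fun a ha => Subfield.subset_closure (hF'W (h6.cF ha))
  have hFF' : F ⊆ F' := (clS_sub F).trans h6.cF
  have hc := hG.fc h h6.hG
  have hBW : BB K W h := BB_mono (Set.insert_subset h4.cl (hF'W.trans (clS_sub W))) h6.bb
  have hfin := orbit_fin h hc W hBW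
  let O := hfin.toFinset
  have hOmem : ∀ x, x ∈ O ↔ ∃ σ : RingAut ℂ, (∀ a ∈ Subfield.closure W, σ a = a) ∧ (hatS σ : RingAut K) * h * (hatS σ : RingAut K)⁻¹ = x := by
    intro x; simp only [O, Set.Finite.mem_toFinset]; rfl
  have hOG : ∀ x ∈ O, Gam G F x := by
    intro x hx
    obtain ⟨σ, hσ, rfl⟩ := (hOmem x).1 hx
    exact Gam.conj hG hM (fun a ha => hσ a (hFW a ha)) (Gam.of hG h6.hG)
  have hL : ∀ x ∈ O.toList, Gam G F x := fun x hx => hOG x (Finset.mem_toList.1 hx)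
  set H := O.toList.prod with hH
  have hHG : Gam G F H := (Gam.list hG hM _ hL (δ := 0) (fun a _ => rfl)).1
  have hHD : ∀ δ, Kil F δ → DD H δ = ∑ x ∈ O, DD x δ := fun δ hδ => by
    rw [(Gam.list hG hM _ hL hδ).2, Finset.sum_map_toList]
  have hcomm : ∀ σ : RingAut ℂ, (∀ a ∈ Subfield.closure W, σ a = a) → (hatS σ : RingAut K) * H = H * hatS σ := by
    intro σ hσ
    apply H_inv hG hM O hOG σ (fun a ha => hσ a (hFW a ha))
    intro x hx
    obtain ⟨τ, hτ, rfl⟩ := (hOmem x).1 hx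
    rw [hOmem]
    refine ⟨σ * τ, fun a ha => by rw [RingAut.mul_apply, hτ a ha, hσ a ha], ?_⟩
    rw [hatS_mul]; group
  have hsymm : ∀ σ : RingAut ℂ, (∀ a ∈ Subfield.closure W, σ a = a) → ∀ a ∈ Subfield.closure W, RingEquiv.symm σ a = a :=
    fun σ hσ a ha => by rw [RingEquiv.symm_apply_eq, hσ a ha]
  have hWc : ∀ a ∈ W, a ∈ Subfield.closure W := fun a ha => Subfield.subset_closure ha
  have hHB : BB K W H := by
    rw [BB_DD]
    intro δ hδ
    rw [hHD δ (hδ.mono (hFF'.trans hF'W))]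
    apply Finset.sum_eq_zero
    intro x hx
    obtain ⟨σ, hσ, rfl⟩ := (hOmem x).1 hx
    have hk : Kil W (conjD σ.symm δ) := fun a ha => by
      rw [conjD_apply]; simp [hσ a (hWc a ha), hδ a ha]
    have h0 := BB_DD.1 hBW _ hk
    ext f
    rw [DD_conj, h0]; simp
  have hHiB : BB K W H⁻¹ := by
    intro δ hδ f
    show RingEquiv.symm H _ = hatD δ (RingEquiv.symm H f)
    rw [RingEquiv.symm_apply_eq, hHB δ hδ]; simp
  -- coefficients
  have hcoef : ∀ f : K, f ∈ Kc K W → (∀ σ : RingAut ℂ, (∀ a ∈ Subfield.closure W, σ a = a) → hatS σ f = f) → ∀ a, 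
      f ∈ Subfield.closure ({f : K | hatD (d a) f = 0} ∪ {cc (z a)}) := by
    intro f hf hσ a
    obtain ⟨S0, s1, s2, s3⟩ := coef_rep f
    have hS0 : ∀ c ∈ S0, c ∈ Subfield.closure W := by
      intro c hcS
      by_contra hn
      obtain ⟨σ, t1, t2⟩ := exists_aut (Subfield.closure W) (clS_alg (mem_clS.2 fun δ hδ => s2 δ (mem_Kc.1 hf δ hδ) c hcS)) hn
      exact t2 (s3 σ (hσ σ t1) c hcS)
    have hcl : Subfield.closure W ≤ (Subfield.closure ({f : K | hatD (d a) f = 0} ∪ {cc (z a)})).comap (ccH K) := by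
      rw [Subfield.closure_le]
      rintro b ((hb | ⟨i, rfl⟩) | hb)
      · refine Subfield.subset_closure (Or.inl ?_)
        show hatD (d a) (cc b) = 0
        rw [hatD_cc, h4.dF a b hb]; exact map_zero (ccH K)
      · by_cases hia : a = i
        · subst hia; exact Subfield.subset_closure (Or.inr rfl)
        · refine Subfield.subset_closure (Or.inl ?_)
          show hatD (d a) (cc _) = 0
          rw [hatD_cc, h4.dz a i, if_neg hia]; exact map_zero (ccH K)
      · rw [Set.mem_singleton_iff] at hb
        subst hb
        refine Subfield.subset_closure (Or.inl ?_)
        show hatD (d a) (cc b) = 0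
        rw [hatD_cc, h4.dw]; exact map_zero (ccH K)
    have : Subfield.closure (cc '' (S0 : Set ℂ) ∪ Set.range zz) ≤ Subfield.closure ({f : K | hatD (d a) f = 0} ∪ {cc (z a)}) := by
      rw [Subfield.closure_le]
      rintro b (⟨b, hb, rfl⟩ | ⟨i, rfl⟩)
      · exact hcl (hS0 b hb)
      · exact Subfield.subset_closure (Or.inl (hatD_zz _ _))
    exact this s1
  -- nonvanishing
  have hx1 : ∀ x ∈ O, Ev z (∑ a, DD x (d a) (zz a)) 1 := by
    intro x hx
    obtain ⟨σ, hσ, rfl⟩ := (hOmem x).1 hx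
    have hk : ∀ a, DD h (conjD σ.symm (d a)) = (cc (d a c) : K) • E := by
      intro a
      have k1 : Kil F' (conjD σ.symm (d a)) := fun b hb => by
        rw [conjD_apply]; simp [hσ b (hWc b (hF'W hb)), h4.dF a b hb]
      rw [h6.eq _ k1]
      have k2 : Kil W (conjD σ.symm (d a) - d a) := by
        rintro b hb
        rw [Derivation.sub_apply, conjD_apply]
        simp only [RingEquiv.symm_symm, hσ b (hWc b hb)]
        rcases hb with (hb | ⟨i, rfl⟩) | hb
        · simp [h4.dF a b hb]
        · rw [h4.dz]; split_ifs <;> simp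
        · rw [Set.mem_singleton_iff] at hb; subst hb; simp [h4.dw]
      have := mem_clS.1 h4.cl _ k2
      rw [Derivation.sub_apply, sub_eq_zero] at this
      rw [this]
    have hzi : ∀ i, σ (z i) = z i := fun i => hσ _ (hWc _ (Or.inl (Or.inr ⟨i, rfl⟩)))
    have : ∑ a, DD ((hatS σ : RingAut K) * h * (hatS σ : RingAut K)⁻¹) (d a) (zz a) = hatS σ (∑ a, cc (d a c) * E (zz a)) := by
      rw [map_sum]
      refine Finset.sum_congr rfl fun a _ => ?_
      have hz : (hatS σ : K ≃+* K).symm (zz a) = zz a := by rw [RingEquiv.symm_apply_eq]; simp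
      rw [DD_conj, hk, hz]; rfl
    rw [this]
    have h2 := Ev.hatS hzi (Ev.sum Finset.univ (fun a => cc (d a c) * E (zz a)) (fun a => d a c * e a) fun a _ => (Ev.cc _).mul (h4.ev a))
    rw [h4.sm, map_one] at h2
    exact h2
  have hKd : ∀ a, Kil F (d a) := fun a => (h4.dF a).mono hFF'
  obtain ⟨a, ha⟩ : ∃ a, DD H (d a) ≠ 0 := by
    by_contra! hn
    have h1 := Ev.sum O _ _ hx1
    rw [Finset.sum_comm] at h1
    have h2 : ∑ a, ∑ x ∈ O, DD x (d a) (zz a) = 0 := by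
      apply Finset.sum_eq_zero
      intro a _
      have := hHD (d a) (hKd a)
      rw [hn a] at this
      rw [← der_sum_apply, ← this]; rfl
    rw [h2] at h1
    have h3 := h1.uniq (w := 0) (by simpa using Ev.cc (z := z) (K := K) 0)
    simp at h3
    have : h ∈ O := (hOmem h).2 ⟨1, fun a _ => rfl, by
      have : (hatS (1 : RingAut ℂ) : RingAut K) = 1 := by apply K2_aut_ext <;> intro a <;> simp
      rw [this]; simp⟩
    rw [h3] at this
    simp at this
  refine ⟨H, d a, z a, hHG, hKd a, by simp [h4.dz], ha, fun i => ⟨hcoef _ ((BB_iff hHG.fc).1 hHB i) ?_ a, hcoef _ ((BB_iff hHG.inv.fc).1 hHiB i) ?_ a⟩⟩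
  · intro σ hσ
    have := congrArg (fun u : RingAut K => u (zz i)) (hcomm σ hσ)
    simp only [RingAut.mul_apply, hatS_zz] at this
    exact this
  · intro σ hσ
    have h1 : (hatS σ : RingAut K) * H⁻¹ = H⁻¹ * hatS σ := by
      rw [eq_inv_mul_iff_mul_eq, ← mul_assoc, ← hcomm σ hσ]; simp
    have := congrArg (fun u : RingAut K => u (zz i)) h1
    simp only [RingAut.mul_apply, hatS_zz] at this
    exact this
end D11

set_option linter.all false

noncomputable section D12

theorem der_pres {L : Type*} [Field L] (D : Derivation ℤ L L) (S : Set L) (h : ∀ s ∈ S, D s ∈ Subfield.closure S) :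
    ∀ a ∈ Subfield.closure S, D a ∈ Subfield.closure S := by
  intro a ha
  induction ha using Subfield.closure_induction with
  | mem x hx => exact h x hx
  | one => simp
  | add x y hx hy h1 h2 => rw [map_add]; exact add_mem h1 h2
  | neg x hx h1 => rw [map_neg]; exact neg_mem h1
  | inv x hx h1 => 
    rw [Derivation.leibniz_inv]; simp only [smul_eq_mul]
    exact mul_mem (neg_mem (pow_mem (inv_mem hx) 2)) h1
  | mul x y hx hy h1 h2 => 
    rw [Derivation.leibniz]; simp only [smul_eq_mul]
    exact add_mem (mul_mem hx h2) (mul_mem hy h1)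

variable {K : Type} [Field K] [CharZero K] [Algebra R2 K] [IsFractionRing R2 K]
variable {G : Set (K ≃+* K)} {F : Set ℂ} {n : ℕ} {D : Fin n → Derivation ℤ K K}

/-- the field of functions rational in x with coefficients killed by d -/
def LL (K : Type) [Field K] [CharZero K] [Algebra R2 K] [IsFractionRing R2 K] (d : Derivation ℤ ℂ ℂ) (x : ℂ) : Subfield K :=
  Subfield.closure ({f : K | hatD d f = 0} ∪ {cc x})

theorem LL_ker {d : Derivation ℤ ℂ ℂ} {x : ℂ} {f : K} (h : hatD d f = 0) : f ∈ LL K d x := Subfield.subset_closure (Or.inl h)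
theorem LL_x {d : Derivation ℤ ℂ ℂ} {x : ℂ} : (cc x : K) ∈ LL K d x := Subfield.subset_closure (Or.inr rfl)

theorem LL_d {d : Derivation ℤ ℂ ℂ} {x : ℂ} (hx : d x = 1) : ∀ f ∈ LL K d x, hatD d f ∈ LL K d x := by
  apply der_pres
  rintro s (hs | rfl)
  · have : hatD d s = 0 := hs
    rw [this]; exact zero_mem _
  · rw [hatD_cc, hx]; simp

theorem Dcc (hG : GD G) (hM : M5D G F n D) (l) (a : ℂ) : D l (cc a) = 0 := (hM.DG l).1 _ (cc_fixG hG a)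

theorem Dcomm (hG : GD G) (hM : M5D G F n D) {d} (hd : Kil F d) (l) (f : K) : hatD d (D l f) = D l (hatD d f) := by
  have : ⁅(hatD d : Derivation ℤ K K), D l⁆ = 0 := by
    apply K2_der_zero
    · intro a; rw [Derivation.commutator_apply, Dcc hG hM, hatD_cc, Dcc hG hM]; simp
    · intro i; rw [Derivation.commutator_apply, mem_Kc.1 (hM.coef l i) d hd]; simp
  have h2 := congrArg (fun E : Derivation ℤ K K => E f) this
  rw [Derivation.commutator_apply] at h2
  exact sub_eq_zero.1 h2

theorem LL_D (hG : GD G) (hM : M5D G F n D) {d} (hd : Kil F d) {x : ℂ} (l) : ∀ f ∈ LL K d x, D l f ∈ LL K d x := by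
  apply der_pres
  rintro s (hs | rfl)
  · have hs : hatD d s = 0 := hs
    apply LL_ker (x := x)
    rw [Dcomm hG hM hd, hs, map_zero]
  · rw [Dcc hG hM]; exact zero_mem _

theorem LL_H {H : K ≃+* K} (hc : ∀ a, H (cc a) = cc a) {d : Derivation ℤ ℂ ℂ} {x : ℂ} (hz : ∀ i, H (zz i) ∈ LL K d x) :
    ∀ f ∈ LL K d x, H f ∈ LL K d x := by
  have : LL K d x ≤ (LL K d x).comap H.toRingHom := by
    unfold LL
    rw [Subfield.closure_le]
    rintro s (hs | rfl)
    · have hs : hatD d s = 0 := hs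
      obtain ⟨S0, h1, h2, _⟩ := coef_rep s
      have h3 : Subfield.closure (cc '' (S0 : Set ℂ) ∪ Set.range zz) ≤ (LL K d x).comap H.toRingHom := by
        rw [Subfield.closure_le]
        rintro z (⟨a, ha, rfl⟩ | ⟨i, rfl⟩)
        · show H (cc a) ∈ LL K d x
          rw [hc]; apply LL_ker; rw [hatD_cc, h2 d hs a ha]; exact map_zero (ccH K)
        · exact hz i
      exact h3 h1
    · show H (cc x) ∈ LL K d x
      rw [hc]; exact LL_x
  exact this

theorem f_LL (hG : GD G) (hM : M5D G F n D) {d} (hd : Kil F d) {x : ℂ} (hx : d x = 1) {H : RingAut K} (hH : Gam G F H)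
    (hz : ∀ i, H (zz i) ∈ LL K d x ∧ H⁻¹ (zz i) ∈ LL K d x) (f : Fin n → K) (hf : DD H d = ∑ l, f l • D l) (l) : f l ∈ LL K d x := by
  obtain ⟨φ, hφ⟩ := LinearMap.exists_leftInverse_of_injective (Algebra.linearMap (LL K d x) K) (by
    rw [LinearMap.ker_eq_bot]; exact (algebraMap (LL K d x) K).injective)
  have hφ' : ∀ a ∈ LL K d x, (φ a : K) = a := fun a ha => congrArg Subtype.val (LinearMap.congr_fun hφ ⟨a, ha⟩)
  have : (fun l => (φ (f l) : K) - f l) = 0 := by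
    apply hM.li
    apply K2_der_zero
    · intro a; rw [der_sum_apply]; simp [Dcc hG hM]
    · intro i
      have h1 := congrArg (fun E : Derivation ℤ K K => E (zz i)) hf
      simp only [der_sum_apply, Derivation.smul_apply, smul_eq_mul] at h1
      have h2 : DD H d (zz i) ∈ LL K d x := by
        rw [DD_apply]
        refine sub_mem ?_ ?_
        · simp
        · exact LL_H hH.fc (fun i => (hz i).1) _ (LL_d hx _ (hz i).2)
      have hDz : ∀ l, D l (zz i) ∈ LL K d x := fun l => LL_ker (mem_Kc.1 (hM.coef l i) d hd)
      have h3 : (φ (DD H d (zz i)) : K) = ∑ l, (φ (f l) : K) * D l (zz i) := by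
        rw [h1, map_sum]
        push_cast
        refine Finset.sum_congr rfl fun l _ => ?_
        have : f l * D l (zz i) = (⟨_, hDz l⟩ : LL K d x) • f l := by rw [Subfield.smul_def]; simp [mul_comm]
        rw [this, map_smul]; simp [mul_comm]
      rw [hφ' _ h2, h1] at h3
      rw [der_sum_apply]
      simp only [Derivation.smul_apply, smul_eq_mul, sub_mul, Finset.sum_sub_distrib, h3, sub_self]
  have h := sub_eq_zero.1 (congrFun this l)
  rw [← h]; exact (φ (f l)).2

theorem f_cl (hM : M5D G F n D) {d} (hd : Kil F d) {x : ℂ} (hcx : ∀ t ∈ G, t (cc x) = cc x) (f : K) (hf : f ∈ LL K d x) (hfk : f ∈ fixG G) :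
    f ∈ Subfield.closure (((fixG G ⊓ kerS (hatD d) : Subfield K) : Set K) ∪ {cc x}) := by
  set A := kerS (hatD d : Derivation ℤ K K) with hA
  obtain ⟨P, Q, hPQ⟩ := closure_frac A (cc x) f hf
  let S : Set K := Set.range fun m : ℕ => (cc x : K) ^ m
  have hsp : ∀ R : Polynomial A, R.eval₂ A.subtype (cc x) ∈ Submodule.span A S := by
    intro R
    rw [Polynomial.eval₂_eq_sum_range]
    refine Submodule.sum_mem _ fun i _ => ?_
    exact Submodule.smul_mem _ (R.coeff i) (Submodule.subset_span ⟨i, rfl⟩)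
  by_cases hQ : Q.eval₂ A.subtype (cc x) = 0
  · rw [hPQ, hQ, div_zero]; exact zero_mem _
  obtain ⟨b, p, q, hb, h1, h2, _, h4⟩ := min_rep A S f _ _ (hsp P) (hsp Q) hQ (by rw [hPQ]; field_simp)
  have hmem : ∀ i, (p i : K) ∈ (fixG G ⊓ A : Subfield K) ∧ (q i : K) ∈ (fixG G ⊓ A : Subfield K) := by
    intro i
    have : ∀ t ∈ G, BB K F t → t (p i) = p i ∧ t (q i) = q i := by
      intro t ht hB
      refine h4 t.toRingHom ?_ ?_ (mem_fixG.1 hfk t ht) i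
      · intro a ha
        have ha : hatD d a = 0 := ha
        show hatD d (t a) = 0
        rw [← hB d hd, ha, map_zero]
      · rintro z ⟨m, rfl⟩
        show t _ = _
        rw [map_pow, hcx t ht]
    exact ⟨⟨hM.A _ fun t h1 h2 => (this t h1 h2).1, (p i).2⟩, ⟨hM.A _ fun t h1 h2 => (this t h1 h2).2, (q i).2⟩⟩
  have hcl : ∀ i : b, (i : K) ∈ Subfield.closure (((fixG G ⊓ A : Subfield K) : Set K) ∪ {cc x}) := by
    intro i
    obtain ⟨m, hm⟩ := hb i.2
    have hm : (cc x : K) ^ m = i := hm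
    rw [← hm]
    refine pow_mem ?_ m
    exact Subfield.subset_closure (Or.inr (Set.mem_singleton _))
  rw [eq_div_of_mul_eq h1 h2]
  refine div_mem ?_ ?_
  · exact sum_mem fun i _ => mul_mem (Subfield.subset_closure (Or.inl (hmem i).1)) (hcl i)
  · exact sum_mem fun i _ => mul_mem (Subfield.subset_closure (Or.inl (hmem i).2)) (hcl i)

end D12

set_option linter.all false

noncomputable section D13

variable {K : Type} [Field K] [CharZero K] [Algebra R2 K] [IsFractionRing R2 K]
variable {G : Set (K ≃+* K)} {F : Set ℂ} {n : ℕ} {D : Fin n → Derivation ℤ K K}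

theorem der_lift {Ω : Type} [Field Ω] [Algebra K Ω] [Algebra.IsAlgebraic K Ω] (E : Derivation ℤ K K) : ∃ E' : Derivation ℤ Ω Ω, 
    ∀ f, E' (algebraMap K _ f) = algebraMap K _ (E f) := by
  obtain ⟨E', h⟩ := der_ext_alg (A := K) (L := Ω) (Derivation.mk'
    { toFun := fun p => algebraMap K Ω (E p)
      map_add' := by intro a b; simp
      map_smul' := by intro a b; simp } (by intro a b; simp [Algebra.smul_def]))
  exact ⟨E', h⟩

theorem kap {K Ω : Type} [Field K] [Field Ω] [Algebra K Ω] (k : Subfield K) : ∃ κ : Subfield Ω, ∀ a, a ∈ κ ↔ IsAlgebraic k a :=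
  ⟨(algebraicClosure k Ω).toSubfield, fun a => mem_algebraicClosure_iff⟩

theorem kap_zero {K Ω : Type} [Field K] [CharZero K] [Field Ω] [Algebra K Ω] (k : Subfield K) (E : Derivation ℤ K K) (E' : Derivation ℤ Ω Ω)
    (h : ∀ f, E' (algebraMap K Ω f) = algebraMap K Ω (E f)) (hk : ∀ f ∈ k, E f = 0) (a : Ω) (ha : IsAlgebraic k a) : E' a = 0 := by
  refine der_alg_zero (K := k) ?_ ha
  intro c
  have h1 : algebraMap k Ω c = algebraMap K Ω (c : K) := rfl
  rw [h1, h, hk _ c.2, map_zero]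

theorem kap_mem {K Ω : Type} [Field K] [Field Ω] [Algebra K Ω] (k : Subfield K) (c : K) (hc : c ∈ k) : IsAlgebraic k (algebraMap K Ω c) :=
  isAlgebraic_algebraMap (A := Ω) (⟨c, hc⟩ : k)

theorem kap_pol {K Ω : Type} [Field K] [Field Ω] [Algebra K Ω] (k L : Subfield K) (k₀ : Subfield L) (hk : ∀ c ∈ k₀, (c : K) ∈ k) (α : Ω) (R : Polynomial k₀)
    (hR : R ≠ 0) (hRα : R.eval₂ (((algebraMap K Ω).comp L.subtype).comp k₀.subtype) α = 0) : IsAlgebraic k α := by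
  let j : k₀ →+* k := (L.subtype.comp k₀.subtype).codRestrict k (fun c => hk c c.2)
  refine ⟨R.map j, (Polynomial.map_ne_zero_iff j.injective).2 hR, ?_⟩
  rw [Polynomial.aeval_def, Polynomial.eval₂_map]
  exact hRα

theorem aut_restrict {K : Type} [Field K] (H : K ≃+* K) (L : Subfield K) (h1 : ∀ a ∈ L, H a ∈ L) (h2 : ∀ a ∈ L, H.symm a ∈ L) : 
    ∃ H' : L →+* L, (∀ a, (H' a : K) = H a) ∧ Function.Surjective H' := by
  refine ⟨(H.toRingHom.comp L.subtype).codRestrict L (fun a => h1 _ a.2), fun a => rfl, ?_⟩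
  intro a
  refine ⟨⟨H.symm a, h2 _ a.2⟩, ?_⟩
  ext; exact RingEquiv.apply_symm_apply H a

theorem cl_restrict {K : Type} [Field K] (L k : Subfield K) (hk : k ≤ L) (x : K) (hx : x ∈ L) (f : K) (hf : f ∈ L) (h : f ∈ Subfield.closure ((k : Set K) ∪ {x})) :
    (⟨f, hf⟩ : L) ∈ Subfield.closure (((k.comap L.subtype : Subfield L) : Set L) ∪ {⟨x, hx⟩}) := by
  have h1 : L.subtype ⟨f, hf⟩ ∈ (Subfield.closure (((k.comap L.subtype : Subfield L) : Set L) ∪ {⟨x, hx⟩})).map L.subtype := by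
    rw [RingHom.map_field_closure]
    refine Subfield.closure_mono ?_ h
    rintro z (hz | rfl)
    · exact ⟨⟨z, hk hz⟩, Or.inl hz, rfl⟩
    · exact ⟨⟨z, hx⟩, Or.inr rfl, rfl⟩
  obtain ⟨w, hw, hwe⟩ := h1
  rwa [← L.subtype.injective hwe]

theorem pole (Ω : Type) [Field Ω] [CharZero Ω] [IsAlgClosed Ω] [Algebra K Ω] [Algebra.IsAlgebraic K Ω] (hG : GD G) (hM : M5D G F n D) : ∃ (dl : Fin n → Derivation ℤ Ω Ω) (a : Fin n → Ω),
    (∀ l f, dl l (algebraMap K _ f) = algebraMap K _ (D l f)) ∧ (∀ l, IsAlgebraic (fixG G) (a l)) ∧ (∀ l m, dl l (a m) = 0) ∧ a ≠ 0 ∧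
    ∃ ε, (ε = 0 ∨ ε = 1) ∧ ∀ i, RatPS (csP (∑ l, a l • dl l) ε (algebraMap K _ (zz i))) := by
  obtain ⟨H, d, x, hH, hd, hx, hne, hz⟩ := M6 hG hM
  change ∀ i, H (zz i) ∈ LL K d x ∧ H⁻¹ (zz i) ∈ LL K d x at hz
  have hDp := hH.DD hG hM hd
  obtain ⟨f, hf⟩ := (hM.C _ (show Dp _ _ _ from ⟨hDp.1, fun t ht => hDp.2 t ht.1⟩)).2
  have hf0 : f ≠ 0 := by rintro rfl; apply hne; rw [hf]; simp
  have hfL := f_LL hG hM hd hx hH hz f hf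
  have hfk : ∀ l, f l ∈ fixG G := fun l => mem_fixG.2 fun t ht => 
    coef_fix hM.li t (fun l => (hM.DG l).2 t ht) f (by rw [← hf]; exact hDp.2 t ht) l
  have hfc := fun l => f_cl hM hd (fun t ht => hG.fc t ht x) (f l) (hfL l) (hfk l)
  obtain ⟨d', hd'⟩ := der_restrict (hatD d) (LL K d x) (LL_d hx)
  choose D' hD' using fun l => der_restrict (D l) (LL K d x) (LL_D hG hM hd l)
  choose dl hdl using fun l => der_lift (Ω := Ω) (D l)
  obtain ⟨H', hH', hHs⟩ := aut_restrict H (LL K d x) (LL_H hH.fc (fun i => (hz i).1)) (LL_H hH.inv.fc (fun i => (hz i).2))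
  obtain ⟨κ, hκm⟩ := kap (Ω := Ω) (fixG G)
  let k₀ : Subfield (LL K d x) := (fixG G ⊓ kerS (hatD d)).comap (LL K d x).subtype
  have hdlk : ∀ l, ∀ a ∈ κ, dl l a = 0 := fun l a ha => kap_zero (fixG G) (D l) (dl l) (hdl l) (hM.DG l).1 a ((hκm a).1 ha)
  have hP : PoleData d' ⟨cc x, LL_x⟩ D' (fun l => ⟨f l, hfL l⟩) H' ((algebraMap K Ω).comp (LL K d x).subtype) dl k₀ κ := {
    hdx := by ext; rw [hd']; simp [hx]
    hgen := by
      have := sub_closure (LL K d x) _ rfl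
      rw [← this]
      congr 1
      ext a
      simp only [Set.mem_union, Set.mem_setOf_eq, Set.mem_singleton_iff, Set.mem_preimage, ← hd', Subtype.ext_iff]
      rfl
    hcomm := by
      intro l a; ext; rw [hd', hD', hD', hd', Dcomm hG hM hd]
    hDx := by intro l; ext; rw [hD']; exact Dcc hG hM l x
    hHx := by ext; rw [hH']; exact hH.fc x
    hHs := hHs
    hH := by
      intro a ha
      have ha : hatD d (a : K) = 0 := by rw [← hd', ha]; rfl
      have h1 := congrArg (fun E : Derivation ℤ K K => E (H a)) hf
      simp only [der_sum_apply, Derivation.smul_apply, smul_eq_mul, DD_apply] at h1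
      rw [RingEquiv.symm_apply_apply H, ha, map_zero, sub_zero] at h1
      ext
      rw [hd', hH', h1]
      push_cast
      refine Finset.sum_congr rfl fun l _ => ?_
      rw [hD', hH']
    hdl := by intro l c; show dl l (algebraMap K _ (c : K)) = algebraMap K _ ((D' l c : LL K d x) : K); rw [hdl, hD']
    hk₀ := by intro c hc; ext; rw [hd']; exact hc.2
    hψ := fun c hc => (hκm _).2 (kap_mem _ _ hc.1)
    hκ := fun α R hR hRα => (hκm _).2 (kap_pol (fixG G) (LL K d x) k₀ (fun c hc => hc.1) α R hR hRα)
    hdlκ := hdlk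
    hf := fun l => cl_restrict (LL K d x) (fixG G ⊓ kerS (hatD d)) (fun z hz => LL_ker hz.2) _ _ _ _ (hfc l) }
  obtain ⟨a, ha, ha0, ε, hε, hr⟩ := flow_main hP (by
    intro h0; apply hf0; funext l; exact congrArg Subtype.val (congrFun h0 l))
  refine ⟨dl, a, hdl, fun l => (hκm _).1 (ha l), fun l m => hdlk l _ (ha m), ha0, ε, hε, fun i => ?_⟩
  exact hr ⟨zz i, LL_ker (hatD_zz d i)⟩ (by ext; rw [hd']; exact hatD_zz d i)

end D13

set_option linter.all false

noncomputable section D14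

variable {K : Type} [Field K] [CharZero K] [Algebra R2 K] [IsFractionRing R2 K]
variable {G : Set (K ≃+* K)} {F : Set ℂ} {n : ℕ} {D : Fin n → Derivation ℤ K K}

theorem alg_mem2 {A Ω : Type} [Field A] [IsAlgClosed A] [Field Ω] [Algebra A Ω] (z : Ω) (hz : IsAlgebraic A z) : ∃ a, z = algebraMap A Ω a := by
  have h1 := minpoly.irreducible hz.isIntegral
  obtain ⟨a, ha⟩ := minpoly.mem_range_of_degree_eq_one A z (IsAlgClosed.degree_eq_one_of_irreducible A h1)
  exact ⟨a, ha.symm⟩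

theorem cc_mem2 {Ω : Type} [Field Ω] [Algebra K Ω] (k : Subfield K) (hk : k = (ccH K).fieldRange) (z : Ω) (hz : IsAlgebraic k z) : ∃ a, z = algebraMap K Ω (cc a) := by
  subst hk
  obtain ⟨⟨a, b, rfl⟩, rfl⟩ := alg_mem2 z hz
  exact ⟨b, rfl⟩

theorem M7a (Ω : Type) [Field Ω] [CharZero Ω] [IsAlgClosed Ω] [Algebra K Ω] [Algebra.IsAlgebraic K Ω] (hG : GD G) (hM : M5D G F n D) :
    ∃ (D₀ : Derivation ℤ K K) (dΩ : Derivation ℤ Ω Ω) (a : Ω), D₀ ≠ 0 ∧ Dp (fixG G) G D₀ ∧ (∀ f, dΩ (algebraMap K Ω f) = algebraMap K Ω (D₀ f)) ∧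
      a ≠ 0 ∧ dΩ a = 0 ∧ ∃ ε, (ε = 0 ∨ ε = 1) ∧ ∀ i, RatPS (csP (a • dΩ) ε (algebraMap K _ (zz i))) := by
  obtain ⟨dl, a, hdl, haa, hda, ha0, ε, hε, hr⟩ := pole Ω hG hM
  by_cases hk : ∀ f ∈ fixG G, ∃ c, f = cc c
  · have hk' : fixG G = (ccH K).fieldRange := by
      ext f; constructor
      · intro hf; obtain ⟨c, rfl⟩ := hk f hf; exact ⟨c, rfl⟩
      · rintro ⟨c, rfl⟩; exact cc_fixG hG c
    choose α hα using fun l => cc_mem2 _ hk' (a l) (haa l)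
    refine ⟨∑ l, (cc (α l) : K) • D l, ∑ l, a l • dl l, 1, ?_, ⟨?_, ?_⟩, ?_, one_ne_zero, by simp, ε, hε, by simpa using hr⟩
    · intro h0
      apply ha0
      funext l
      have := congrFun (hM.li _ h0) l
      rw [hα l, show (cc (α l) : K) = 0 from this, map_zero]; rfl
    · intro f hf
      rw [der_sum_apply]
      exact Finset.sum_eq_zero fun l _ => by simp [(hM.DG l).1 f hf]
    · intro t ht f
      rw [der_sum_apply, der_sum_apply, map_sum]
      exact Finset.sum_congr rfl fun l _ => by simp [hG.fc t ht, (hM.DG l).2 t ht]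
    · intro f
      rw [der_sum_apply, der_sum_apply, map_sum]
      exact Finset.sum_congr rfl fun l _ => by simp [hdl, hα, Algebra.smul_def]
  · push Not at hk
    obtain ⟨f0, hf0, hfc⟩ := hk
    obtain ⟨i, hi⟩ := pd_exists hfc
    have hss : ∀ l m : Fin n, l = m := by
      intro l m
      by_contra hlm
      obtain ⟨v, hv, hs⟩ := three_dep ![D l, D m, pd i] (by
        intro j a; fin_cases j
        · exact Dcc hG hM l a
        · exact Dcc hG hM m a
        · exact pd_cc i a)
      simp only [Fin.sum_univ_three, Matrix.cons_val_zero, Matrix.cons_val_one, Matrix.cons_val] at hs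
      have h1 := congrArg (fun E : Derivation ℤ K K => E f0) hs
      simp only [Derivation.add_apply, Derivation.smul_apply, (hM.DG l).1 _ hf0, (hM.DG m).1 _ hf0, smul_eq_mul, mul_zero, zero_add, Derivation.zero_apply] at h1
      have h2 : v 2 = 0 := (mul_eq_zero.1 h1).resolve_right hi
      have h3 := hM.li (Pi.single l (v 0) + Pi.single m (v 1)) (by
        simp only [Pi.add_apply, add_smul, Finset.sum_add_distrib]
        rw [Finset.sum_eq_single l, Finset.sum_eq_single m]
        · simpa [h2] using hs
        all_goals simp +contextual [Pi.single_apply])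
      apply hv
      have e1 := congrFun h3 l
      have e2 := congrFun h3 m
      simp [Pi.single_apply, hlm, Ne.symm hlm] at e1 e2
      funext j; fin_cases j
      · exact e1
      · exact e2
      · exact h2
    obtain ⟨l, hl⟩ : ∃ l, a l ≠ 0 := by
      by_contra! h; exact ha0 (funext h)
    haveI : Subsingleton (Fin n) := ⟨hss⟩
    have hsum : ∑ l, a l • dl l = a l • dl l := Fintype.sum_subsingleton _ l
    rw [hsum] at hr
    refine ⟨D l, dl l, a l, ?_, hM.DG l, hdl l, hl, hda l l, ε, hε, hr⟩
    intro h0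
    have := congrFun (hM.li (fun _ => 1) (by rw [Fintype.sum_subsingleton _ l, h0]; simp)) l
    simp at this

theorem M7b (Ω : Type) [Field Ω] [CharZero Ω] [IsAlgClosed Ω] [Algebra K Ω] [Algebra.IsAlgebraic K Ω] (hG : GD G) :
    ∃ ψ : K ≃+* K, (∀ a, ψ (cc a) = cc a) ∧ ∀ g ∈ G, ∀ f, ψ (g (ψ.symm f)) ∈ CYg K ↔ f ∈ CYg K := by
  obtain ⟨F, n, D, hM⟩ := M5 hG
  obtain ⟨D₀, dΩ, a, hD, hDp, hext, ha, hda, ε, hε, hr⟩ := M7a Ω hG hM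
  have hDc : ∀ a, D₀ (cc a) = 0 := fun a => hDp.1 _ (cc_fixG hG a)
  rcases hε with rfl | rfl
  · have hrz : ∀ i, RatPS (csP D₀ 0 (zz i)) := by
      intro i
      have h1 := hr i
      rw [csP_rescale _ _ hda] at h1
      have h2 := rat_rescale _ ha _ h1
      have h3 := csP_map (algebraMap K Ω) D₀ dΩ hext 0 (zz i)
      rw [map_zero] at h3
      rw [h3] at h2
      exact rat_descend _ h2
    obtain ⟨s, hs, hcl⟩ := L1 D₀ (Set.range cc ∪ Set.range zz) K2_gen (by
      rintro f (⟨a, rfl⟩ | ⟨i, rfl⟩)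
      · have : csP D₀ 0 (cc a : K) = PowerSeries.C (cc a) := by
          have h0 : ∀ m, cs D₀ 0 (cc a : K) (m+1) = 0 := by
            intro m
            induction m with
            | zero => simp [cs, hDc]
            | succ m ih => rw [cs, ih]; simp
          ext m
          cases m with
          | zero => simp [csP, cs]
          | succ m => simp only [csP, PowerSeries.coeff_mk, h0]; rw [PowerSeries.coeff_C]; simp
        rw [this]; exact ratC _
      · exact hrz i) hD
    obtain ⟨ψ, h1, h2⟩ := M1 D₀ hDc s hs hcl
    refine ⟨ψ, h1, fun g hg => h2 g fun f => ?_⟩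
    rw [← hDp.2 g hg]; simp
  · exfalso
    obtain ⟨τ, ⟨f0, hf0⟩, hτ2, hτk, hτc⟩ := L2 D₀ dΩ hext a ha hda (Set.range zz) (by
      rw [eq_top_iff, ← K2_gen]
      apply Subfield.closure_mono
      rintro f (⟨a, rfl⟩ | hz)
      · exact Or.inl (hDc a)
      · exact Or.inr hz) (by rintro f ⟨i, rfl⟩; exact hr i) hD
    let T : K ≃+* K := RingEquiv.ofBijective τ ⟨τ.injective, fun f => ⟨τ f, hτ2 f⟩⟩
    have hT : ∀ f, T f = τ f := fun f => rfl
    have hTG : T ∈ G := hG.cen T (fun c => hτk _ (hDc c)) (fun g hg f => (hτc g (fun f => hDp.2 g hg f) f).symm)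
    exact hf0 (hG.tf T hTG 2 two_pos (fun f => hτ2 f) f0)

instance charz {K : Type} [Field K] [CharZero K] : CharZero (AlgebraicClosure K) := 
  charZero_of_injective_algebraMap (algebraMap K (AlgebraicClosure K)).injective

theorem M7 (hG : GD G) :
    ∃ ψ : K ≃+* K, (∀ a, ψ (cc a) = cc a) ∧ ∀ g ∈ G, ∀ f, ψ (g (ψ.symm f)) ∈ CYg K ↔ f ∈ CYg K := M7b (AlgebraicClosure K) hG

end D14

open MvPolynomial

theorem cc_K2 (a : ℂ) : (cc a : K2) = algebraMap ℂ K2 a := by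
  rw [IsScalarTower.algebraMap_apply ℂ (MvPolynomial (Fin 2) ℂ) K2]; rfl

/-- A maximal abelian uncountable subgroup of the Cremona group either has a
nontrivial element of finite order, or is conjugate to a subgroup of the de
Jonquières group. -/
theorem maximal_abelian_uncountable (G : Subgroup Cremona)
    (habel : ∀ a ∈ G, ∀ b ∈ G, a * b = b * a)
    (hmax : ∀ H : Subgroup Cremona, (∀ a ∈ H, ∀ b ∈ H, a * b = b * a) → G ≤ H → H = G)
    (hunc : ¬ (G : Set Cremona).Countable) :
    (∃ g ∈ G, g ≠ 1 ∧ IsOfFinOrder g) ∨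
    (∃ ψ : Cremona, ∀ g ∈ G, ψ * g * ψ⁻¹ ∈ deJonquieres) := by
  by_cases htor : ∃ g ∈ G, g ≠ 1 ∧ IsOfFinOrder g
  · exact Or.inl htor
  right
  push Not at htor
  let j : Cremona → (K2 ≃+* K2) := fun g => g.toRingEquiv
  have hj : ∀ g f, j g f = g f := fun g f => rfl
  have hmk : ∀ a : K2 ≃+* K2, (∀ c, a (cc c) = cc c) → ∃ a' : Cremona, j a' = a := by
    intro a ha
    refine ⟨AlgEquiv.ofRingEquiv (f := a) (fun r => ?_), ?_⟩
    · have := ha r; rwa [cc_K2] at this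
    · ext f; rfl
  have hGD : GD (j '' (G : Set Cremona)) := {
    fc := by
      rintro _ ⟨g, hg, rfl⟩ a
      rw [hj, cc_K2]; exact g.commutes a
    ab := by
      rintro _ ⟨g, hg, rfl⟩ _ ⟨h, hh, rfl⟩ f
      simp only [hj]
      exact DFunLike.congr_fun (habel g hg h hh) f
    cen := by
      intro a ha hc
      obtain ⟨a, rfl⟩ := hmk a ha
      refine ⟨a, ?_, rfl⟩
      have hca : ∀ g ∈ G, a * g = g * a := by
        intro g hg
        ext1 f
        exact hc (j g) ⟨g, hg, rfl⟩ f
      have hcom : ∀ u ∈ (G : Set Cremona) ∪ {a}, ∀ v ∈ (G : Set Cremona) ∪ {a}, u * v = v * u := by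
        rintro u (hu | rfl) v (hv | rfl)
        · exact habel u hu v hv
        · exact (hca u hu).symm
        · exact hca v hv
        · rfl
      have := hmax (Subgroup.closure ((G : Set Cremona) ∪ {a})) (by
        letI := Subgroup.isMulCommutative_closure hcom
        intro u hu v hv
        exact congrArg Subtype.val (mul_comm' (⟨u, hu⟩ : Subgroup.closure ((G : Set Cremona) ∪ {a})) ⟨v, hv⟩))
        (fun g hg => Subgroup.subset_closure (Or.inl hg))
      rw [SetLike.mem_coe, ← this]
      exact Subgroup.subset_closure (Or.inr rfl)
    tf := by
      rintro _ ⟨g, hg, rfl⟩ n hn h f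
      by_contra hne
      refine htor g hg (by rintro rfl; exact hne rfl) ?_
      rw [isOfFinOrder_iff_pow_eq_one]
      refine ⟨n, hn, ?_⟩
      ext1 f
      have key : ∀ m : ℕ, (g ^ m) f = (j g)^[m] f := by
        intro m
        induction m with
        | zero => rfl
        | succ m ih => rw [Function.iterate_succ_apply', ← ih, pow_succ']; rfl
      rw [key, h]; rfl
    unc := by
      intro h
      apply hunc
      refine Set.countable_of_injective_of_countable_image ?_ h
      intro u _ v _ huv
      ext1 f
      exact RingEquiv.congr_fun huv f }
  obtain ⟨ψ, h1, h2⟩ := M7 hGD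
  obtain ⟨ψ, rfl⟩ := hmk ψ h1
  refine ⟨ψ, fun g hg => ?_⟩
  have hCY : CY = CYg K2 := by
    unfold CY CYg
    congr 2
  have h3 : ∀ f, (ψ * g * ψ⁻¹) f ∈ CY ↔ f ∈ CY := by
    intro f; rw [hCY]; exact h2 (j g) ⟨g, hg, rfl⟩ f
  show CY.map _ = CY
  ext z
  constructor
  · rintro ⟨f, hf, rfl⟩
    exact (h3 f).2 hf
  · intro hz
    refine ⟨(ψ * g * ψ⁻¹).symm z, (h3 _).1 ?_, ?_⟩
    · rwa [AlgEquiv.apply_symm_apply]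
    · exact AlgEquiv.apply_symm_apply _ z
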